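/- arXiv:2006.01405 — 6 statements merged into one kernel-verified Lean document; each statement's English description precedes it below -/
import Mathlib

section
/- Suppose λσ = −1, |d₁| = y*/x*, d₂ = 0, d₅ ≠ 0, Δ > 0 where Δ = (1 − c₂y*/x* − d₄y*/d₁)² − 4d₅(d₃(x*)² + c₁d₁x*), and −1 < c₂y*/x* < 1 − √Δ/2. Then there exist η > 0 and an integer k_min such that for every even k ≥ k_min in the case d₁ = y*/x*, and for every odd k ≥ k_min in the case d₁ = −y*/x*, the map f has an asymptotically stable SR_k-solution (with parameter η) and a saddle SR_k-solution (with parameter η). -/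
open Filter Metric

noncomputable section

/-- Jacobian matrix of a planar map at a point. -/
def jac (T : ℝ × ℝ → ℝ × ℝ) (z : ℝ × ℝ) : Matrix (Fin 2) (Fin 2) ℝ :=
  !![fderiv ℝ (fun p => (T p).1) z (1, 0), fderiv ℝ (fun p => (T p).1) z (0, 1);
     fderiv ℝ (fun p => (T p).2) z (1, 0), fderiv ℝ (fun p => (T p).2) z (0, 1)]

/-- The forward orbit of a point under a planar map. -/
def orbit (f : ℝ × ℝ → ℝ × ℝ) (p : ℝ × ℝ) : Set (ℝ × ℝ) :=
  Set.range fun n : ℕ => f^[n] p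

/-- A periodic orbit (through `p`) is Lyapunov stable if every forward orbit starting
close enough to the orbit stays close to it. -/
def LyapStable (f : ℝ × ℝ → ℝ × ℝ) (p : ℝ × ℝ) : Prop :=
  ∀ ε > 0, ∃ δ > 0, ∀ q : ℝ × ℝ, infDist q (orbit f p) < δ →
    ∀ n : ℕ, infDist (f^[n] q) (orbit f p) < ε

/-- Asymptotic stability: Lyapunov stability together with local attractivity. -/
def AsympStable (f : ℝ × ℝ → ℝ × ℝ) (p : ℝ × ℝ) : Prop :=
  LyapStable f p ∧ ∃ δ > 0, ∀ q : ℝ × ℝ, infDist q (orbit f p) < δ →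
    Tendsto (fun n : ℕ => infDist (f^[n] q) (orbit f p)) atTop (nhds 0)

/-- A periodic point `p` of period `n` is a saddle if the Jacobian of `f^[n]` at `p`
has real eigenvalues `μ₁, μ₂` with `|μ₁| < 1 < |μ₂|`. -/
def IsSaddle (f : ℝ × ℝ → ℝ × ℝ) (n : ℕ) (p : ℝ × ℝ) : Prop :=
  ∃ μ₁ μ₂ : ℝ, μ₁ + μ₂ = Matrix.trace (jac (f^[n]) p) ∧
    μ₁ * μ₂ = (jac (f^[n]) p).det ∧ |μ₁| < 1 ∧ 1 < |μ₂|

/-- The set `N_η = {(x,y) ∈ N : |xy| < η}`. -/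
def Nset (N : Set (ℝ × ℝ)) (η : ℝ) : Set (ℝ × ℝ) := {p ∈ N | |p.1 * p.2| < η}

/-- `z 0, …, z k` are points of an `SR_k`-solution (with parameter `η`). -/
def IsSRSol (f T₁ : ℝ × ℝ → ℝ × ℝ) (N : Set (ℝ × ℝ)) (η : ℝ) (m k : ℕ)
    (z : ℕ → ℝ × ℝ) : Prop :=
  f^[k + m] (z 0) = z 0 ∧
  (∀ j : ℕ, 0 < j → j < k + m → f^[j] (z 0) ≠ z 0) ∧
  (∀ j < k, z (j + 1) = f (z j)) ∧
  (∀ j < k, z j ∈ Nset N η) ∧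
  z 0 = T₁ (z k)

/-- The Taylor expansion of `T₁` at `(0, ys)` has the indicated coefficients. -/
def TaylorExp (T₁ : ℝ × ℝ → ℝ × ℝ) (xs ys c₁ c₂ d₁ d₂ d₃ d₄ d₅ : ℝ) : Prop :=
  ∃ C > 0, ∃ ε > 0, ∀ x v : ℝ, |x| < ε → |v| < ε →
    |(T₁ (x, ys + v)).1 - (xs + c₁ * x + c₂ * v)| ≤ C * (|x| + |v|) ^ 2 ∧
    |(T₁ (x, ys + v)).2 - (d₁ * x + d₂ * v + d₃ * x ^ 2 + d₄ * x * v + d₅ * v ^ 2)|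
      ≤ C * (|x| + |v|) ^ 3

/-! ### Stability of periodic orbits -/

/-- A point whose nearby orbits shadow its own orbit uniformly inherits this from its image. -/
lemma eventually_forall_dist_iterate_lt_of_map {α : Type*} [PseudoMetricSpace α] {f : α → α}
    (hf : Continuous f) {ε : ℝ} (hε : 0 < ε) {x : α} (n : ℕ)
    (h : ∀ᶠ q in nhds (f^[n] x), ∀ i : ℕ, dist (f^[i] q) (f^[i] (f^[n] x)) < ε) :
    ∀ᶠ q in nhds x, ∀ i : ℕ, dist (f^[i] q) (f^[i] x) < ε := by
  induction n generalizing x with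
  | zero => exact h
  | succ n ih =>
    have h1 := hf.continuousAt.eventually (ih (x := f x) h)
    filter_upwards [h1, Metric.ball_mem_nhds x hε] with q hq hq' i
    cases i with
    | zero => exact hq'
    | succ i => exact hq i

/-- Convergence towards the orbit of the image of a point gives convergence towards the orbit
of the point. -/
lemma eventually_tendsto_dist_iterate_of_map {α : Type*} [PseudoMetricSpace α] {f : α → α}
    (hf : Continuous f) {x : α} (n : ℕ)
    (h : ∀ᶠ q in nhds (f^[n] x),
      Tendsto (fun i : ℕ => dist (f^[i] q) (f^[i] (f^[n] x))) atTop (nhds 0)) :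
    ∀ᶠ q in nhds x, Tendsto (fun i : ℕ => dist (f^[i] q) (f^[i] x)) atTop (nhds 0) := by
  have h1 := (hf.iterate n).continuousAt.eventually h
  filter_upwards [h1] with q hq
  simp only [← Function.iterate_add_apply] at hq
  exact (tendsto_add_atTop_iff_nat (f := fun i => dist (f^[i] q) (f^[i] x)) n).1 hq

/-- A periodic point at which some iterate contracts has an asymptotically stable orbit. -/
lemma asympStable_of_contracting {f : ℝ × ℝ → ℝ × ℝ} (hf : Continuous f) {p : ℝ × ℝ} {n : ℕ}
    (hn : 0 < n) (hp : f^[n] p = p) {c : ℝ} (hc0 : 0 ≤ c) (hc : c < 1)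
    (h : ∀ᶠ q in nhds p, dist (f^[n] q) p ≤ c * dist q p) : AsympStable f p := by
  obtain ⟨r, hr, hball⟩ := Metric.eventually_nhds_iff.1 h
  have hpow : ∀ a : ℕ, ∀ q, dist q p < r → dist (f^[n * a] q) p ≤ c ^ a * dist q p := by
    intro a q hq
    induction a with
    | zero => simp
    | succ a ih =>
      have h1 : dist (f^[n * a] q) p < r :=
        lt_of_le_of_lt (ih.trans (mul_le_of_le_one_left dist_nonneg (pow_le_one₀ hc0 hc.le))) hq
      have h2 := hball h1
      rw [← Function.iterate_add_apply] at h2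
      rw [Nat.mul_succ, Nat.add_comm]
      calc _ ≤ _ := h2
        _ ≤ c * (c ^ a * dist q p) := by gcongr
        _ = _ := by ring
  have hfix : ∀ a : ℕ, f^[n * a] p = p := by
    intro a
    rw [Function.iterate_mul]
    exact Function.iterate_fixed hp a
  have hdecomp : ∀ N q, f^[N] q = f^[N % n] (f^[n * (N / n)] q) := by
    intro N q
    rw [← Function.iterate_add_apply, Nat.mod_add_div]
  have hcont : ∀ ε > 0, ∃ δ > 0, ∀ q, dist q p < δ → ∀ i < n, dist (f^[i] q) (f^[i] p) < ε := by
    intro ε hε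
    have : ∀ᶠ q in nhds p, ∀ i ∈ Finset.range n, dist (f^[i] q) (f^[i] p) < ε := by
      rw [Filter.eventually_all_finset]
      intro i _
      exact (hf.iterate i).continuousAt.eventually (Metric.ball_mem_nhds _ hε)
    obtain ⟨δ, hδ, h⟩ := Metric.eventually_nhds_iff.1 this
    exact ⟨δ, hδ, fun q hq i hi => h hq i (Finset.mem_range.2 hi)⟩
  have hS : ∀ ε > 0, ∀ᶠ q in nhds p, ∀ i : ℕ, dist (f^[i] q) (f^[i] p) < ε := by
    intro ε hε
    obtain ⟨δ, hδ, h1⟩ := hcont ε hε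
    filter_upwards [Metric.ball_mem_nhds p (lt_min hδ hr)] with q hq N
    have hq' := lt_min_iff.1 (Metric.mem_ball.1 hq)
    rw [hdecomp N q, hdecomp N p, hfix]
    refine h1 _ (lt_of_le_of_lt ((hpow _ q hq'.2).trans ?_) hq'.1) _ (Nat.mod_lt _ hn)
    exact mul_le_of_le_one_left dist_nonneg (pow_le_one₀ hc0 hc.le)
  have hC : ∀ᶠ q in nhds p, Tendsto (fun i : ℕ => dist (f^[i] q) (f^[i] p)) atTop (nhds 0) := by
    filter_upwards [Metric.ball_mem_nhds p hr] with q hq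
    rw [Metric.tendsto_atTop]
    intro ε hε
    obtain ⟨δ, hδ, h1⟩ := hcont ε hε
    have ht : Tendsto (fun a : ℕ => c ^ a * dist q p) atTop (nhds 0) := by
      simpa using (tendsto_pow_atTop_nhds_zero_of_lt_one hc0 hc).mul_const (dist q p)
    obtain ⟨a, ha⟩ := (ht.eventually (gt_mem_nhds hδ)).exists_forall_of_atTop
    refine ⟨n * a, fun N hN => ?_⟩
    rw [Real.dist_0_eq_abs, abs_of_nonneg dist_nonneg, hdecomp N q, hdecomp N p, hfix]
    refine h1 _ (lt_of_le_of_lt (hpow _ q hq) (ha _ ?_)) _ (Nat.mod_lt _ hn)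
    exact (Nat.le_div_iff_mul_le hn).2 (by rwa [mul_comm] at hN)
  have horb : ∀ x ∈ orbit f p, ∃ i < n, x = f^[i] p := by
    rintro _ ⟨N, rfl⟩
    refine ⟨N % n, Nat.mod_lt _ hn, ?_⟩
    change f^[N] p = _
    rw [hdecomp N p, hfix]
  have hne : (orbit f p).Nonempty := ⟨p, 0, rfl⟩
  have hunif : ∀ S : ℝ × ℝ → ℝ × ℝ → Prop, (∀ i < n, ∀ᶠ q in nhds (f^[i] p), S (f^[i] p) q) →
      ∃ δ > 0, ∀ q, infDist q (orbit f p) < δ → ∃ x ∈ orbit f p, S x q := by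
    intro S hS
    have : ∀ᶠ δ : ℝ in nhdsWithin 0 (Set.Ioi 0), ∀ i ∈ Finset.range n, ∀ q,
        dist q (f^[i] p) < δ → S (f^[i] p) q := by
      rw [Filter.eventually_all_finset]
      intro i hi
      obtain ⟨δ, hδ, h1⟩ := Metric.eventually_nhds_iff.1 (hS i (Finset.mem_range.1 hi))
      filter_upwards [Ioo_mem_nhdsGT hδ] with δ' hδ' q hq
      exact h1 (hq.trans hδ'.2)
    obtain ⟨δ, h1, h2⟩ := (this.and self_mem_nhdsWithin).exists
    refine ⟨δ, h2, fun q hq => ?_⟩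
    obtain ⟨x, hx, hd⟩ := (infDist_lt_iff hne).1 hq
    obtain ⟨i, hi, rfl⟩ := horb x hx
    exact ⟨_, hx, h1 i (Finset.mem_range.2 hi) q hd⟩
  have hle : ∀ x ∈ orbit f p, ∀ q N, infDist (f^[N] q) (orbit f p) ≤ dist (f^[N] q) (f^[N] x) := by
    rintro _ ⟨i, rfl⟩ q N
    exact infDist_le_dist_of_mem ⟨N + i, Function.iterate_add_apply _ _ _ _⟩
  have hback : ∀ i < n, f^[n - i] (f^[i] p) = p := by
    intro i hi
    rw [← Function.iterate_add_apply, Nat.sub_add_cancel hi.le, hp]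
  refine ⟨fun ε hε => ?_, ?_⟩
  · obtain ⟨δ, hδ, h1⟩ := hunif (fun x q => ∀ i : ℕ, dist (f^[i] q) (f^[i] x) < ε) (by
      intro i hi
      apply eventually_forall_dist_iterate_lt_of_map hf hε (n - i)
      rw [hback i hi]
      exact hS ε hε)
    refine ⟨δ, hδ, fun q hq N => ?_⟩
    obtain ⟨x, hx, h2⟩ := h1 q hq
    exact (hle x hx q N).trans_lt (h2 N)
  · obtain ⟨δ, hδ, h1⟩ := hunif
      (fun x q => Tendsto (fun i : ℕ => dist (f^[i] q) (f^[i] x)) atTop (nhds 0)) (by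
      intro i hi
      apply eventually_tendsto_dist_iterate_of_map hf (n - i)
      rw [hback i hi]
      exact hC)
    refine ⟨δ, hδ, fun q hq => ?_⟩
    obtain ⟨x, hx, h2⟩ := h1 q hq
    exact squeeze_zero (fun _ => infDist_nonneg) (hle x hx q) h2

/-- Both roots of a real quadratic satisfying the Jury conditions lie in the open unit disc. -/
lemma exists_complex_roots_norm_lt_one {τ D : ℝ} (h1 : |τ| < 1 + D) (h2 : D < 1) :
    ∃ μ ν : ℂ, μ + ν = τ ∧ μ * ν = D ∧ ‖μ‖ < 1 ∧ ‖ν‖ < 1 := by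
  obtain ⟨h3, h4⟩ := abs_lt.1 h1
  rcases le_total 0 (τ ^ 2 - 4 * D) with hd | hd
  · have hq := Real.sq_sqrt hd
    have hq0 := Real.sqrt_nonneg (τ ^ 2 - 4 * D)
    set q := Real.sqrt (τ ^ 2 - 4 * D)
    have hτ : |τ| < 2 := by linarith
    obtain ⟨h5, h6⟩ := abs_lt.1 hτ
    have hq1 : q < 2 - τ := by nlinarith
    have hq2 : q < 2 + τ := by nlinarith
    refine ⟨((τ + q) / 2 : ℝ), ((τ - q) / 2 : ℝ), ?_, ?_, ?_, ?_⟩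
    · push_cast; ring
    · rw [← Complex.ofReal_mul]; congr 1; nlinarith
    · rw [Complex.norm_real, Real.norm_eq_abs, abs_lt]; constructor <;> linarith
    · rw [Complex.norm_real, Real.norm_eq_abs, abs_lt]; constructor <;> linarith
  · have hd' : 0 ≤ 4 * D - τ ^ 2 := by linarith
    have hq := Real.sq_sqrt hd'
    set q := Real.sqrt (4 * D - τ ^ 2)
    refine ⟨⟨τ / 2, q / 2⟩, ⟨τ / 2, -q / 2⟩, ?_, ?_, ?_, ?_⟩
    · apply Complex.ext <;> simp; ring
    · apply Complex.ext <;> simp <;> nlinarith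
    · rw [← sq_lt_one_iff₀ (norm_nonneg _), Complex.sq_norm, Complex.normSq_mk]; nlinarith
    · rw [← sq_lt_one_iff₀ (norm_nonneg _), Complex.sq_norm, Complex.normSq_mk]; nlinarith

/-- Powers of an element annihilated by a Schur stable quadratic tend to zero. -/
lemma tendsto_pow_zero_of_quadratic {𝔸 : Type*} [NormedRing 𝔸] [NormedAlgebra ℝ 𝔸] {a : 𝔸}
    {τ D : ℝ} (ha : a * a = τ • a - D • (1 : 𝔸)) (h1 : |τ| < 1 + D) (h2 : D < 1) :
    Tendsto (fun n : ℕ => a ^ n) atTop (nhds 0) := by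
  obtain ⟨μ, ν, hs, hp, hμ, hν⟩ := exists_complex_roots_norm_lt_one h1 h2
  let b : ℕ → ℝ := fun n => Nat.rec (motive := fun _ => ℝ × ℝ) (0, 1)
    (fun _ p => (p.2, τ * p.2 - D * p.1)) n |>.1
  have hb0 : b 0 = 0 := rfl
  have hb1 : b 1 = 1 := rfl
  have hb2 : ∀ n, b (n + 2) = τ * b (n + 1) - D * b n := fun n => rfl
  have hpow : ∀ n, a ^ (n + 1) = b (n + 1) • a - (D * b n) • (1 : 𝔸) := by
    intro n
    induction n with
    | zero => simp [hb0, hb1]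
    | succ n ih =>
      rw [pow_succ, ih, hb2, sub_mul, smul_mul_assoc, ha, smul_mul_assoc, one_mul]
      module
  set r := max ‖μ‖ ‖ν‖ with hr
  have hr0 : 0 ≤ r := le_max_of_le_left (norm_nonneg _)
  have hr1 : r < 1 := max_lt hμ hν
  have hrec : ∀ n, (b (n + 1) : ℂ) = μ * b n + ν ^ n := by
    intro n
    induction n with
    | zero => simp [hb0, hb1]
    | succ n ih =>
      rw [hb2]
      push_cast
      rw [← hs, ← hp, pow_succ]
      linear_combination ν * ih
  have hbd : ∀ n, |b (n + 1)| ≤ (n + 1) * r ^ n := by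
    intro n
    induction n with
    | zero => simp [hb1]
    | succ n ih =>
      rw [← Real.norm_eq_abs, ← Complex.norm_real, hrec (n + 1)]
      refine (norm_add_le _ _).trans ?_
      rw [norm_mul, norm_pow, Complex.norm_real, Real.norm_eq_abs]
      have h4 : ‖μ‖ * |b (n + 1)| ≤ r * ((n + 1) * r ^ n) :=
        mul_le_mul (le_max_left _ _) ih (abs_nonneg _) hr0
      have h5 : ‖ν‖ ^ (n + 1) ≤ r ^ (n + 1) :=
        pow_le_pow_left₀ (norm_nonneg _) (le_max_right _ _) _
      push_cast
      calc _ ≤ r * ((n + 1) * r ^ n) + r ^ (n + 1) := add_le_add h4 h5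
        _ = _ := by ring
  have hb : Tendsto b atTop (nhds 0) := by
    rw [← tendsto_add_atTop_iff_nat 1]
    refine squeeze_zero_norm (fun n => hbd n) ?_
    have h3 := (tendsto_self_mul_const_pow_of_lt_one hr0 hr1).add
      (tendsto_pow_atTop_nhds_zero_of_lt_one hr0 hr1)
    rw [add_zero] at h3
    exact h3.congr fun n => by ring
  rw [← tendsto_add_atTop_iff_nat 1]
  have h3 := (((tendsto_add_atTop_iff_nat 1).2 hb).smul_const a).sub
    ((hb.const_mul D).smul_const (1 : 𝔸))
  simp only [zero_smul, mul_zero, sub_zero] at h3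
  exact h3.congr fun n => (hpow n).symm

/-- Entries of the Jacobian matrix in terms of the total derivative. -/
lemma jac_eq_of_hasFDerivAt {T : ℝ × ℝ → ℝ × ℝ} {z : ℝ × ℝ} {A : ℝ × ℝ →L[ℝ] ℝ × ℝ}
    (h : HasFDerivAt T A z) :
    jac T z = !![(A (1, 0)).1, (A (0, 1)).1; (A (1, 0)).2, (A (0, 1)).2] := by
  have h1 : fderiv ℝ (fun p => (T p).1) z = (ContinuousLinearMap.fst ℝ ℝ ℝ).comp A := h.fst.fderiv
  have h2 : fderiv ℝ (fun p => (T p).2) z = (ContinuousLinearMap.snd ℝ ℝ ℝ).comp A := h.snd.fderiv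
  simp [jac, h1, h2]

/-- Trace of a planar linear map. -/
def tr (A : ℝ × ℝ →L[ℝ] ℝ × ℝ) : ℝ := (A (1, 0)).1 + (A (0, 1)).2

/-- Determinant of a planar linear map. -/
def dt (A : ℝ × ℝ →L[ℝ] ℝ × ℝ) : ℝ := (A (1, 0)).1 * (A (0, 1)).2 - (A (0, 1)).1 * (A (1, 0)).2

lemma continuous_tr : Continuous tr := by unfold tr; fun_prop

lemma continuous_dt : Continuous dt := by unfold dt; fun_prop

lemma clm_apply_eq (A : ℝ × ℝ →L[ℝ] ℝ × ℝ) (v : ℝ × ℝ) :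
    A v = v.1 • A (1, 0) + v.2 • A (0, 1) := by
  rw [← A.map_smul, ← A.map_smul, ← A.map_add]
  simp

lemma cayley_hamilton_clm (A : ℝ × ℝ →L[ℝ] ℝ × ℝ) :
    A * A = tr A • A - dt A • (1 : ℝ × ℝ →L[ℝ] ℝ × ℝ) := by
  apply ContinuousLinearMap.ext
  intro v
  change A (A v) = tr A • A v - dt A • v
  rw [clm_apply_eq A (A v), clm_apply_eq A v]
  ext <;> simp [tr, dt] <;> ring

/-- A periodic point satisfying the Jury conditions is asymptotically stable. -/
lemma asympStable_of_jury {f : ℝ × ℝ → ℝ × ℝ} (hf : Continuous f) {p : ℝ × ℝ} {n : ℕ}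
    (hn : 0 < n) (hp : f^[n] p = p) {A : ℝ × ℝ →L[ℝ] ℝ × ℝ} (hA : HasFDerivAt (f^[n]) A p)
    (h1 : |tr A| < 1 + dt A) (h2 : dt A < 1) : AsympStable f p := by
  have ht := tendsto_pow_zero_of_quadratic (cayley_hamilton_clm A) h1 h2
  obtain ⟨a, ha, ha0⟩ := (((tendsto_zero_iff_norm_tendsto_zero.1 ht).eventually
    (gt_mem_nhds (show (0 : ℝ) < 1 / 2 by norm_num))).and (eventually_gt_atTop 0)).exists
  have hfix : f^[n * a] p = p := by
    rw [Function.iterate_mul]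
    exact Function.iterate_fixed hp a
  have hd : HasFDerivAt (f^[n * a]) (A ^ a) p := by
    rw [Function.iterate_mul]
    exact hA.iterate hp a
  refine asympStable_of_contracting hf (Nat.mul_pos hn ha0) hfix (c := 3 / 4) (by norm_num)
    (by norm_num) ?_
  have h3 := hd.isLittleO.def (show (0 : ℝ) < 1 / 4 by norm_num)
  filter_upwards [h3] with q hq
  rw [hfix] at hq
  rw [dist_eq_norm, dist_eq_norm]
  calc ‖f^[n * a] q - p‖ = ‖(f^[n * a] q - p - (A ^ a) (q - p)) + (A ^ a) (q - p)‖ := by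
        rw [sub_add_cancel]
    _ ≤ 1 / 4 * ‖q - p‖ + 1 / 2 * ‖q - p‖ :=
        (norm_add_le _ _).trans (add_le_add hq
          (((A ^ a).le_opNorm _).trans (by gcongr)))
    _ = _ := by ring

/-- A fixed point of an iterate whose characteristic polynomial separates `1` and `-1`
is a saddle. -/
lemma isSaddle_of_trace_det {f : ℝ × ℝ → ℝ × ℝ} {p : ℝ × ℝ} {n : ℕ}
    {A : ℝ × ℝ →L[ℝ] ℝ × ℝ} (hA : HasFDerivAt (f^[n]) A p)
    (h : |1 + dt A| < tr A) : IsSaddle f n p := by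
  obtain ⟨h1, h2⟩ := abs_lt.1 h
  have htr : (jac (f^[n]) p).trace = tr A := by
    rw [jac_eq_of_hasFDerivAt hA, Matrix.trace_fin_two_of]; rfl
  have hdt : (jac (f^[n]) p).det = dt A := by
    rw [jac_eq_of_hasFDerivAt hA, Matrix.det_fin_two_of]; rfl
  unfold IsSaddle
  rw [htr, hdt]
  set τ := tr A
  set D := dt A
  have hτ : 0 < τ := (abs_nonneg _).trans_lt h
  have hd : 0 ≤ τ ^ 2 - 4 * D := by nlinarith [sq_nonneg (1 - D)]
  have hq := Real.sq_sqrt hd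
  have hq0 := Real.sqrt_nonneg (τ ^ 2 - 4 * D)
  set q := Real.sqrt (τ ^ 2 - 4 * D)
  have h3 : 2 - τ < q := by by_contra! h'; nlinarith
  have h4 : τ - 2 < q := by by_contra! h'; nlinarith
  have h5 : q < τ + 2 := by nlinarith
  refine ⟨(τ - q) / 2, (τ + q) / 2, by ring, by nlinarith, ?_, ?_⟩
  · rw [abs_lt]; constructor <;> linarith
  · rw [lt_abs]; left; linarith

/-! ### Lipschitz estimates -/

/-- A `C¹` map on a finite-dimensional space is bounded and Lipschitz on balls. -/
lemma exists_bound_lipschitz_closedBall {E F : Type*} [NormedAddCommGroup E] [NormedSpace ℝ E]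
    [FiniteDimensional ℝ E] [NormedAddCommGroup F] [NormedSpace ℝ F] {g : E → F}
    (hg : ContDiff ℝ 1 g) (R : ℝ) :
    ∃ K > 0, (∀ x ∈ closedBall (0 : E) R, ‖g x‖ ≤ K) ∧
      ∀ x ∈ closedBall (0 : E) R, ∀ y ∈ closedBall (0 : E) R, ‖g x - g y‖ ≤ K * ‖x - y‖ := by
  have hc := isCompact_closedBall (0 : E) R
  obtain ⟨K₁, h1⟩ := hc.exists_bound_of_continuousOn hg.continuous.continuousOn
  obtain ⟨K₂, h2⟩ := hc.exists_bound_of_continuousOn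
    (hg.continuous_fderiv one_ne_zero).continuousOn
  refine ⟨max 1 (max K₁ K₂), lt_of_lt_of_le one_pos (le_max_left _ _), fun x hx =>
    (h1 x hx).trans ((le_max_left _ _).trans (le_max_right _ _)), fun x hx y hy => ?_⟩
  exact (convex_closedBall (0 : E) R).norm_image_sub_le_of_norm_fderiv_le
    (fun z _ => (hg.differentiable one_ne_zero) z)
    (fun z hz => (h2 z hz).trans ((le_max_right _ _).trans (le_max_right _ _))) hy hx

/-- A function vanishing to second order at the origin has small derivative nearby. -/
lemma exists_fderiv_small_of_le_sq {E : Type*} [NormedAddCommGroup E] [NormedSpace ℝ E]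
    {g : E → ℝ} (hg : ContDiff ℝ 1 g) {C : ℝ} (hC : ∀ᶠ z in nhds (0 : E), |g z| ≤ C * ‖z‖ ^ 2) :
    g 0 = 0 ∧ fderiv ℝ g 0 = 0 ∧ ∀ κ > 0, ∃ δ > 0, ∀ z, ‖z‖ < δ → ‖fderiv ℝ g z‖ ≤ κ := by
  have h0 : g 0 = 0 := by simpa using hC.self_of_nhds
  have hO : g =O[nhds 0] fun z => ‖z‖ ^ 2 :=
    Asymptotics.IsBigO.of_bound C (by simpa using hC)
  have hd : HasFDerivAt g (0 : E →L[ℝ] ℝ) 0 := by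
    rw [hasFDerivAt_iff_isLittleO_nhds_zero]
    simp only [zero_add, h0, sub_zero, zero_apply]
    refine hO.trans_isLittleO ?_
    simpa using (Asymptotics.isLittleO_norm_pow_id (E' := E) one_lt_two)
  refine ⟨h0, hd.fderiv, fun κ hκ => ?_⟩
  have hcont := (hg.continuous_fderiv one_ne_zero).continuousAt (x := (0 : E))
  obtain ⟨δ, hδ, h⟩ := Metric.continuousAt_iff.1 hcont κ hκ
  refine ⟨δ, hδ, fun z hz => ?_⟩
  have := h (by simpa using hz : dist z 0 < δ)
  rw [hd.fderiv, dist_zero_right] at this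
  exact this.le

/-- A function vanishing to third order at the origin has a derivative of size `o(‖z‖)`. -/
lemma exists_fderiv_small_of_le_cube {E : Type*} [NormedAddCommGroup E] [NormedSpace ℝ E]
    {g : E → ℝ} (hg : ContDiff ℝ 2 g) {C : ℝ} (hC0 : 0 ≤ C)
    (hC : ∀ᶠ z in nhds (0 : E), |g z| ≤ C * ‖z‖ ^ 3) :
    g 0 = 0 ∧ ∀ κ > 0, ∃ δ > 0, ∀ z, ‖z‖ < δ → ‖fderiv ℝ g z‖ ≤ κ * ‖z‖ := by
  have hg1 : ContDiff ℝ 1 g := hg.of_le (by norm_num)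
  obtain ⟨h0, hd0, -⟩ := exists_fderiv_small_of_le_sq hg1 (C := C) (by
    filter_upwards [hC, Metric.ball_mem_nhds (0 : E) one_pos] with z hz hz1
    refine hz.trans ?_
    have : ‖z‖ ≤ 1 := by simpa using (Metric.mem_ball.1 hz1).le
    gcongr C * ?_
    exact pow_le_pow_of_le_one (norm_nonneg _) this (by norm_num))
  refine ⟨h0, ?_⟩
  have hgd : ContDiff ℝ 1 (fderiv ℝ g) := hg.fderiv_right (by norm_num)
  set A := fderiv ℝ (fderiv ℝ g) 0 with hA
  have hAd : HasFDerivAt (fderiv ℝ g) A 0 := (hgd.differentiable one_ne_zero 0).hasFDerivAt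
  have hsymm : ∀ v w, A v w = A w v :=
    hg.contDiffAt.isSymmSndFDerivAt (by simp)
  have hdiag : ∀ v, A v v = 0 := by
    intro v
    have hline : ∀ t : ℝ, HasDerivAt (fun t : ℝ => t • v) v t := fun t => by
      simpa using (hasDerivAt_id t).smul_const v
    have h1 : ∀ t : ℝ, HasDerivAt (fun t : ℝ => g (t • v)) (fderiv ℝ g (t • v) v) t := fun t =>
      (hg1.differentiable one_ne_zero (t • v)).hasFDerivAt.comp_hasDerivAt t (hline t)
    have h2 : HasDerivAt (fun t : ℝ => fderiv ℝ g (t • v) v) (A v v) 0 := by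
      have hAd' : HasFDerivAt (fderiv ℝ g) A ((0 : ℝ) • v) := by simpa using hAd
      have h3 := hAd'.comp_hasDerivAt (0 : ℝ) (hline 0)
      simpa using h3.clm_apply (hasDerivAt_const (0 : ℝ) v)
    have h3 : Tendsto (fun t : ℝ => fderiv ℝ g (t • v) v / (2 * t)) (nhdsWithin 0 {0}ᶜ)
        (nhds (A v v / 2)) := by
      have h4 := h2.tendsto_slope.div_const 2
      refine h4.congr fun t => ?_
      simp only [slope_def_field, zero_smul, hd0, zero_apply, sub_zero]
      rw [div_div, mul_comm]
    have h4 : Tendsto (fun t : ℝ => g (t • v) / t ^ 2) (nhdsWithin 0 {0}ᶜ)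
        (nhds (A v v / 2)) := by
      refine HasDerivAt.lhopital_zero_nhdsNE (Eventually.of_forall h1)
        (Eventually.of_forall fun t => ?_) ?_ ?_ ?_ h3
      · simpa using hasDerivAt_pow 2 t
      · filter_upwards [self_mem_nhdsWithin] with t ht
        exact mul_ne_zero two_ne_zero ht
      · have := (h1 0).continuousAt.tendsto
        simp only [zero_smul, h0] at this
        exact this.mono_left nhdsWithin_le_nhds
      · have : Tendsto (fun t : ℝ => t ^ 2) (nhds 0) (nhds (0 ^ 2)) :=
          (continuous_pow 2).tendsto 0
        rw [zero_pow two_ne_zero] at this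
        exact this.mono_left nhdsWithin_le_nhds
    have h5 : Tendsto (fun t : ℝ => g (t • v) / t ^ 2) (nhdsWithin 0 {0}ᶜ) (nhds 0) := by
      have hev : ∀ᶠ t in nhds (0 : ℝ), |g (t • v)| ≤ C * ‖t • v‖ ^ 3 := by
        have : Tendsto (fun t : ℝ => t • v) (nhds 0) (nhds 0) := by
          simpa using (hline 0).continuousAt.tendsto
        exact this.eventually hC
      have hlim : Tendsto (fun t : ℝ => C * ‖v‖ ^ 3 * |t|) (nhdsWithin 0 {0}ᶜ) (nhds 0) := by
        have : Tendsto (fun t : ℝ => C * ‖v‖ ^ 3 * |t|) (nhds 0) (nhds (C * ‖v‖ ^ 3 * |0|)) :=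
          (continuous_const.mul continuous_abs).tendsto 0
        simp only [abs_zero, mul_zero] at this
        exact this.mono_left nhdsWithin_le_nhds
      refine squeeze_zero_norm' ?_ hlim
      filter_upwards [hev.filter_mono nhdsWithin_le_nhds, self_mem_nhdsWithin] with t ht ht0
      have ht1 : 0 < |t| := abs_pos.2 ht0
      rw [Real.norm_eq_abs, abs_div, abs_pow, div_le_iff₀ (by positivity)]
      rw [norm_smul, Real.norm_eq_abs] at ht
      calc _ ≤ _ := ht
        _ = _ := by ring
    have := tendsto_nhds_unique h4 h5
    linarith
  have hA0 : A = 0 := by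
    ext v w
    have h1 := hdiag (v + w)
    simp only [map_add, add_apply, hdiag, hsymm w v] at h1
    simp only [zero_apply]
    linarith
  intro κ hκ
  rw [hA0, hasFDerivAt_iff_isLittleO_nhds_zero] at hAd
  obtain ⟨δ, hδ, h⟩ := Metric.eventually_nhds_iff.1 (hAd.def hκ)
  refine ⟨δ, hδ, fun z hz => ?_⟩
  have := h (by simpa using hz : dist z 0 < δ)
  simpa [hd0] using this

/-- Rescaling a function with small derivative near the origin gives a function with small
Lipschitz constant. -/
lemma exists_lipschitz_rescaled {E : Type*} [NormedAddCommGroup E] [NormedSpace ℝ E]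
    {g : E → ℝ} (hg : Differentiable ℝ g) (n : ℕ)
    (h : ∀ κ > 0, ∃ δ > 0, ∀ z, ‖z‖ < δ → ‖fderiv ℝ g z‖ ≤ κ * ‖z‖ ^ n) {ρ κ : ℝ} (hρ : 0 < ρ)
    (hκ : 0 < κ) :
    ∃ ε₀ > 0, ∀ ε : ℝ, ε ≠ 0 → |ε| < ε₀ → ∀ x ∈ closedBall (0 : E) ρ, ∀ y ∈ closedBall (0 : E) ρ,
      |g (ε • x) / ε ^ (n + 1) - g (ε • y) / ε ^ (n + 1)| ≤ κ * ‖x - y‖ := by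
  obtain ⟨δ, hδ, h1⟩ := h (κ / ρ ^ n) (by positivity)
  refine ⟨δ / ρ, by positivity, fun ε hε hε1 x hx y hy => ?_⟩
  have hε2 : |ε| * ρ < δ := (lt_div_iff₀ hρ).1 hε1
  have hε0 : 0 < |ε| := abs_pos.2 hε
  have hmem : ∀ w ∈ closedBall (0 : E) ρ, ε • w ∈ closedBall (0 : E) (|ε| * ρ) := by
    intro w hw
    rw [mem_closedBall_zero_iff] at hw ⊢
    rw [norm_smul, Real.norm_eq_abs]
    gcongr
  have h2 := (convex_closedBall (0 : E) (|ε| * ρ)).norm_image_sub_le_of_norm_fderiv_le (𝕜 := ℝ)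
    (f := g) (C := κ * |ε| ^ n) (fun z _ => hg z) (fun z hz => by
      rw [mem_closedBall_zero_iff] at hz
      refine (h1 z (hz.trans_lt hε2)).trans ?_
      calc κ / ρ ^ n * ‖z‖ ^ n ≤ κ / ρ ^ n * (|ε| * ρ) ^ n := by gcongr
        _ = κ * |ε| ^ n := by rw [mul_pow]; field_simp) (hmem y hy) (hmem x hx)
  rw [← smul_sub, norm_smul, Real.norm_eq_abs, Real.norm_eq_abs] at h2
  rw [← sub_div, abs_div, abs_pow, div_le_iff₀ (by positivity)]
  calc _ ≤ _ := h2
    _ = _ := by ring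

/-- A discrete Gronwall estimate for slowly varying recursions depending on a parameter. -/
lemma recursion_bound_lipschitz {P Q : Type*} [NormedAddCommGroup P] [NormedAddCommGroup Q]
    [NormedSpace ℝ Q] {s : Set P} {H : ℕ → P → Q → Q} {q : ℕ → P → Q} {q₀ : Q} {δ K : ℝ} {k : ℕ}
    (hδ : 0 ≤ δ) (hK : 0 ≤ K) (hk : K * k * δ ≤ 1) (hq₀ : ∀ p, q 0 p = q₀)
    (hq : ∀ j p, q (j + 1) p = q j p + δ • H j p (q j p))
    (hH : ∀ j < k, ∀ p ∈ s, ∀ x ∈ closedBall q₀ 1, ‖H j p x‖ ≤ K)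
    (hHL : ∀ j < k, ∀ p ∈ s, ∀ x ∈ closedBall q₀ 1, ∀ p' ∈ s, ∀ x' ∈ closedBall q₀ 1,
      ‖H j p x - H j p' x'‖ ≤ K * max ‖p - p'‖ ‖x - x'‖) :
    ∀ j ≤ k, (∀ p ∈ s, ‖q j p - q₀‖ ≤ K * j * δ) ∧
      ∀ p ∈ s, ∀ p' ∈ s, ‖q j p - q j p'‖ ≤ K * j * δ * ‖p - p'‖ := by
  intro j
  induction j with
  | zero => simp [hq₀]
  | succ j ih =>
    intro hj
    obtain ⟨h1, h2⟩ := ih (by omega)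
    have hjk : K * j * δ ≤ 1 := by
      refine le_trans ?_ hk
      gcongr
      omega
    have hmem : ∀ p ∈ s, q j p ∈ closedBall q₀ 1 := fun p hp => by
      rw [mem_closedBall, dist_eq_norm]
      exact (h1 p hp).trans hjk
    constructor
    · intro p hp
      rw [hq, add_sub_right_comm]
      refine (norm_add_le _ _).trans ?_
      rw [norm_smul, Real.norm_of_nonneg hδ]
      have := mul_le_mul_of_nonneg_left (hH j (by omega) p hp _ (hmem p hp)) hδ
      push_cast
      linarith [h1 p hp]
    · intro p hp p' hp'
      rw [hq, hq, add_sub_add_comm, ← smul_sub]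
      refine (norm_add_le _ _).trans ?_
      rw [norm_smul, Real.norm_of_nonneg hδ]
      have h3 := hHL j (by omega) p hp _ (hmem p hp) p' hp' _ (hmem p' hp')
      have h4 : max ‖p - p'‖ ‖q j p - q j p'‖ = ‖p - p'‖ :=
        max_eq_left ((h2 p hp p' hp').trans (mul_le_of_le_one_left (norm_nonneg _) hjk))
      rw [h4] at h3
      have := mul_le_mul_of_nonneg_left h3 hδ
      push_cast
      linarith [h2 p hp p' hp']

/-- A map close to an affine map without eigenvalue one has a fixed point. -/
lemma exists_fixedPoint_of_approx {E : Type*} [NormedAddCommGroup E] [NormedSpace ℝ E]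
    [CompleteSpace E] {L : E →L[ℝ] E} (e : E ≃L[ℝ] E) (he : ∀ v, e v = v - L v) {κ r M : ℝ}
    (hr : 0 < r) (hM : ∀ v, ‖e.symm v‖ ≤ M * ‖v‖) (hM0 : 0 < M) (hκ : M * κ ≤ 1 / 2)
    {g : E → E} {p₀ : E}
    (hg : ∀ p ∈ closedBall p₀ r, ∀ p' ∈ closedBall p₀ r, ‖g p - g p' - L (p - p')‖ ≤ κ * ‖p - p'‖)
    (h0 : M * ‖g p₀ - p₀‖ ≤ r / 2) : ∃ p ∈ closedBall p₀ r, g p = p := by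
  let Φ : E → E := fun p => p + e.symm (g p - p)
  have hΦ : ∀ p p', Φ p - Φ p' = e.symm (g p - g p' - L (p - p')) := by
    intro p p'
    have h1 : Φ p - Φ p' = (p - p') + e.symm ((g p - p) - (g p' - p')) := by
      simp only [Φ, map_sub]
      abel
    apply e.injective
    rw [h1, map_add, e.apply_symm_apply, e.apply_symm_apply, he]
    abel
  have hlip : ∀ p ∈ closedBall p₀ r, ∀ p' ∈ closedBall p₀ r,
      ‖Φ p - Φ p'‖ ≤ 1 / 2 * ‖p - p'‖ := by
    intro p hp p' hp'
    rw [hΦ]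
    refine (hM _).trans ?_
    calc _ ≤ M * (κ * ‖p - p'‖) := by gcongr; exact hg p hp p' hp'
      _ = M * κ * ‖p - p'‖ := by ring
      _ ≤ _ := by gcongr
  have hmaps : Set.MapsTo Φ (closedBall p₀ r) (closedBall p₀ r) := by
    intro p hp
    have h1 := hlip p hp p₀ (mem_closedBall_self hr.le)
    have h2 : ‖Φ p₀ - p₀‖ ≤ r / 2 := by
      simp only [Φ, add_sub_cancel_left]
      exact (hM _).trans h0
    rw [mem_closedBall, dist_eq_norm] at hp ⊢
    calc _ = ‖(Φ p - Φ p₀) + (Φ p₀ - p₀)‖ := by rw [sub_add_sub_cancel]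
      _ ≤ 1 / 2 * r + r / 2 := (norm_add_le _ _).trans (add_le_add (h1.trans (by gcongr)) h2)
      _ = r := by ring
  have hcontr : ContractingWith (1 / 2) (Set.MapsTo.restrict Φ _ _ hmaps) := by
    refine ⟨by rw [← NNReal.coe_lt_coe]; norm_num, LipschitzWith.of_dist_le_mul fun x y => ?_⟩
    have := hlip x x.2 y y.2
    rw [Subtype.dist_eq, Subtype.dist_eq, dist_eq_norm, dist_eq_norm]
    simpa using this
  obtain ⟨p, hp, hfix, -⟩ := ContractingWith.exists_fixedPoint' isClosed_closedBall.isComplete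
    hmaps hcontr (mem_closedBall_self hr.le) (edist_ne_top _ _)
  refine ⟨p, hp, ?_⟩
  have h1 : e.symm (g p - p) = 0 := by
    have : p + e.symm (g p - p) = p := hfix
    simpa using this
  exact sub_eq_zero.1 (e.symm.map_eq_zero_iff.1 h1)

/-- A derivative is close to a linear map which the function approximates nearby. -/
lemma norm_sub_le_of_approx {E : Type*} [NormedAddCommGroup E] [NormedSpace ℝ E]
    {L A : E →L[ℝ] E} {κ : ℝ} (hκ : 0 ≤ κ) {s : Set E} {g : E → E} {p : E} (hs : s ∈ nhds p)
    (hg : ∀ p ∈ s, ∀ p' ∈ s, ‖g p - g p' - L (p - p')‖ ≤ κ * ‖p - p'‖)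
    (hA : HasFDerivAt g A p) : ‖A - L‖ ≤ κ := by
  refine (hA.sub L.hasFDerivAt).le_of_lip' hκ ?_
  filter_upwards [hs] with x hx
  have := hg x hx p (mem_of_mem_nhds hs)
  simpa [sub_sub_sub_comm] using this

/-! ### Passage near the saddle -/

lemma exists_mem_of_convex {N : Set (ℝ × ℝ)} {lam sig xs ys : ℝ}
    (hNopen : IsOpen N) (hNconv : Convex ℝ N) (hN0 : ((0 : ℝ), (0 : ℝ)) ∈ N)
    (hlam1 : |lam| < 1) (hls : lam * sig = -1)
    (hp1 : ((xs : ℝ), (0 : ℝ)) ∈ N) (hp2 : ((lam * xs : ℝ), (0 : ℝ)) ∈ N)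
    (hp3 : ((0 : ℝ), ys / sig) ∈ N) (hp4 : ((0 : ℝ), ys / sig ^ 2) ∈ N) :
    ∃ ρ > 1, ∃ M : ℕ, ∀ i l : ℕ, 1 ≤ l → M ≤ i + l → ∀ α β : ℝ, 0 ≤ α → α ≤ ρ → 0 ≤ β → β ≤ ρ →
      (lam ^ i * xs * α, ys * β / sig ^ l) ∈ N := by
  have hexp : ∀ P ∈ N, ∀ᶠ t : ℝ in nhdsWithin 1 (Set.Ioi 1), t • P ∈ N := by
    intro P hP
    have hc : ContinuousAt (fun t : ℝ => t • P) 1 := by fun_prop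
    exact (hc.eventually (hNopen.mem_nhds (by simpa using hP))).filter_mono nhdsWithin_le_nhds
  obtain ⟨ρ₁, ⟨⟨h1, h2⟩, h3, h4⟩, hρ₁⟩ := ((((hexp _ hp1).and (hexp _ hp2)).and
    ((hexp _ hp3).and (hexp _ hp4))).and self_mem_nhdsWithin).exists
  have hρ₁ : 1 < ρ₁ := hρ₁
  have hρ₁0 : 0 < ρ₁ := by linarith
  have hsig : sig ≠ 0 := by rintro rfl; simp at hls
  set ρ := Real.sqrt ρ₁ with hρ
  have hρ1 : 1 < ρ := by rw [hρ, Real.lt_sqrt (by norm_num)]; simpa using hρ₁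
  have hρρ : ρ * ρ = ρ₁ := Real.mul_self_sqrt hρ₁0.le
  obtain ⟨n₀, hn₀⟩ := exists_pow_lt_of_lt_one (sub_pos.2 hρ1) hlam1
  have hcomb : ∀ u ∈ N, ∀ v ∈ N, ∀ a b : ℝ, 0 ≤ a → 0 ≤ b → a + b ≤ 1 → a • u + b • v ∈ N := by
    intro u hu v hv a b ha hb hab
    rcases (add_nonneg ha hb).eq_or_lt' with h0 | h0
    · have ha0 : a = 0 := by linarith
      have hb0 : b = 0 := by linarith
      rw [ha0, hb0, zero_smul, zero_smul, add_zero]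
      exact hN0
    · have h5 : (a / (a + b)) • u + (b / (a + b)) • v ∈ N :=
        hNconv hu hv (by positivity) (by positivity) (by field_simp)
      have h6 := hNconv.smul_mem_of_zero_mem hN0 h5 ⟨h0.le, hab⟩
      rw [smul_add, smul_smul, smul_smul, mul_div_cancel₀ _ h0.ne', mul_div_cancel₀ _ h0.ne'] at h6
      exact h6
  have habs : 0 ≤ |lam| := abs_nonneg lam
  have hX : ∀ i : ℕ, ∃ P : ℝ, ρ₁ • ((P, 0) : ℝ × ℝ) ∈ N ∧ ∃ a, 0 ≤ a ∧ a ≤ |lam| ^ (i - 1) ∧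
      lam ^ i * xs = a * P := by
    intro i
    rcases Nat.even_or_odd i with hi | ⟨n, rfl⟩
    · refine ⟨xs, h1, lam ^ i, hi.pow_nonneg _, ?_, rfl⟩
      rw [← hi.pow_abs]
      exact pow_le_pow_of_le_one habs hlam1.le (by omega)
    · refine ⟨lam * xs, h2, lam ^ (2 * n), (even_two_mul n).pow_nonneg _, ?_, by ring⟩
      rw [← (even_two_mul n).pow_abs]
      exact pow_le_pow_of_le_one habs hlam1.le (by omega)
  have hinv : ∀ n : ℕ, lam ^ (2 * n) * sig ^ (2 * n) = 1 := fun n => by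
    rw [← mul_pow, hls, (even_two_mul n).neg_one_pow]
  have hY : ∀ l : ℕ, 1 ≤ l → ∃ P : ℝ, ρ₁ • ((0, P) : ℝ × ℝ) ∈ N ∧ ∃ b, 0 ≤ b ∧
      b ≤ |lam| ^ (l - 2) ∧ ys / sig ^ l = b * P := by
    intro l hl
    rcases Nat.even_or_odd' l with ⟨n, rfl | rfl⟩
    · obtain ⟨n, rfl⟩ : ∃ n', n = n' + 1 := ⟨n - 1, by omega⟩
      refine ⟨ys / sig ^ 2, h4, lam ^ (2 * n), (even_two_mul n).pow_nonneg _, ?_, ?_⟩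
      · rw [← (even_two_mul n).pow_abs]
        exact pow_le_pow_of_le_one habs hlam1.le (by omega)
      · rw [show 2 * (n + 1) = 2 * n + 2 by ring, pow_add]
        field_simp
        linear_combination -ys * hinv n
    · refine ⟨ys / sig, h3, lam ^ (2 * n), (even_two_mul n).pow_nonneg _, ?_, ?_⟩
      · rw [← (even_two_mul n).pow_abs]
        exact pow_le_pow_of_le_one habs hlam1.le (by omega)
      · rw [pow_succ]
        field_simp
        linear_combination -ys * hinv n
  refine ⟨ρ, hρ1, 2 * n₀ + 4, fun i l hl hil α β hα0 hα hβ0 hβ => ?_⟩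
  obtain ⟨P, hP, a, ha0, ha, hPa⟩ := hX i
  obtain ⟨P', hP', b, hb0, hb, hPb⟩ := hY l hl
  have hab : a + b ≤ ρ := by
    have hle1 : ∀ n : ℕ, |lam| ^ n ≤ 1 := fun n => pow_le_one₀ habs hlam1.le
    by_cases hi : i ≤ n₀
    · have : |lam| ^ (l - 2) ≤ |lam| ^ n₀ := pow_le_pow_of_le_one habs hlam1.le (by omega)
      linarith [hle1 (i - 1)]
    · have : |lam| ^ (i - 1) ≤ |lam| ^ n₀ := pow_le_pow_of_le_one habs hlam1.le (by omega)
      linarith [hle1 (l - 2)]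
  have h5 := hcomb _ hP _ hP' (a * α / ρ₁) (b * β / ρ₁) (by positivity) (by positivity) (by
    rw [← add_div, div_le_one hρ₁0, ← hρρ]
    calc a * α + b * β ≤ a * ρ + b * ρ := by gcongr
      _ = (a + b) * ρ := by ring
      _ ≤ ρ * ρ := by gcongr)
  convert h5 using 1
  ext
  · simp only [Prod.smul_mk, smul_eq_mul, Prod.mk_add_mk, mul_zero, add_zero]
    rw [hPa]
    field_simp
  · simp only [Prod.smul_mk, smul_eq_mul, Prod.mk_add_mk, mul_zero, zero_add]
    rw [mul_div_right_comm, hPb]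
    field_simp

/-- Affine coordinates adapted to the entry point of the passage near the saddle. -/
def entryPoint (xs ys s ε : ℝ) (p : ℝ × ℝ) : ℝ × ℝ := (xs + ε * p.1, s * ε * (ys + ε * p.2))

/-- The relative increment of the multipliers along the passage near the saddle. -/
def increment (P Q : ℝ × ℝ → ℝ) (xs ys : ℝ) (z : (ℝ × ℝ × ℝ) × (ℝ × ℝ) × (ℝ × ℝ)) : ℝ × ℝ :=
  (z.2.2.1 * ((xs + z.1.1 * z.2.1.1) * (ys + z.1.1 * z.2.1.2) * z.2.2.1 * z.2.2.2) ^ 2 *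
      P (z.1.2.1 * (xs + z.1.1 * z.2.1.1) * z.2.2.1, z.1.2.2 * (ys + z.1.1 * z.2.1.2) * z.2.2.2),
    z.2.2.2 * ((xs + z.1.1 * z.2.1.1) * (ys + z.1.1 * z.2.1.2) * z.2.2.1 * z.2.2.2) ^ 2 *
      Q (z.1.2.1 * (xs + z.1.1 * z.2.1.1) * z.2.2.1, z.1.2.2 * (ys + z.1.1 * z.2.1.2) * z.2.2.2))

lemma contDiff_increment {P Q : ℝ × ℝ → ℝ} (hP : ContDiff ℝ 1 P) (hQ : ContDiff ℝ 1 Q)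
    (xs ys : ℝ) : ContDiff ℝ 1 (increment P Q xs ys) := by
  unfold increment
  fun_prop

/-- The passage near the saddle, in rescaled coordinates, is close to the identity together with
its Lipschitz constant. -/
lemma iterate_entryPoint {f : ℝ × ℝ → ℝ × ℝ} {P Q : ℝ × ℝ → ℝ} {lam sig xs ys s : ℝ}
    {N : Set (ℝ × ℝ)} (hP : ContDiff ℝ 1 P) (hQ : ContDiff ℝ 1 Q)
    (hlam0 : 0 < |lam|) (hlam1 : |lam| < 1)
    (hNopen : IsOpen N) (hNconv : Convex ℝ N) (hN0 : ((0 : ℝ), (0 : ℝ)) ∈ N)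
    (hfN : ∀ p ∈ N, f p =
      (lam * p.1 * (1 + p.1 ^ 2 * p.2 ^ 2 * P p), sig * p.2 * (1 + p.1 ^ 2 * p.2 ^ 2 * Q p)))
    (hxs : 0 < xs) (hys : 0 < ys)
    (hp1 : ((xs : ℝ), (0 : ℝ)) ∈ N) (hp2 : ((lam * xs : ℝ), (0 : ℝ)) ∈ N)
    (hp3 : ((0 : ℝ), ys / sig) ∈ N) (hp4 : ((0 : ℝ), ys / sig ^ 2) ∈ N)
    (hls : lam * sig = -1) {R δ : ℝ} (hδ : 0 < δ) :
    ∀ᶠ k : ℕ in atTop, (-1) ^ k = s → ∃ e : ℝ × ℝ → ℝ × ℝ,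
      (∀ p ∈ closedBall (0 : ℝ × ℝ) R, ‖e p‖ ≤ δ) ∧
      (∀ p ∈ closedBall (0 : ℝ × ℝ) R, ∀ p' ∈ closedBall (0 : ℝ × ℝ) R,
        ‖e p - e p'‖ ≤ δ * ‖p - p'‖) ∧
      ∀ p ∈ closedBall (0 : ℝ × ℝ) R,
        f^[k] (entryPoint xs ys s (lam ^ k) p) =
          (lam ^ k * ((xs + lam ^ k * p.1) * (1 + lam ^ k * (e p).1)),
            ys + lam ^ k * (p.2 * (1 + lam ^ k * (e p).2) + ys * (e p).2)) ∧
        (∀ j < k, f^[j] (entryPoint xs ys s (lam ^ k) p) ∈ Nset N 1) ∧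
        ∀ j, 0 < j → j ≤ k →
          f^[j] (entryPoint xs ys s (lam ^ k) p) ≠ entryPoint xs ys s (lam ^ k) p := by
  obtain ⟨ρ, hρ, M, hM⟩ := exists_mem_of_convex hNopen hNconv hN0 hlam1 hls hp1 hp2 hp3 hp4
  obtain ⟨K, hK, hK1, hK2⟩ := exists_bound_lipschitz_closedBall
    (contDiff_increment hP hQ xs ys) (max R 2)
  obtain ⟨τ, ⟨⟨hτρ, hτlam⟩, hτ1⟩, hτ0⟩ : ∃ τ : ℝ,
      (((1 + τ) ^ 2 < ρ ∧ |lam| * (1 + τ) < 1) ∧ τ < 1) ∧ 0 < τ := by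
    have h1 : ∀ᶠ τ : ℝ in nhds 0, (1 + τ) ^ 2 < ρ :=
      (show ContinuousAt (fun τ : ℝ => (1 + τ) ^ 2) 0 by fun_prop).eventually_lt_const
        (by simpa using hρ)
    have h2 : ∀ᶠ τ : ℝ in nhds 0, |lam| * (1 + τ) < 1 :=
      (show ContinuousAt (fun τ : ℝ => |lam| * (1 + τ)) 0 by fun_prop).eventually_lt_const
        (by simpa using hlam1)
    exact ((((h1.and h2).and (gt_mem_nhds one_pos)).filter_mono nhdsWithin_le_nhds).and
      (self_mem_nhdsWithin (s := Set.Ioi (0 : ℝ)))).exists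
  have ht0 := tendsto_pow_atTop_nhds_zero_of_lt_one hlam0.le hlam1
  have ht1 := (tendsto_self_mul_const_pow_of_lt_one hlam0.le hlam1).const_mul K
  rw [mul_zero] at ht1
  have ht2 := ht0.mul_const R
  have ht3 := ht0.mul_const (xs * ys * ρ ^ 2)
  rw [zero_mul] at ht2 ht3
  filter_upwards [eventually_ge_atTop M, ht1.eventually_lt_const hδ, ht1.eventually_lt_const hτ0,
    ht2.eventually_lt_const (mul_pos hτ0 hxs), ht2.eventually_lt_const (mul_pos hτ0 hys),
    ht3.eventually_lt_const one_pos] with k hkM hkδ hkτ hkx hky hk1 hks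
  rw [← abs_pow] at hkδ hkτ hkx hky hk1
  set ε := lam ^ k with hε
  have hlam : lam ≠ 0 := abs_pos.1 hlam0
  have hsig : sig ≠ 0 := by rintro rfl; simp at hls
  have hε0 : ε ≠ 0 := pow_ne_zero _ hlam
  have hεpos : 0 < |ε| := abs_pos.2 hε0
  have hε1 : |ε| ≤ 1 := by rw [hε, abs_pow]; exact pow_le_one₀ hlam0.le hlam1.le
  have hs : s * s = 1 := by rw [← hks, ← mul_pow]; simp
  have hsigk : ∀ j ≤ k, s * sig ^ j * ε * sig ^ (k - j) = 1 := by
    intro j hj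
    calc s * sig ^ j * ε * sig ^ (k - j) = s * (lam ^ k * (sig ^ j * sig ^ (k - j))) := by
          rw [hε]; ring
      _ = 1 := by rw [← pow_add, Nat.add_sub_cancel' hj, ← mul_pow, hls, hks, hs]
  have hν : ∀ j ≤ k, |s * sig ^ j * ε| ≤ 1 := by
    intro j hj
    have h1 : s * sig ^ j * ε = (-lam) ^ (k - j) := by
      have h2 : (-lam) ^ (k - j) * sig ^ (k - j) = 1 := by
        rw [← mul_pow, neg_mul, hls, neg_neg, one_pow]
      exact mul_right_cancel₀ (pow_ne_zero _ hsig) ((hsigk j hj).trans h2.symm)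
    rw [h1, abs_pow, abs_neg]
    exact pow_le_one₀ hlam0.le hlam1.le
  let q : ℕ → ℝ × ℝ → ℝ × ℝ := fun j p => Nat.rec (motive := fun _ => ℝ × ℝ) (1, 1)
    (fun j x => x + ε ^ 2 • increment P Q xs ys ((ε, lam ^ j, s * sig ^ j * ε), p, x)) j
  have hq0 : ∀ p, q 0 p = (1, 1) := fun p => rfl
  have hqs : ∀ j p, q (j + 1) p =
      q j p + ε ^ 2 • increment P Q xs ys ((ε, lam ^ j, s * sig ^ j * ε), p, q j p) :=
    fun j p => rfl
  have hball : ∀ j < k, ∀ p ∈ closedBall (0 : ℝ × ℝ) R, ∀ x ∈ closedBall ((1, 1) : ℝ × ℝ) 1,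
      (((ε, lam ^ j, s * sig ^ j * ε), p, x) : (ℝ × ℝ × ℝ) × (ℝ × ℝ) × (ℝ × ℝ)) ∈
        closedBall 0 (max R 2) := by
    intro j hj p hp x hx
    rw [mem_closedBall_zero_iff] at hp ⊢
    rw [mem_closedBall, dist_eq_norm] at hx
    have hx2 : ‖x‖ ≤ 2 := by
      calc ‖x‖ = ‖(x - (1, 1)) + (1, 1)‖ := by rw [sub_add_cancel]
        _ ≤ 1 + 1 := (norm_add_le _ _).trans (add_le_add hx (by simp [Prod.norm_def]))
        _ = 2 := by norm_num
    have h2 : |lam ^ j| ≤ 1 := by rw [abs_pow]; exact pow_le_one₀ hlam0.le hlam1.le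
    have h3 := hν j hj.le
    have h4 : (2 : ℝ) ≤ max R 2 := le_max_right _ _
    have h5 : R ≤ max R 2 := le_max_left _ _
    simp only [Prod.norm_mk, Real.norm_eq_abs, sup_le_iff]
    refine ⟨⟨?_, ?_, ?_⟩, ?_, ?_⟩ <;> linarith
  have hKk : K * k * ε ^ 2 ≤ K * (k * |ε|) := by
    rw [mul_assoc, ← sq_abs ε]
    gcongr
    nlinarith
  have hmain := recursion_bound_lipschitz (s := closedBall (0 : ℝ × ℝ) R) (k := k) (sq_nonneg ε)
    hK.le (by linarith) hq0 hqs (fun j hj p hp x hx => hK1 _ (hball j hj p hp x hx))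
    (fun j hj p hp x hx p' hp' x' hx' => by
      refine (hK2 _ (hball j hj p hp x hx) _ (hball j hj p' hp' x' hx')).trans (le_of_eq ?_)
      simp [Prod.norm_def])
  have hqτ : ∀ j ≤ k, ∀ p ∈ closedBall (0 : ℝ × ℝ) R, ‖q j p - (1, 1)‖ ≤ τ := by
    intro j hj p hp
    refine ((hmain j hj).1 p hp).trans ?_
    calc K * j * ε ^ 2 ≤ K * k * ε ^ 2 := by gcongr
      _ ≤ τ := by linarith
  have hcoord : ∀ j ≤ k, ∀ p ∈ closedBall (0 : ℝ × ℝ) R,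
      (0 < (q j p).1 ∧ (q j p).1 ≤ 1 + τ) ∧ 0 < (q j p).2 ∧ (q j p).2 ≤ 1 + τ := by
    intro j hj p hp
    have h1 := hqτ j hj p hp
    rw [Prod.norm_def, sup_le_iff] at h1
    obtain ⟨h2, h3⟩ := h1
    simp only [Prod.fst_sub, Prod.snd_sub, Real.norm_eq_abs] at h2 h3
    rw [abs_le] at h2 h3
    refine ⟨⟨?_, ?_⟩, ?_, ?_⟩ <;> linarith [h2.1, h2.2, h3.1, h3.2]
  have hp12 : ∀ p ∈ closedBall (0 : ℝ × ℝ) R, (0 < 1 + ε * p.1 / xs ∧ 1 + ε * p.1 / xs ≤ 1 + τ) ∧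
      0 < 1 + ε * p.2 / ys ∧ 1 + ε * p.2 / ys ≤ 1 + τ := by
    intro p hp
    rw [mem_closedBall_zero_iff, Prod.norm_def, sup_le_iff] at hp
    have aux : ∀ t a : ℝ, 0 < a → ‖t‖ ≤ R → |ε| * R < τ * a →
        0 < 1 + ε * t / a ∧ 1 + ε * t / a ≤ 1 + τ := by
      intro t a ha ht hR
      have h1 : |ε * t / a| ≤ τ := by
        rw [abs_div, abs_mul, abs_of_pos ha, div_le_iff₀ ha]
        refine le_trans ?_ hR.le
        gcongr
        exact ht
      rw [abs_le] at h1
      constructor <;> linarith [h1.1, h1.2]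
    exact ⟨aux _ _ hxs hp.1 hkx, aux _ _ hys hp.2 hky⟩
  have hform : ∀ p, ∀ j ≤ k,
      ((lam ^ j * (xs + ε * p.1) * (q j p).1, s * sig ^ j * ε * (ys + ε * p.2) * (q j p).2) :
        ℝ × ℝ) = (lam ^ j * xs * ((1 + ε * p.1 / xs) * (q j p).1),
          ys * ((1 + ε * p.2 / ys) * (q j p).2) / sig ^ (k - j)) := by
    intro p j hj
    have h1 := hsigk j hj
    have hxs' := hxs.ne'
    have hys' := hys.ne'
    ext
    · field_simp
    · have h2 : s * sig ^ j * ε = 1 / sig ^ (k - j) := by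
        rw [eq_div_iff (pow_ne_zero _ hsig), h1]
      simp only
      rw [h2]
      field_simp
  have hprod : ∀ u v : ℝ, 0 < u → u ≤ 1 + τ → 0 < v → v ≤ 1 + τ → u * v ≤ ρ := by
    intro u v hu hu1 hv hv1
    calc u * v ≤ (1 + τ) * (1 + τ) := by gcongr
      _ ≤ ρ := by linarith [sq (1 + τ)]
  have hmem : ∀ p ∈ closedBall (0 : ℝ × ℝ) R, ∀ j < k,
      ((lam ^ j * (xs + ε * p.1) * (q j p).1, s * sig ^ j * ε * (ys + ε * p.2) * (q j p).2) :
        ℝ × ℝ) ∈ N := by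
    intro p hp j hj
    obtain ⟨⟨h1, h2⟩, h3, h4⟩ := hcoord j hj.le p hp
    obtain ⟨⟨h5, h6⟩, h7, h8⟩ := hp12 p hp
    rw [hform p j hj.le]
    exact hM j (k - j) (by omega) (by omega) _ _ (by positivity) (hprod _ _ h5 h6 h1 h2)
      (by positivity) (hprod _ _ h7 h8 h3 h4)
  have hiter : ∀ p ∈ closedBall (0 : ℝ × ℝ) R, ∀ j ≤ k, f^[j] (entryPoint xs ys s ε p) =
      (lam ^ j * (xs + ε * p.1) * (q j p).1, s * sig ^ j * ε * (ys + ε * p.2) * (q j p).2) := by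
    intro p hp j
    induction j with
    | zero => intro _; simp [entryPoint, hq0]
    | succ j ih =>
      intro hj
      have hsq : (lam ^ j * (s * sig ^ j)) ^ 2 = 1 := by
        have : lam ^ j * (s * sig ^ j) = s * (-1) ^ j := by rw [← hls, mul_pow]; ring
        rw [this, mul_pow, ← pow_mul, mul_comm j 2, pow_mul, neg_one_sq, one_pow, mul_one, sq, hs]
      have hsq' : (lam ^ j * (xs + ε * p.1) * (q j p).1) ^ 2 *
          (s * sig ^ j * ε * (ys + ε * p.2) * (q j p).2) ^ 2 =
          ε ^ 2 * ((xs + ε * p.1) * (ys + ε * p.2) * (q j p).1 * (q j p).2) ^ 2 := by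
        linear_combination
          (ε ^ 2 * ((xs + ε * p.1) * (ys + ε * p.2) * (q j p).1 * (q j p).2) ^ 2) * hsq
      rw [Function.iterate_succ_apply', ih (by omega), hfN _ (hmem p hp j (by omega)), hqs]
      simp only [hsq']
      ext
      · simp only [increment, Prod.fst_add, Prod.smul_fst, smul_eq_mul]
        ring
      · simp only [increment, Prod.snd_add, Prod.smul_snd, smul_eq_mul]
        ring
  refine ⟨fun p => ε⁻¹ • (q k p - (1, 1)), fun p hp => ?_, fun p hp p' hp' => ?_, fun p hp => ?_⟩
  · rw [norm_smul, norm_inv, Real.norm_eq_abs, inv_mul_le_iff₀ hεpos]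
    refine ((hmain k le_rfl).1 p hp).trans ?_
    rw [← sq_abs ε]
    nlinarith
  · rw [← smul_sub, sub_sub_sub_cancel_right, norm_smul, norm_inv, Real.norm_eq_abs,
      inv_mul_le_iff₀ hεpos]
    refine ((hmain k le_rfl).2 p hp p' hp').trans ?_
    rw [← mul_assoc]
    refine mul_le_mul_of_nonneg_right ?_ (norm_nonneg _)
    rw [← sq_abs ε]
    nlinarith
  · refine ⟨?_, fun j hj => ?_, fun j hj0 hj => ?_⟩
    · have h1 := hsigk k le_rfl
      rw [Nat.sub_self, pow_zero, mul_one] at h1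
      rw [hiter p hp k le_rfl, h1, ← hε]
      ext
      · simp only [Prod.smul_fst, Prod.fst_sub, smul_eq_mul]
        field_simp
        ring
      · simp only [Prod.smul_snd, Prod.snd_sub, smul_eq_mul]
        field_simp
        ring
    · rw [hiter p hp j hj.le]
      refine ⟨hmem p hp j hj, ?_⟩
      obtain ⟨⟨h1, h2⟩, h3, h4⟩ := hcoord j hj.le p hp
      obtain ⟨⟨h5, h6⟩, h7, h8⟩ := hp12 p hp
      have h9 : |(lam ^ j * (xs + ε * p.1) * (q j p).1) *
          (s * sig ^ j * ε * (ys + ε * p.2) * (q j p).2)| = |ε| * (xs * ys *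
            (((1 + ε * p.1 / xs) * (q j p).1) * ((1 + ε * p.2 / ys) * (q j p).2))) := by
        have h10 : (lam ^ j * (xs + ε * p.1) * (q j p).1) *
          (s * sig ^ j * ε * (ys + ε * p.2) * (q j p).2) = (s * (-1) ^ j) * (ε * (xs * ys *
            (((1 + ε * p.1 / xs) * (q j p).1) * ((1 + ε * p.2 / ys) * (q j p).2)))) := by
          rw [← hls, mul_pow]
          field_simp
        have h11 : |s * (-1) ^ j| = 1 := by
          rw [← hks, ← pow_add, abs_pow, abs_neg, abs_one, one_pow]
        have h12 : 0 < xs * ys *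
            (((1 + ε * p.1 / xs) * (q j p).1) * ((1 + ε * p.2 / ys) * (q j p).2)) := by positivity
        rw [h10, abs_mul, h11, one_mul, abs_mul, abs_of_pos h12]
      rw [h9]
      refine lt_of_le_of_lt ?_ hk1
      have h12 := hprod _ _ h5 h6 h1 h2
      have h13 := hprod _ _ h7 h8 h3 h4
      have h14 : ((1 + ε * p.1 / xs) * (q j p).1) * ((1 + ε * p.2 / ys) * (q j p).2) ≤ ρ * ρ := by
        gcongr
      rw [sq]
      gcongr
    · rw [hiter p hp j hj]
      intro heq
      have h1 := congrArg Prod.fst heq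
      simp only [entryPoint] at h1
      obtain ⟨⟨h2, h3⟩, -⟩ := hcoord j hj p hp
      obtain ⟨⟨h5, h6⟩, -⟩ := hp12 p hp
      have h7 : xs + ε * p.1 ≠ 0 := by
        have : xs + ε * p.1 = xs * (1 + ε * p.1 / xs) := by field_simp
        rw [this]
        positivity
      have h8 : lam ^ j * (q j p).1 = 1 := by
        apply mul_right_cancel₀ h7
        linear_combination h1
      have h9 : |lam ^ j * (q j p).1| < 1 := by
        rw [abs_mul, abs_of_pos h2, abs_pow]
        refine lt_of_le_of_lt ?_ hτlam
        gcongr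
        exact pow_le_of_le_one hlam0.le hlam1.le hj0.ne'
      rw [h8, abs_one] at h9
      exact lt_irrefl _ h9

/-! ### The rescaled return map -/

/-- The inverse of `entryPoint`. -/
def entryCoord (xs ys s ε : ℝ) (z : ℝ × ℝ) : ℝ × ℝ := ((z.1 - xs) / ε, (s * z.2 / ε - ys) / ε)

lemma entryPoint_entryCoord {xs ys s ε : ℝ} (hε : ε ≠ 0) (hs : s * s = 1) (z : ℝ × ℝ) :
    entryPoint xs ys s ε (entryCoord xs ys s ε z) = z := by
  ext
  · simp only [entryCoord, entryPoint]
    field_simp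
    ring
  · simp only [entryCoord, entryPoint]
    field_simp
    linear_combination z.2 * hs

/-- The exit point of the passage near the saddle, in rescaled coordinates. -/
def exitCoord (xs ys : ℝ) (z : ℝ × (ℝ × ℝ) × (ℝ × ℝ)) : ℝ × ℝ :=
  ((xs + z.1 * z.2.1.1) * (1 + z.1 * z.2.2.1), z.2.1.2 * (1 + z.1 * z.2.2.2) + ys * z.2.2.2)

lemma contDiff_exitCoord (xs ys : ℝ) : ContDiff ℝ 1 (exitCoord xs ys) := by
  unfold exitCoord
  fun_prop

/-- The return map in rescaled coordinates, without the Taylor remainders of the global map. -/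
def returnMap (xs ys s c₁ c₂ d₃ d₄ d₅ : ℝ) (z : ℝ × (ℝ × ℝ) × (ℝ × ℝ)) : ℝ × ℝ :=
  (c₁ * (exitCoord xs ys z).1 + c₂ * (exitCoord xs ys z).2,
    ys / xs * (z.2.1.1 * (1 + z.1 * z.2.2.1) + xs * z.2.2.1) +
      s * (d₃ * (exitCoord xs ys z).1 ^ 2 + d₄ * (exitCoord xs ys z).1 * (exitCoord xs ys z).2 +
        d₅ * (exitCoord xs ys z).2 ^ 2))

lemma contDiff_returnMap (xs ys s c₁ c₂ d₃ d₄ d₅ : ℝ) :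
    ContDiff ℝ 1 (returnMap xs ys s c₁ c₂ d₃ d₄ d₅) := by
  have := contDiff_exitCoord xs ys
  unfold returnMap
  fun_prop

/-- Taylor remainder of the first component of the global map. -/
def remFst (T : ℝ × ℝ → ℝ × ℝ) (xs ys c₁ c₂ : ℝ) (z : ℝ × ℝ) : ℝ :=
  (T (z.1, ys + z.2)).1 - (xs + c₁ * z.1 + c₂ * z.2)

/-- Taylor remainder of the second component of the global map. -/
def remSnd (T : ℝ × ℝ → ℝ × ℝ) (ys d₁ d₂ d₃ d₄ d₅ : ℝ) (z : ℝ × ℝ) : ℝ :=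
  (T (z.1, ys + z.2)).2 -
    (d₁ * z.1 + d₂ * z.2 + d₃ * z.1 ^ 2 + d₄ * z.1 * z.2 + d₅ * z.2 ^ 2)

/-- The rescaled Taylor remainders. -/
def remScaled (T : ℝ × ℝ → ℝ × ℝ) (xs ys s c₁ c₂ d₁ d₂ d₃ d₄ d₅ ε : ℝ) (z : ℝ × ℝ) : ℝ × ℝ :=
  (remFst T xs ys c₁ c₂ (ε • z) / ε ^ (0 + 1),
    s * (remSnd T ys d₁ d₂ d₃ d₄ d₅ (ε • z) / ε ^ (1 + 1)))

lemma remScaled_lipschitz {T : ℝ × ℝ → ℝ × ℝ} {xs ys s c₁ c₂ d₁ d₂ d₃ d₄ d₅ : ℝ}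
    (hT : ContDiff ℝ 2 T) (hs : s * s = 1) (hTay : TaylorExp T xs ys c₁ c₂ d₁ d₂ d₃ d₄ d₅) :
    (∀ ε, remScaled T xs ys s c₁ c₂ d₁ d₂ d₃ d₄ d₅ ε 0 = 0) ∧ ∀ ρ > 0, ∀ κ > 0, ∃ ε₀ > 0,
      ∀ ε : ℝ, ε ≠ 0 → |ε| < ε₀ →
        ∀ x ∈ closedBall (0 : ℝ × ℝ) ρ, ∀ y ∈ closedBall (0 : ℝ × ℝ) ρ,
        ‖remScaled T xs ys s c₁ c₂ d₁ d₂ d₃ d₄ d₅ ε x -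
          remScaled T xs ys s c₁ c₂ d₁ d₂ d₃ d₄ d₅ ε y‖ ≤ κ * ‖x - y‖ := by
  obtain ⟨C, hC, ε₁, hε₁, h⟩ := hTay
  have habs : |s| = 1 := by
    rw [← abs_one, ← sq_eq_sq_iff_abs_eq_abs, sq, hs, one_pow]
  have h1 : ContDiff ℝ 2 (remFst T xs ys c₁ c₂) := by unfold remFst; fun_prop
  have h2 : ContDiff ℝ 2 (remSnd T ys d₁ d₂ d₃ d₄ d₅) := by unfold remSnd; fun_prop
  have hle : ∀ z : ℝ × ℝ, |z.1| + |z.2| ≤ 2 * ‖z‖ := fun z => by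
    have h3 := norm_fst_le z
    have h4 := norm_snd_le z
    rw [Real.norm_eq_abs] at h3 h4
    linarith
  have hsmall : ∀ᶠ z : ℝ × ℝ in nhds 0, |z.1| < ε₁ ∧ |z.2| < ε₁ := by
    filter_upwards [Metric.ball_mem_nhds (0 : ℝ × ℝ) hε₁] with z hz
    rw [mem_ball_zero_iff] at hz
    exact ⟨(norm_fst_le z).trans_lt hz, (norm_snd_le z).trans_lt hz⟩
  obtain ⟨h3, -, h4⟩ := exists_fderiv_small_of_le_sq (C := 4 * C) (h1.of_le (by norm_num)) (by
    filter_upwards [hsmall] with z hz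
    refine (h z.1 z.2 hz.1 hz.2).1.trans ?_
    calc C * (|z.1| + |z.2|) ^ 2 ≤ C * (2 * ‖z‖) ^ 2 := by gcongr; exact hle z
      _ = _ := by ring)
  obtain ⟨h5, h6⟩ := exists_fderiv_small_of_le_cube (C := 8 * C) h2 (by positivity) (by
    filter_upwards [hsmall] with z hz
    refine (h z.1 z.2 hz.1 hz.2).2.trans ?_
    calc C * (|z.1| + |z.2|) ^ 3 ≤ C * (2 * ‖z‖) ^ 3 := by gcongr; exact hle z
      _ = _ := by ring)
  refine ⟨fun ε => by simp [remScaled, h3, h5], fun ρ hρ κ hκ => ?_⟩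
  obtain ⟨δ₁, hδ₁, h7⟩ := exists_lipschitz_rescaled (h1.differentiable two_ne_zero) 0
    (by simpa using h4) hρ hκ
  obtain ⟨δ₂, hδ₂, h8⟩ := exists_lipschitz_rescaled (h2.differentiable two_ne_zero) 1
    (by simpa using h6) hρ hκ
  refine ⟨min δ₁ δ₂, lt_min hδ₁ hδ₂, fun ε hε hεlt x hx y hy => ?_⟩
  obtain ⟨h9, h10⟩ := lt_min_iff.1 hεlt
  rw [Prod.norm_def, sup_le_iff]
  refine ⟨h7 ε hε h9 x hx y hy, ?_⟩
  simp only [remScaled, Prod.snd_sub]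
  rw [← mul_sub, norm_mul, Real.norm_eq_abs, habs, one_mul]
  exact h8 ε hε h10 x hx y hy

lemma entryCoord_global_map {T : ℝ × ℝ → ℝ × ℝ} {xs ys s c₁ c₂ d₁ d₂ d₃ d₄ d₅ ε : ℝ}
    (hxs : xs ≠ 0) (hε : ε ≠ 0) (hs : s * s = 1) (hd1 : d₁ = s * (ys / xs)) (hd2 : d₂ = 0)
    (p e : ℝ × ℝ) :
    entryCoord xs ys s ε (T (ε * (exitCoord xs ys (ε, p, e)).1,
      ys + ε * (exitCoord xs ys (ε, p, e)).2)) =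
      returnMap xs ys s c₁ c₂ d₃ d₄ d₅ (ε, p, e) +
        remScaled T xs ys s c₁ c₂ d₁ d₂ d₃ d₄ d₅ ε (exitCoord xs ys (ε, p, e)) := by
  have hu : (exitCoord xs ys (ε, p, e)).1 = (xs + ε * p.1) * (1 + ε * e.1) := rfl
  simp only [returnMap, remScaled, remFst, remSnd, entryCoord, Prod.smul_fst, Prod.smul_snd,
    smul_eq_mul, Prod.mk_add_mk, hd1, hd2]
  generalize (exitCoord xs ys (ε, p, e)).2 = w at *
  generalize (exitCoord xs ys (ε, p, e)).1 = u at *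
  generalize T (ε * u, ys + ε * w) = t
  ext
  · simp only
    field_simp
    ring
  · simp only
    field_simp
    rw [hu]
    linear_combination (ε ^ 3 * (xs + ε * p.1) * (1 + ε * e.1) * ys) * hs

/-- Small `C¹` perturbations of a family of maps keep the linear approximation. -/
lemma perturbed_approx {E : Type*} [NormedAddCommGroup E] [NormedSpace ℝ E]
    [FiniteDimensional ℝ E] {Γ q : ℝ × E × E → E} {rem : ℝ → E → E} (hΓ : ContDiff ℝ 1 Γ)
    (hq : ContDiff ℝ 1 q) (hrem0 : ∀ ε, rem ε 0 = 0)
    (hrem : ∀ ρ > 0, ∀ κ > 0, ∃ ε₀ > 0, ∀ ε : ℝ, ε ≠ 0 → |ε| < ε₀ →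
      ∀ x ∈ closedBall (0 : E) ρ, ∀ y ∈ closedBall (0 : E) ρ,
        ‖rem ε x - rem ε y‖ ≤ κ * ‖x - y‖)
    {p₀ : E} {L : E →L[ℝ] E} (hL : HasFDerivAt (fun p => Γ (0, p, 0)) L p₀) {κ : ℝ} (hκ : 0 < κ) :
    ∃ r > 0, r ≤ 1 ∧ ∀ μ > 0, ∃ δ > 0, ∀ ε : ℝ, ε ≠ 0 → |ε| < δ → ∀ e : E → E,
      (∀ p ∈ closedBall p₀ r, ‖e p‖ ≤ δ) →
      (∀ p ∈ closedBall p₀ r, ∀ p' ∈ closedBall p₀ r, ‖e p - e p'‖ ≤ δ * ‖p - p'‖) →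
      (∀ p ∈ closedBall p₀ r, ∀ p' ∈ closedBall p₀ r,
        ‖(Γ (ε, p, e p) + rem ε (q (ε, p, e p))) - (Γ (ε, p', e p') + rem ε (q (ε, p', e p'))) -
          L (p - p')‖ ≤ κ * ‖p - p'‖) ∧
      ‖Γ (ε, p₀, e p₀) + rem ε (q (ε, p₀, e p₀)) - Γ (0, p₀, 0)‖ ≤ μ := by
  set Γ' := fderiv ℝ Γ (0, p₀, 0) with hΓ'
  have hstrict : HasStrictFDerivAt Γ Γ' (0, p₀, 0) := hΓ.hasStrictFDerivAt one_ne_zero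
  have hLeq : ∀ v, L v = Γ' (0, v, 0) := by
    have h1 : HasFDerivAt (fun p : E => ((0 : ℝ), p, (0 : E)))
        ((0 : E →L[ℝ] ℝ).prod ((ContinuousLinearMap.id ℝ E).prod (0 : E →L[ℝ] E))) p₀ := by
      have h3 := ((hasFDerivAt_const (0 : ℝ) p₀).prodMk
        ((hasFDerivAt_id (𝕜 := ℝ) p₀).prodMk (hasFDerivAt_const (0 : E) p₀)))
      exact h3
    have h2 := hL.unique (hstrict.hasFDerivAt.comp p₀ h1)
    intro v
    rw [h2]
    rfl
  obtain ⟨r, hr, hr1⟩ : ∃ r > 0, ∀ z ∈ closedBall ((0 : ℝ), p₀, (0 : E)) r,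
      ∀ z' ∈ closedBall ((0 : ℝ), p₀, (0 : E)) r,
        ‖Γ z - Γ z' - Γ' (z - z')‖ ≤ κ / 4 * ‖z - z'‖ := by
    have h1 := hstrict.isLittleO.def (show 0 < κ / 4 by positivity)
    obtain ⟨r, hr, h3⟩ := Metric.nhds_basis_closedBall.mem_iff.1 h1
    rw [← closedBall_prod_same] at h3
    exact ⟨r, hr, fun z hz z' hz' => h3 (Set.mk_mem_prod hz hz')⟩
  obtain ⟨K, hK, hK1, hK2⟩ := exists_bound_lipschitz_closedBall hq (‖p₀‖ + 1)
  obtain ⟨K', hK', -, hK2'⟩ := exists_bound_lipschitz_closedBall hΓ (‖p₀‖ + 1)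
  refine ⟨min r 1, lt_min hr one_pos, min_le_right _ _, fun μ hμ => ?_⟩
  obtain ⟨ε₀, hε₀, hR⟩ := hrem K hK (min (κ / (4 * K)) (μ / (2 * K))) (by positivity)
  refine ⟨min (min (min r 1) ε₀) (min (κ / (4 * (‖Γ'‖ + 1))) (μ / (2 * K'))), by positivity,
    fun ε hε hεlt e he heL => ?_⟩
  set δ := min (min (min r 1) ε₀) (min (κ / (4 * (‖Γ'‖ + 1))) (μ / (2 * K'))) with hδ
  have hδ0 : 0 ≤ δ := (abs_nonneg ε).trans hεlt.le
  have hδr : δ ≤ r := (min_le_left _ _).trans ((min_le_left _ _).trans (min_le_left _ _))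
  have hδ1 : δ ≤ 1 := (min_le_left _ _).trans ((min_le_left _ _).trans (min_le_right _ _))
  have hδε : δ ≤ ε₀ := (min_le_left _ _).trans (min_le_right _ _)
  have hδκ : δ * (4 * (‖Γ'‖ + 1)) ≤ κ :=
    (le_div_iff₀ (by positivity)).1 ((min_le_right _ _).trans (min_le_left _ _))
  have hδμ : δ * (2 * K') ≤ μ :=
    (le_div_iff₀ (by positivity)).1 ((min_le_right _ _).trans (min_le_right _ _))
  have hmem : ∀ p ∈ closedBall p₀ (min r 1),
      ((ε, p, e p) : ℝ × E × E) ∈ closedBall ((0 : ℝ), p₀, (0 : E)) r ∧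
      ((ε, p, e p) : ℝ × E × E) ∈ closedBall (0 : ℝ × E × E) (‖p₀‖ + 1) := by
    intro p hp
    have h1 := he p hp
    rw [mem_closedBall, dist_eq_norm] at hp
    have h2 : ‖p‖ ≤ ‖p₀‖ + 1 := by
      calc ‖p‖ = ‖p₀ + (p - p₀)‖ := by rw [add_sub_cancel]
        _ ≤ _ := (norm_add_le _ _).trans (by gcongr; exact hp.trans (min_le_right _ _))
    constructor
    · rw [mem_closedBall, dist_eq_norm]
      simp only [Prod.mk_sub_mk, sub_zero, Prod.norm_mk, sup_le_iff, Real.norm_eq_abs]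
      exact ⟨by linarith, hp.trans (min_le_left _ _), by linarith⟩
    · rw [mem_closedBall_zero_iff]
      simp only [Prod.norm_mk, sup_le_iff, Real.norm_eq_abs]
      have := norm_nonneg p₀
      exact ⟨by linarith, h2, by linarith⟩
  have hqmem : ∀ p ∈ closedBall p₀ (min r 1), q (ε, p, e p) ∈ closedBall (0 : E) K := by
    intro p hp
    rw [mem_closedBall_zero_iff]
    exact hK1 _ (hmem p hp).2
  have hp₀ : p₀ ∈ closedBall p₀ (min r 1) := mem_closedBall_self (by positivity)
  have hR' := hR ε hε (hεlt.trans_le hδε)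
  constructor
  · intro p hp p' hp'
    have hz : ‖((ε, p, e p) : ℝ × E × E) - (ε, p', e p')‖ ≤ ‖p - p'‖ := by
      simp only [Prod.mk_sub_mk, sub_self, Prod.norm_mk, sup_le_iff, norm_zero]
      exact ⟨norm_nonneg _, le_rfl,
        (heL p hp p' hp').trans (mul_le_of_le_one_left (norm_nonneg _) hδ1)⟩
    have h1 := hr1 _ (hmem p hp).1 _ (hmem p' hp').1
    have h2 := hR' _ (hqmem p hp) _ (hqmem p' hp')
    have h3 := hK2 _ (hmem p hp).2 _ (hmem p' hp').2
    have h4 : ‖Γ' (0, 0, e p - e p')‖ ≤ κ / 4 * ‖p - p'‖ := by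
      refine (Γ'.le_opNorm _).trans ?_
      have h5 : ‖((0, 0, e p - e p') : ℝ × E × E)‖ = ‖e p - e p'‖ := by simp [Prod.norm_def]
      rw [h5]
      calc ‖Γ'‖ * ‖e p - e p'‖ ≤ (‖Γ'‖ + 1) * (δ * ‖p - p'‖) := by
            gcongr
            · linarith
            · exact heL p hp p' hp'
        _ = (δ * (4 * (‖Γ'‖ + 1))) / 4 * ‖p - p'‖ := by ring
        _ ≤ _ := by gcongr
    have h5 : ‖rem ε (q (ε, p, e p)) - rem ε (q (ε, p', e p'))‖ ≤ κ / 4 * ‖p - p'‖ := by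
      refine h2.trans ?_
      calc _ ≤ κ / (4 * K) * (K * ‖p - p'‖) := by
            gcongr
            · exact min_le_left _ _
            · exact h3.trans (by gcongr)
        _ = _ := by field_simp
    have h6 : Γ' ((ε, p, e p) - (ε, p', e p')) = L (p - p') + Γ' (0, 0, e p - e p') := by
      rw [hLeq, ← map_add]
      simp
    calc _ = ‖(Γ (ε, p, e p) - Γ (ε, p', e p') - Γ' ((ε, p, e p) - (ε, p', e p'))) +
          Γ' (0, 0, e p - e p') + (rem ε (q (ε, p, e p)) - rem ε (q (ε, p', e p')))‖ := by
          rw [h6]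
          congr 1
          abel
      _ ≤ κ / 4 * ‖p - p'‖ + κ / 4 * ‖p - p'‖ + κ / 4 * ‖p - p'‖ :=
          (norm_add_le _ _).trans (add_le_add ((norm_add_le _ _).trans
            (add_le_add (h1.trans (by gcongr)) h4)) h5)
      _ ≤ _ := by nlinarith [norm_nonneg (p - p')]
  · have h1 : ‖Γ (ε, p₀, e p₀) - Γ (0, p₀, 0)‖ ≤ μ / 2 := by
      refine (hK2' _ (hmem p₀ hp₀).2 (0, p₀, 0) ?_).trans ?_
      · rw [mem_closedBall_zero_iff]
        simp only [Prod.norm_mk, sup_le_iff, norm_zero]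
        have := norm_nonneg p₀
        exact ⟨by linarith, by linarith, by linarith⟩
      · have h2 : ‖((ε, p₀, e p₀) : ℝ × E × E) - (0, p₀, 0)‖ ≤ δ := by
          simp only [Prod.mk_sub_mk, sub_self, sub_zero, Prod.norm_mk, sup_le_iff, norm_zero,
            Real.norm_eq_abs]
          exact ⟨hεlt.le, hδ0, he p₀ hp₀⟩
        calc _ ≤ K' * δ := by gcongr
          _ ≤ _ := by linarith
    have h2 : ‖rem ε (q (ε, p₀, e p₀))‖ ≤ μ / 2 := by
      have h3 := hR' _ (hqmem p₀ hp₀) 0 (mem_closedBall_self hK.le)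
      rw [hrem0, sub_zero, sub_zero] at h3
      refine h3.trans ?_
      calc _ ≤ μ / (2 * K) * K := by
            gcongr
            · exact min_le_right _ _
            · exact hK1 _ (hmem p₀ hp₀).2
        _ = _ := by field_simp
    rw [add_sub_right_comm]
    exact (norm_add_le _ _).trans (by linarith)

/-- `1 - L` is invertible when one is not an eigenvalue of the planar map `L`. -/
lemma exists_equiv_one_sub {L : ℝ × ℝ →L[ℝ] ℝ × ℝ} (h : 1 - tr L + dt L ≠ 0) :
    ∃ e : (ℝ × ℝ) ≃L[ℝ] ℝ × ℝ, ∀ v, e v = v - L v := by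
  let l : ℝ × ℝ →ₗ[ℝ] ℝ × ℝ := LinearMap.id - L.toLinearMap
  have hl : Function.Injective l := by
    rw [injective_iff_map_eq_zero]
    intro v hv
    have h1 : v - L v = 0 := hv
    rw [clm_apply_eq L v] at h1
    have h2 := congrArg Prod.fst h1
    have h3 := congrArg Prod.snd h1
    simp only [Prod.fst_sub, Prod.snd_sub, Prod.fst_add, Prod.snd_add, Prod.smul_fst,
      Prod.smul_snd, smul_eq_mul, Prod.fst_zero, Prod.snd_zero] at h2 h3
    unfold tr dt at h
    ext
    · apply (mul_eq_zero.1 _).resolve_left h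
      linear_combination (1 - (L (0, 1)).2) * h2 + (L (0, 1)).1 * h3
    · apply (mul_eq_zero.1 _).resolve_left h
      linear_combination (1 - (L (1, 0)).1) * h3 + (L (1, 0)).2 * h2
  exact ⟨(LinearEquiv.ofInjectiveEndo l hl).toContinuousLinearEquiv, fun v => rfl⟩

/-- Trace and determinant of the derivative are unchanged by the rescaling. -/
lemma hasFDerivAt_conj_entryPoint {F : ℝ × ℝ → ℝ × ℝ} {xs ys s ε : ℝ} (hε : ε ≠ 0)
    (hs : s * s = 1) {p : ℝ × ℝ} {A : ℝ × ℝ →L[ℝ] ℝ × ℝ}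
    (hA : HasFDerivAt F A (entryPoint xs ys s ε p)) :
    ∃ B : ℝ × ℝ →L[ℝ] ℝ × ℝ,
      HasFDerivAt (fun p => entryCoord xs ys s ε (F (entryPoint xs ys s ε p))) B p ∧
        tr B = tr A ∧ dt B = dt A := by
  let D : ℝ × ℝ →L[ℝ] ℝ × ℝ := (ε • ContinuousLinearMap.fst ℝ ℝ ℝ).prod
    ((s * ε * ε) • ContinuousLinearMap.snd ℝ ℝ ℝ)
  let D' : ℝ × ℝ →L[ℝ] ℝ × ℝ := (ε⁻¹ • ContinuousLinearMap.fst ℝ ℝ ℝ).prod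
    ((s * ε⁻¹ * ε⁻¹) • ContinuousLinearMap.snd ℝ ℝ ℝ)
  have hD : HasFDerivAt (entryPoint xs ys s ε) D p := by
    have h1 : entryPoint xs ys s ε = fun p => D p + (xs, s * ε * ys) := by
      funext p
      ext <;> simp [entryPoint, D] <;> ring
    rw [h1]
    exact D.hasFDerivAt.add_const _
  have hD' : ∀ z, HasFDerivAt (entryCoord xs ys s ε) D' z := by
    intro z
    have h1 : entryCoord xs ys s ε = fun p => D' p + (-xs / ε, -ys / ε) := by
      funext p
      ext
      · simp [entryCoord, D']
        field_simp
        ring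
      · simp [entryCoord, D']
        field_simp
        ring
    rw [h1]
    exact D'.hasFDerivAt.add_const _
  refine ⟨D'.comp (A.comp D), (hD' _).comp p (hA.comp p hD), ?_, ?_⟩
  · simp only [tr, ContinuousLinearMap.comp_apply]
    rw [clm_apply_eq A (D (1, 0)), clm_apply_eq A (D (0, 1))]
    simp [D, D']
    field_simp
    linear_combination (A (0, 1)).2 * hs
  · simp only [dt, ContinuousLinearMap.comp_apply]
    rw [clm_apply_eq A (D (1, 0)), clm_apply_eq A (D (0, 1))]
    simp [D, D']
    field_simp
    linear_combination ((A (1, 0)).1 * (A (0, 1)).2 - (A (0, 1)).1 * (A (1, 0)).2) * hs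

/-! ### Existence of single-round periodic orbits -/

/-- The homoclinic excursion meets the point `(xs, 0)` only at its end, also for nearby orbits. -/
lemma exists_no_early_return {f : ℝ × ℝ → ℝ × ℝ} {lam xs ys : ℝ} {N : Set (ℝ × ℝ)} {m : ℕ}
    (hf : Continuous f) (hlam1 : |lam| < 1) (hNconv : Convex ℝ N)
    (hN0 : ((0 : ℝ), (0 : ℝ)) ∈ N) (hfN : ∀ x : ℝ, (x, (0 : ℝ)) ∈ N → f (x, 0) = (lam * x, 0))
    (hxs : 0 < xs) (hp1 : ((xs : ℝ), (0 : ℝ)) ∈ N) (hp2 : ((lam * xs : ℝ), (0 : ℝ)) ∈ N)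
    (hhom : f^[m] (0, ys) = (xs, 0)) :
    ∃ r > 0, ∀ z z' : ℝ × ℝ, ‖z - (0, ys)‖ ≤ r → ‖z' - (xs, 0)‖ ≤ r →
      ∀ i, 0 < i → i < m → f^[i] z ≠ z' := by
  have hmem : ∀ n : ℕ, ((lam ^ n * xs : ℝ), (0 : ℝ)) ∈ N := by
    intro n
    have hsq : ∀ i : ℕ, 0 ≤ lam ^ (2 * i) ∧ lam ^ (2 * i) ≤ 1 := fun i => by
      rw [pow_mul, ← sq_abs, ← pow_mul]
      exact ⟨by positivity, pow_le_one₀ (abs_nonneg _) hlam1.le⟩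
    rcases Nat.even_or_odd' n with ⟨i, rfl | rfl⟩
    · have := hNconv.smul_mem_of_zero_mem hN0 hp1 (t := lam ^ (2 * i)) (hsq i)
      simpa using this
    · have := hNconv.smul_mem_of_zero_mem hN0 hp2 (t := lam ^ (2 * i)) (hsq i)
      simpa [pow_succ, mul_assoc] using this
  have hit : ∀ n : ℕ, f^[n] (xs, 0) = (lam ^ n * xs, 0) := by
    intro n
    induction n with
    | zero => simp
    | succ n ih =>
      rw [Function.iterate_succ_apply', ih, hfN _ (hmem n), pow_succ']
      simp only [mul_assoc]
  have hne : ∀ i, 0 < i → i < m → f^[i] (0, ys) ≠ (xs, 0) := by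
    intro i hi him h
    have h1 : f^[m - i] (xs, 0) = (xs, 0) := by
      rw [← h, ← Function.iterate_add_apply, Nat.sub_add_cancel him.le, hhom, h]
    rw [hit] at h1
    have h2 : lam ^ (m - i) * xs = xs := congrArg Prod.fst h1
    have h3 : lam ^ (m - i) = 1 := by
      rwa [mul_eq_right₀ hxs.ne'] at h2
    have h4 : |lam| ^ (m - i) < 1 := pow_lt_one₀ (abs_nonneg _) hlam1 (by omega)
    rw [← abs_pow, h3, abs_one] at h4
    exact lt_irrefl _ h4
  have hev : ∀ᶠ w : (ℝ × ℝ) × (ℝ × ℝ) in nhds ((0, ys), (xs, 0)),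
      ∀ i ∈ Set.Iio m, 0 < i → f^[i] w.1 ≠ w.2 := by
    rw [Filter.eventually_all_finite (Set.finite_Iio m)]
    intro i hi
    by_cases h0 : 0 < i
    · have hc : Continuous fun w : (ℝ × ℝ) × (ℝ × ℝ) => f^[i] w.1 :=
        (hf.iterate i).comp continuous_fst
      filter_upwards [(hc.continuousAt.ne_iff_eventually_ne continuous_snd.continuousAt).1
        (hne i h0 hi)] with w hw _
      exact hw
    · exact Filter.Eventually.of_forall fun w h => absurd h h0
  obtain ⟨r, hr, h⟩ := Metric.nhds_basis_closedBall.mem_iff.1 hev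
  rw [← closedBall_prod_same] at h
  refine ⟨r, hr, fun z z' hz hz' i hi him => ?_⟩
  rw [← dist_eq_norm] at hz hz'
  exact h (Set.mk_mem_prod hz hz') i him hi

lemma contDiff_iterate {E : Type*} [NormedAddCommGroup E] [NormedSpace ℝ E] {f : E → E}
    {n : WithTop ℕ∞} (hf : ContDiff ℝ n f) (i : ℕ) : ContDiff ℝ n (f^[i]) := by
  induction i with
  | zero => exact contDiff_id
  | succ i ih => exact ih.comp hf

/-- Nondegenerate fixed points of the limiting rescaled return map give single-round periodic
orbits, whose linearization is close to that of the limiting map. -/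
lemma exists_isSRSol {f : ℝ × ℝ → ℝ × ℝ} {P Q : ℝ × ℝ → ℝ}
    {lam sig xs ys s c₁ c₂ d₁ d₂ d₃ d₄ d₅ : ℝ} {N : Set (ℝ × ℝ)} {m : ℕ}
    (hf : ContDiff ℝ 2 f) (hP : ContDiff ℝ 1 P) (hQ : ContDiff ℝ 1 Q)
    (hlam0 : 0 < |lam|) (hlam1 : |lam| < 1)
    (hNopen : IsOpen N) (hNconv : Convex ℝ N) (hN0 : ((0 : ℝ), (0 : ℝ)) ∈ N)
    (hfN : ∀ p ∈ N, f p =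
      (lam * p.1 * (1 + p.1 ^ 2 * p.2 ^ 2 * P p), sig * p.2 * (1 + p.1 ^ 2 * p.2 ^ 2 * Q p)))
    (hxs : 0 < xs) (hys : 0 < ys)
    (hp1 : ((xs : ℝ), (0 : ℝ)) ∈ N) (hp2 : ((lam * xs : ℝ), (0 : ℝ)) ∈ N)
    (hp3 : ((0 : ℝ), ys / sig) ∈ N) (hp4 : ((0 : ℝ), ys / sig ^ 2) ∈ N)
    (hhom : f^[m] (0, ys) = (xs, 0))
    (hTay : TaylorExp (f^[m]) xs ys c₁ c₂ d₁ d₂ d₃ d₄ d₅)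
    (hls : lam * sig = -1) (hs : s * s = 1) (hd1 : d₁ = s * (ys / xs)) (hd2 : d₂ = 0)
    {p₀ : ℝ × ℝ} (hp₀ : returnMap xs ys s c₁ c₂ d₃ d₄ d₅ (0, p₀, 0) = p₀)
    {L : ℝ × ℝ →L[ℝ] ℝ × ℝ}
    (hL : HasFDerivAt (fun p => returnMap xs ys s c₁ c₂ d₃ d₄ d₅ (0, p, 0)) L p₀)
    (hL1 : 1 - tr L + dt L ≠ 0) {U : Set (ℝ × ℝ →L[ℝ] ℝ × ℝ)} (hU : U ∈ nhds L) :
    ∀ᶠ k : ℕ in atTop, (-1) ^ k = s → ∃ z, IsSRSol f (f^[m]) N 1 m k z ∧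
      ∃ A B, HasFDerivAt (f^[k + m]) A (z 0) ∧ B ∈ U ∧ tr A = tr B ∧ dt A = dt B := by
  have habs : |s| = 1 := by
    rw [← abs_one, ← sq_eq_sq_iff_abs_eq_abs, sq, hs, one_pow]
  obtain ⟨Ψ, hΨ⟩ := exists_equiv_one_sub hL1
  set M := ‖(Ψ.symm : ℝ × ℝ →L[ℝ] ℝ × ℝ)‖ + 1 with hMdef
  have hM0 : 0 < M := by positivity
  have hM : ∀ v, ‖Ψ.symm v‖ ≤ M * ‖v‖ := fun v =>
    ((Ψ.symm : ℝ × ℝ →L[ℝ] ℝ × ℝ).le_opNorm v).trans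
      (mul_le_mul_of_nonneg_right (by linarith) (norm_nonneg v))
  obtain ⟨κ₁, hκ₁, hκU⟩ := Metric.nhds_basis_closedBall.mem_iff.1 hU
  set κ := min κ₁ (1 / (2 * M)) with hκdef
  have hκ : 0 < κ := by positivity
  have hMκ : M * κ ≤ 1 / 2 := by
    calc M * κ ≤ M * (1 / (2 * M)) := by gcongr; exact min_le_right _ _
      _ = _ := by field_simp
  have hT : ContDiff ℝ 2 (f^[m]) := contDiff_iterate hf m
  obtain ⟨hrem0, hrem⟩ := remScaled_lipschitz hT hs hTay
  obtain ⟨r, hr, hr1, hpert⟩ := perturbed_approx (contDiff_returnMap xs ys s c₁ c₂ d₃ d₄ d₅)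
    (contDiff_exitCoord xs ys) hrem0 hrem hL hκ
  obtain ⟨δ₁, hδ₁, hpert⟩ := hpert (r / (4 * M)) (by positivity)
  obtain ⟨r', hr', hno⟩ := exists_no_early_return hf.continuous hlam1 hNconv hN0
    (fun x hx => by simpa using hfN _ hx) hxs hp1 hp2 hhom
  set R := ‖p₀‖ + 1 with hRdef
  have hR0 : 0 < R := by positivity
  obtain ⟨K, hK, hK1, -⟩ := exists_bound_lipschitz_closedBall (contDiff_exitCoord xs ys) R
  have hsub : closedBall p₀ r ⊆ closedBall (0 : ℝ × ℝ) R := by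
    refine closedBall_subset_closedBall' ?_
    rw [dist_zero_right]
    linarith
  have hδ : 0 < min δ₁ 1 := by positivity
  have ht0 := tendsto_pow_atTop_nhds_zero_of_lt_one hlam0.le hlam1
  have ht1 := ht0.mul_const K
  have ht2 := ht0.mul_const (R + ys)
  rw [zero_mul] at ht1 ht2
  filter_upwards [iterate_entryPoint (R := R) hP hQ hlam0 hlam1 hNopen hNconv hN0 hfN hxs hys hp1
    hp2 hp3 hp4 hls hδ, ht0.eventually_lt_const hδ, ht1.eventually_lt_const hr',
    ht2.eventually_lt_const hr'] with k hk hεδ hεK hεR hks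
  obtain ⟨e, he, heL, horb⟩ := hk hks
  have hε : lam ^ k ≠ 0 := pow_ne_zero _ (abs_pos.1 hlam0)
  rw [← abs_pow] at hεδ hεK hεR
  generalize hεdef : lam ^ k = ε at *
  obtain ⟨hεδ₁, hε1⟩ := lt_min_iff.1 hεδ
  obtain ⟨happ, hcl⟩ := hpert ε hε hεδ₁ e
    (fun p hp => (he p (hsub hp)).trans (min_le_left _ _))
    (fun p hp p' hp' => (heL p (hsub hp) p' (hsub hp')).trans
      (mul_le_mul_of_nonneg_right (min_le_left _ _) (norm_nonneg _)))
  set g : ℝ × ℝ → ℝ × ℝ := fun p =>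
    entryCoord xs ys s ε (f^[k + m] (entryPoint xs ys s ε p)) with hg
  have hexit : ∀ p ∈ closedBall p₀ r, f^[k] (entryPoint xs ys s ε p) =
      (ε * (exitCoord xs ys (ε, p, e p)).1, ys + ε * (exitCoord xs ys (ε, p, e p)).2) :=
    fun p hp => (horb p (hsub hp)).1
  have hgeq : ∀ p ∈ closedBall p₀ r, g p =
      returnMap xs ys s c₁ c₂ d₃ d₄ d₅ (ε, p, e p) +
        remScaled (f^[m]) xs ys s c₁ c₂ d₁ d₂ d₃ d₄ d₅ ε (exitCoord xs ys (ε, p, e p)) := by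
    intro p hp
    rw [← entryCoord_global_map hxs.ne' hε hs hd1 hd2, ← hexit p hp,
      ← Function.iterate_add_apply, add_comm m k]
  have happ' : ∀ p ∈ closedBall p₀ r, ∀ p' ∈ closedBall p₀ r,
      ‖g p - g p' - L (p - p')‖ ≤ κ * ‖p - p'‖ := by
    intro p hp p' hp'
    rw [hgeq p hp, hgeq p' hp']
    exact happ p hp p' hp'
  have hhalf : closedBall p₀ (r / 2) ⊆ closedBall p₀ r := closedBall_subset_closedBall (by linarith)
  obtain ⟨p, hp, hgp⟩ : ∃ p ∈ closedBall p₀ (r / 2), g p = p := by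
    refine exists_fixedPoint_of_approx Ψ hΨ (half_pos hr) hM hM0 hMκ
      (fun p hp p' hp' => happ' p (hhalf hp) p' (hhalf hp')) ?_
    rw [hgeq p₀ (mem_closedBall_self hr.le)]
    rw [hp₀] at hcl
    calc _ ≤ M * (r / (4 * M)) := by gcongr
      _ = _ := by field_simp; norm_num
  have hpr := hhalf hp
  have hpR := hsub hpr
  have hfix : f^[k + m] (entryPoint xs ys s ε p) = entryPoint xs ys s ε p := by
    rw [← entryPoint_entryCoord hε hs (f^[k + m] (entryPoint xs ys s ε p))]
    exact congrArg _ hgp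
  obtain ⟨h1, h2, h3⟩ := horb p hpR
  have hA : HasFDerivAt (f^[k + m]) (fderiv ℝ (f^[k + m]) (entryPoint xs ys s ε p))
      (entryPoint xs ys s ε p) :=
    ((contDiff_iterate hf (k + m)).differentiable two_ne_zero _).hasFDerivAt
  obtain ⟨B, hB, htr, hdt⟩ := hasFDerivAt_conj_entryPoint hε hs hA
  refine ⟨fun j => f^[j] (entryPoint xs ys s ε p), ⟨hfix, ?_, ?_, h2, ?_⟩, _, B, hA, hκU ?_,
    htr.symm, hdt.symm⟩
  · intro j hj0 hj
    rcases le_or_gt j k with hjk | hjk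
    · exact h3 j hj0 hjk
    · have hz : f^[j] (entryPoint xs ys s ε p) =
          f^[j - k] (f^[k] (entryPoint xs ys s ε p)) := by
        rw [← Function.iterate_add_apply, Nat.sub_add_cancel hjk.le]
      simp only [Function.iterate_zero, id_eq]
      rw [hz]
      refine hno _ _ ?_ ?_ (j - k) (by omega) (by omega)
      · rw [hexit p hpr]
        have h4 := hK1 (ε, p, e p) (by
          rw [mem_closedBall_zero_iff]
          simp only [Prod.norm_mk, sup_le_iff, Real.norm_eq_abs]
          have := norm_nonneg p₀
          have h5 := (he p hpR).trans (min_le_right _ _)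
          exact ⟨by linarith, mem_closedBall_zero_iff.1 hpR, by linarith⟩)
        have h5 : ((ε * (exitCoord xs ys (ε, p, e p)).1,
            ys + ε * (exitCoord xs ys (ε, p, e p)).2) - (0, ys) : ℝ × ℝ) =
            ε • exitCoord xs ys (ε, p, e p) := by
          ext <;> simp
        rw [h5, norm_smul, Real.norm_eq_abs]
        exact (mul_le_mul_of_nonneg_left h4 (abs_nonneg ε)).trans hεK.le
      · have h4 := mem_closedBall_zero_iff.1 hpR
        have h5 : entryPoint xs ys s ε p - (xs, 0) = ε • (p.1, s * (ys + ε * p.2)) := by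
          ext <;> simp [entryPoint]
          ring
        rw [h5, norm_smul, Real.norm_eq_abs]
        refine (mul_le_mul_of_nonneg_left ?_ (abs_nonneg ε)).trans hεR.le
        simp only [Prod.norm_mk, sup_le_iff, norm_mul, Real.norm_eq_abs, habs, one_mul]
        have h6 := norm_fst_le p
        have h7 := norm_snd_le p
        rw [Real.norm_eq_abs] at h6 h7
        refine ⟨by linarith, (abs_add_le _ _).trans ?_⟩
        rw [abs_mul, abs_of_pos hys]
        have h8 := mul_le_mul hε1.le h7 (abs_nonneg _) zero_le_one
        linarith
  · intro j _
    exact Function.iterate_succ_apply' f j _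
  · change entryPoint xs ys s ε p = f^[m] (f^[k] (entryPoint xs ys s ε p))
    rw [← Function.iterate_add_apply, add_comm m k, hfix]
  · rw [mem_closedBall, dist_eq_norm]
    refine (norm_sub_le_of_approx hκ.le (closedBall_mem_nhds_of_mem ?_) happ' hB).trans
      (min_le_left _ _)
    exact closedBall_subset_ball (by linarith) hp

/-- The rescaled return map in the limit. -/
lemma hasFDerivAt_returnMap_zero (xs ys s c₁ c₂ d₃ d₄ d₅ : ℝ) (p : ℝ × ℝ) :
    HasFDerivAt (fun p => returnMap xs ys s c₁ c₂ d₃ d₄ d₅ (0, p, 0))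
      ((c₂ • ContinuousLinearMap.snd ℝ ℝ ℝ).prod ((ys / xs) • ContinuousLinearMap.fst ℝ ℝ ℝ +
        (s * (d₄ * xs + 2 * d₅ * p.2)) • ContinuousLinearMap.snd ℝ ℝ ℝ)) p := by
  have h1 : (fun p => returnMap xs ys s c₁ c₂ d₃ d₄ d₅ (0, p, 0)) = fun p : ℝ × ℝ =>
      (c₁ * xs + c₂ * p.2,
        ys / xs * p.1 + s * (d₃ * xs ^ 2 + d₄ * xs * p.2 + d₅ * (p.2 * p.2))) := by
    funext p
    ext
    · simp [returnMap, exitCoord]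
    · simp only [returnMap, exitCoord, zero_mul, add_zero, mul_one, mul_zero, Prod.fst_zero,
        Prod.snd_zero]
      ring
  rw [h1]
  have hf : HasFDerivAt (fun p : ℝ × ℝ => p.1) (ContinuousLinearMap.fst ℝ ℝ ℝ) p := hasFDerivAt_fst
  have hs : HasFDerivAt (fun p : ℝ × ℝ => p.2) (ContinuousLinearMap.snd ℝ ℝ ℝ) p := hasFDerivAt_snd
  refine ((hs.const_mul c₂).const_add (c₁ * xs)).prodMk ?_
  refine ((hf.const_mul (ys / xs)).add ((((hs.const_mul (d₄ * xs)).const_add (d₃ * xs ^ 2)).add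
    ((hs.mul hs).const_mul d₅)).const_mul s)).congr_fderiv ?_
  ext <;> simp
  ring

theorem sufficient_conditions_orientation_reversing
    (f : ℝ × ℝ → ℝ × ℝ) (P Q : ℝ × ℝ → ℝ)
    (lam sig xs ys c₁ c₂ d₁ d₂ d₃ d₄ d₅ Δ : ℝ)
    (N : Set (ℝ × ℝ)) (m : ℕ)
    (hf : ContDiff ℝ (⊤ : ℕ∞) f) (hP : ContDiff ℝ (⊤ : ℕ∞) P) (hQ : ContDiff ℝ (⊤ : ℕ∞) Q)
    (hlam0 : 0 < |lam|) (hlam1 : |lam| < 1) (hsig : 1 < |sig|)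
    (hNopen : IsOpen N) (hNconv : Convex ℝ N) (hNbdd : Bornology.IsBounded N)
    (hN0 : ((0 : ℝ), (0 : ℝ)) ∈ N)
    (hfN : ∀ p ∈ N, f p =
      (lam * p.1 * (1 + p.1 ^ 2 * p.2 ^ 2 * P p),
       -(1 / lam) * p.2 * (1 + p.1 ^ 2 * p.2 ^ 2 * Q p)))
    (hxs : 0 < xs) (hys : 0 < ys)
    (hp1 : ((xs : ℝ), (0 : ℝ)) ∈ N) (hp2 : ((lam * xs : ℝ), (0 : ℝ)) ∈ N)
    (hp3 : ((0 : ℝ), ys / sig) ∈ N) (hp4 : ((0 : ℝ), ys / sig ^ 2) ∈ N)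
    (hm : 1 ≤ m) (hhom : f^[m] (0, ys) = (xs, 0))
    (hTay : TaylorExp (f^[m]) xs ys c₁ c₂ d₁ d₂ d₃ d₄ d₅)
    (hls : lam * sig = -1) (hd1 : |d₁| = ys / xs) (hd2 : d₂ = 0)
    (hd5 : d₅ ≠ 0)
    (hΔdef : Δ = (1 - c₂ * ys / xs - d₄ * ys / d₁) ^ 2
      - 4 * d₅ * (d₃ * xs ^ 2 + c₁ * d₁ * xs))
    (hΔ : 0 < Δ)
    (hstab1 : -1 < c₂ * ys / xs) (hstab2 : c₂ * ys / xs < 1 - Real.sqrt Δ / 2) :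
    ∃ η > 0, ∃ kmin : ℕ, ∀ k : ℕ, kmin ≤ k →
      ((d₁ = ys / xs ∧ Even k) ∨ (d₁ = -(ys / xs) ∧ Odd k)) →
      (∃ z : ℕ → ℝ × ℝ, IsSRSol f (f^[m]) N η m k z ∧ AsympStable f (z 0)) ∧
      (∃ z : ℕ → ℝ × ℝ, IsSRSol f (f^[m]) N η m k z ∧ IsSaddle f (k + m) (z 0)) := by
  obtain ⟨s, hs, hd1s⟩ : ∃ s : ℝ, s * s = 1 ∧ d₁ = s * (ys / xs) := by
    rcases abs_choice d₁ with h | h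
    · exact ⟨1, by norm_num, by rw [← hd1, h, one_mul]⟩
    · exact ⟨-1, by norm_num, by rw [← hd1, h]; ring⟩
  have hlam : lam ≠ 0 := abs_pos.1 hlam0
  have hsig' : sig = -(1 / lam) := by
    field_simp
    linarith
  rw [← hsig'] at hfN
  have hs0 : s ≠ 0 := left_ne_zero_of_mul_eq_one hs
  have hsign : ∀ k : ℕ, ((d₁ = ys / xs ∧ Even k) ∨ (d₁ = -(ys / xs) ∧ Odd k)) →
      (-1) ^ k = s := by
    have hpos : ys / xs ≠ 0 := (div_pos hys hxs).ne'
    rintro k (⟨h, hk⟩ | ⟨h, hk⟩)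
    · rw [hk.neg_one_pow]
      apply mul_right_cancel₀ hpos
      rw [one_mul, ← hd1s, h]
    · rw [hk.neg_one_pow]
      apply mul_right_cancel₀ hpos
      rw [neg_one_mul, ← hd1s, h]
  have hdiv : d₄ * ys / d₁ = s * d₄ * xs := by
    rw [hd1s]
    field_simp
    linear_combination -d₄ * hs
  have hcd : c₁ * d₁ * xs = s * c₁ * ys := by
    rw [hd1s]
    field_simp
  rw [hdiv, hcd] at hΔdef
  set b := c₂ * ys / xs with hb
  set w := Real.sqrt Δ with hw
  have hw0 : 0 < w := Real.sqrt_pos.2 hΔ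
  have hww : w * w = Δ := Real.mul_self_sqrt hΔ.le
  let L : ℝ → ℝ × ℝ →L[ℝ] ℝ × ℝ := fun t =>
    (c₂ • ContinuousLinearMap.snd ℝ ℝ ℝ).prod ((ys / xs) • ContinuousLinearMap.fst ℝ ℝ ℝ +
      t • ContinuousLinearMap.snd ℝ ℝ ℝ)
  have htr : ∀ t, tr (L t) = t := fun t => by simp [tr, L]
  have hdt : ∀ t, dt (L t) = -b := fun t => by
    simp [dt, L, hb]
    ring
  have key : ∀ v : ℝ, v * v = Δ → v ≠ 0 → ∀ U ∈ nhds (L (1 - b + v)),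
      ∀ᶠ k : ℕ in atTop, (-1) ^ k = s → ∃ z, IsSRSol f (f^[m]) N 1 m k z ∧
      ∃ A B, HasFDerivAt (f^[k + m]) A (z 0) ∧ B ∈ U ∧ tr A = tr B ∧ dt A = dt B := by
    intro v hv hv0 U hU
    set V := (1 - b - s * d₄ * xs + v) / (2 * s * d₅) with hV
    have hVeq : 2 * s * d₅ * V = 1 - b - s * d₄ * xs + v := by
      rw [hV]
      field_simp
    have hL := hasFDerivAt_returnMap_zero xs ys s c₁ c₂ d₃ d₄ d₅ (c₁ * xs + c₂ * V, V)
    have ht : s * (d₄ * xs + 2 * d₅ * V) = 1 - b + v := by linear_combination hVeq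
    rw [ht] at hL
    refine exists_isSRSol (contDiff_infty.1 hf 2) (contDiff_infty.1 hP 1)
      (contDiff_infty.1 hQ 1) hlam0 hlam1
      hNopen hNconv hN0 hfN hxs hys hp1 hp2 hp3 hp4 hhom hTay hls hs hd1s hd2 ?_ hL ?_ hU
    · ext
      · simp [returnMap, exitCoord]
      · simp only [returnMap, exitCoord, zero_mul, add_zero, mul_one, mul_zero,
          Prod.fst_zero, Prod.snd_zero]
        have hbx : ys / xs * (c₁ * xs + c₂ * V) = c₁ * ys + b * V := by
          rw [hb]
          field_simp
        rw [hbx]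
        apply mul_left_cancel₀ (mul_ne_zero (mul_ne_zero four_ne_zero hs0) hd5)
        have hq : (2 * s * d₅ * V - (1 - b - s * d₄ * xs)) ^ 2 = Δ := by
          rw [hVeq, ← hv]
          ring
        rw [hΔdef] at hq
        linear_combination hq + (4 * d₅ * d₃ * xs ^ 2) * hs
    · have h1 := htr (1 - b + v)
      have h2 := hdt (1 - b + v)
      change 1 - tr (L (1 - b + v)) + dt (L (1 - b + v)) ≠ 0
      rw [h1, h2]
      intro h
      apply hv0
      linarith
  have hstable := key (-w) (by rw [neg_mul_neg, hww]) (neg_ne_zero.2 hw0.ne')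
    {B | |tr B| < 1 + dt B ∧ dt B < 1} (by
      refine (IsOpen.mem_nhds ?_ ?_)
      · exact (isOpen_lt continuous_tr.abs (continuous_const.add continuous_dt)).inter
          (isOpen_lt continuous_dt continuous_const)
      · simp only [Set.mem_ofPred_eq, htr, hdt, abs_lt]
        exact ⟨⟨by linarith, by linarith⟩, by linarith⟩)
  have hsaddle := key w hww hw0.ne' {B | |1 + dt B| < tr B} (by
      refine (IsOpen.mem_nhds ?_ ?_)
      · exact isOpen_lt (continuous_const.add continuous_dt).abs continuous_tr
      · simp only [Set.mem_ofPred_eq, htr, hdt, abs_lt]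
        exact ⟨by linarith, by linarith⟩)
  obtain ⟨kmin, hk⟩ := eventually_atTop.1 (hstable.and hsaddle)
  refine ⟨1, one_pos, kmin, fun k hkk hcase => ?_⟩
  obtain ⟨h1, h2⟩ := hk k hkk
  have hsk := hsign k hcase
  constructor
  · obtain ⟨z, hz, A, B, hA, hB, htA, hdA⟩ := h1 hsk
    refine ⟨z, hz, asympStable_of_jury hf.continuous (by omega) hz.1 hA ?_ ?_⟩
    · rw [htA, hdA]
      exact hB.1
    · rw [hdA]
      exact hB.2
  · obtain ⟨z, hz, A, B, hA, hB, htA, hdA⟩ := h2 hsk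
    refine ⟨z, hz, isSaddle_of_trace_det hA ?_⟩
    rw [htA, hdA]
    exact hB
end
end

section
/- Suppose there is an infinite set K of positive integers such that for every k ∈ K the map f has an SR_k-solution with parameter η = η_R, with points (x_j^{(k)}, y_j^{(k)}) for j = 0,…,k, and suppose (x₀^{(k)}, y₀^{(k)}) → (x*, 0) as k → ∞ in K. Then for all sufficiently large k ∈ K one has |y₀^{(k)}| ≤ 2 y* |σ|^{−k/2}. -/
/-- Pointwise estimate behind the expansion in the unstable direction. -/
theorem abs_mul_one_add_ge {s σ y u g R c : ℝ} (hs : 0 < s) (hσ : |σ| = s ^ 2) (hg : |g| ≤ R)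
    (hu : |u| * R ≤ 1 - c / s) : s * c * |y| ≤ |σ * y * (1 + u * g)| := by
  have h1 : |u * g| ≤ |u| * R := by
    rw [abs_mul]; gcongr
  have h2 : c / s ≤ |1 + u * g| := by
    have h3 := neg_abs_le (u * g)
    have h4 := le_abs_self (1 + u * g)
    linarith
  rw [abs_mul, abs_mul, hσ]
  calc s * c * |y| = s ^ 2 * |y| * (c / s) := by field_simp
    _ ≤ _ := by gcongr

/-- A sequence that grows by a factor `s * t` for the first `J` steps, and by `s` afterwards. -/
theorem growth_lower_bound {a : ℕ → ℝ} {s t : ℝ} {J k : ℕ} (hs : 0 ≤ s) (ht : 0 ≤ t)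
    (h₁ : ∀ j < k, j < J → s * t * a j ≤ a (j + 1)) (h₂ : ∀ j < k, s * a j ≤ a (j + 1)) :
    ∀ j ≤ k, s ^ j * t ^ min j J * a 0 ≤ a j := by
  intro j
  induction j with
  | zero => simp
  | succ j ih =>
    intro hj
    have ih' := ih (by omega)
    rcases lt_or_ge j J with hJ | hJ
    · rw [min_eq_left hJ.le] at ih'
      rw [min_eq_left (Nat.succ_le_of_lt hJ)]
      calc s ^ (j + 1) * t ^ (j + 1) * a 0 = s * t * (s ^ j * t ^ j * a 0) := by ring
        _ ≤ s * t * a j := by gcongr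
        _ ≤ _ := h₁ j (by omega) hJ
    · rw [min_eq_right hJ] at ih'
      rw [min_eq_right (by omega)]
      calc s ^ (j + 1) * t ^ J * a 0 = s * (s ^ j * t ^ J * a 0) := by ring
        _ ≤ s * a j := by gcongr
        _ ≤ _ := h₂ j (by omega)

/-- The stable axis is mapped linearly by the iterates of `f`. -/
theorem iterate_stable_axis {f : ℝ × ℝ → ℝ × ℝ} {F G : ℝ × ℝ → ℝ} {lam sig xs : ℝ}
    {N : Set (ℝ × ℝ)} (hlam1 : |lam| < 1) (hNconv : Convex ℝ N) (hN0 : ((0 : ℝ), (0 : ℝ)) ∈ N)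
    (hfN : ∀ p ∈ N, f p =
      (lam * p.1 * (1 + p.1 * p.2 * F p), sig * p.2 * (1 + p.1 * p.2 * G p)))
    (hp1 : (xs, (0 : ℝ)) ∈ N) (hp2 : (lam * xs, (0 : ℝ)) ∈ N) (j : ℕ) :
    f^[j] (xs, 0) = (lam ^ j * xs, 0) := by
  have hscale : ∀ c : ℝ, 0 ≤ c → c ≤ 1 → ∀ x : ℝ, (x, (0 : ℝ)) ∈ N → (c * x, (0 : ℝ)) ∈ N := by
    intro c h0 h1 x hx
    have h := hNconv hx hN0 h0 (sub_nonneg.2 h1) (by ring)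
    simpa using h
  have hmem : ∀ i : ℕ, (lam ^ i * xs, (0 : ℝ)) ∈ N := by
    have hl2 : (lam ^ 2) ≤ 1 := by
      rw [← sq_abs]
      exact pow_le_one₀ (abs_nonneg _) hlam1.le
    intro i
    induction i using Nat.twoStepInduction with
    | zero => simpa using hp1
    | one => simpa using hp2
    | more i ih _ =>
      have h := hscale (lam ^ 2) (sq_nonneg _) hl2 _ ih
      convert h using 2
      ring
  induction j with
  | zero => simp
  | succ j ih =>
    rw [Function.iterate_succ_apply', ih, hfN _ (hmem j)]
    ext <;> simp
    ring


open Filter Metric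

noncomputable section

theorem y0_bound
    (f : ℝ × ℝ → ℝ × ℝ) (F G : ℝ × ℝ → ℝ)
    (lam sig R xs ys : ℝ)
    (N : Set (ℝ × ℝ)) (m : ℕ)
    (hf : ContDiff ℝ (⊤ : ℕ∞) f) (hF : ContDiff ℝ (⊤ : ℕ∞) F) (hG : ContDiff ℝ (⊤ : ℕ∞) G)
    (hlam0 : 0 < |lam|) (hlam1 : |lam| < 1) (hsig : 1 < |sig|)
    (hNopen : IsOpen N) (hNconv : Convex ℝ N) (hNbdd : Bornology.IsBounded N)
    (hN0 : ((0 : ℝ), (0 : ℝ)) ∈ N)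
    (hfN : ∀ p ∈ N, f p =
      (lam * p.1 * (1 + p.1 * p.2 * F p), sig * p.2 * (1 + p.1 * p.2 * G p)))
    (hR : 0 < R) (hFGb : ∀ p ∈ N, |F p| ≤ R ∧ |G p| ≤ R)
    (hxs : 0 < xs) (hys : 0 < ys)
    (hp1 : ((xs : ℝ), (0 : ℝ)) ∈ N) (hp2 : ((lam * xs : ℝ), (0 : ℝ)) ∈ N)
    (hp3 : ((0 : ℝ), ys / sig) ∈ N) (hp4 : ((0 : ℝ), ys / sig ^ 2) ∈ N)
    (hm : 1 ≤ m) (hhom : f^[m] (0, ys) = (xs, 0))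
    (K : Set ℕ) (pts : ℕ → ℕ → ℝ × ℝ)
    (hK : K.Infinite) (hK1 : ∀ k ∈ K, 1 ≤ k)
    (hSR : ∀ k ∈ K, IsSRSol f (f^[m]) N ((1 - |sig| ^ (-(1 : ℝ) / 2)) / R) m k (pts k))
    (hconv : Tendsto (fun k => pts k 0) (atTop ⊓ 𝓟 K) (nhds ((xs : ℝ), (0 : ℝ)))) :
    ∀ᶠ k in atTop ⊓ 𝓟 K, |(pts k 0).2| ≤ 2 * ys * |sig| ^ (-(k : ℝ) / 2) := by
  set s : ℝ := √|sig| with hs_def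
  have hs2 : |sig| = s ^ 2 := (Real.sq_sqrt (abs_nonneg _)).symm
  have hs1 : 1 < s := by rw [hs_def]; exact Real.lt_sqrt_of_sq_lt (by simpa using hsig)
  have hs0 : 0 < s := one_pos.trans hs1
  have hsinv : |sig| ^ (-(1 : ℝ) / 2) = 1 / s := by
    rw [neg_div, Real.rpow_neg (abs_nonneg _), ← Real.sqrt_eq_rpow, one_div]
  have hspow : ∀ k : ℕ, |sig| ^ (-(k : ℝ) / 2) = (s ^ k)⁻¹ := by
    intro k
    rw [neg_div, Real.rpow_neg (abs_nonneg _), hs_def, Real.sqrt_eq_rpow, ← Real.rpow_natCast,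
      ← Real.rpow_mul (abs_nonneg _)]
    congr 2
    ring
  obtain ⟨t, ht1, hts⟩ := exists_between hs1
  have ht0 : 0 < t := one_pos.trans ht1
  obtain ⟨B, hB⟩ := hNbdd.exists_norm_le
  have hB0 : 0 ≤ B := (norm_nonneg _).trans (hB _ hN0)
  set C : ℝ := |sig| * B * (1 + B * B * R) with hC
  obtain ⟨J, hJ⟩ := pow_unbounded_of_one_lt (C / (2 * ys)) ht1
  have hCJ : C ≤ 2 * ys * t ^ J := by
    rw [div_lt_iff₀ (by positivity)] at hJ
    linarith
  set δ : ℝ := (1 - t / s) / R with hδ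
  have hδ0 : 0 < δ := div_pos (sub_pos.2 ((div_lt_one hs0).2 hts)) hR
  have hsmall : ∀ᶠ k in atTop ⊓ 𝓟 K, ∀ j < J,
      |(f^[j] (pts k 0)).1 * (f^[j] (pts k 0)).2| < δ := by
    refine (eventually_all_finite (Set.finite_lt_nat J)).2 ?_
    intro j _
    have hc : Continuous fun p => |(f^[j] p).1 * (f^[j] p).2| := by
      have := hf.continuous.iterate j
      fun_prop
    have h := (hc.tendsto (xs, 0)).comp hconv
    rw [iterate_stable_axis hlam1 hNconv hN0 hfN hp1 hp2 j] at h
    simp only [mul_zero, abs_zero] at h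
    exact h.eventually (gt_mem_nhds hδ0)
  have hmemK : ∀ᶠ k in atTop ⊓ 𝓟 K, k ∈ K := mem_inf_of_right (mem_principal_self K)
  have hlarge : ∀ᶠ k in atTop ⊓ 𝓟 K, J ≤ k := mem_inf_of_left (eventually_ge_atTop J)
  filter_upwards [hsmall, hmemK, hlarge] with k hk hkK hJk
  obtain ⟨-, -, hstep, hN, -⟩ := hSR k hkK
  have hiter : ∀ j ≤ k, pts k j = f^[j] (pts k 0) := by
    intro j
    induction j with
    | zero => simp
    | succ j ih =>
      intro hj
      rw [hstep j hj, ih (by omega), Function.iterate_succ_apply']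
  have hnext : ∀ j < k, (pts k (j + 1)).2 =
      sig * (pts k j).2 * (1 + (pts k j).1 * (pts k j).2 * G (pts k j)) := by
    intro j hj
    rw [hstep j hj, hfN _ (hN j hj).1]
  have hgrow := growth_lower_bound (a := fun j => |(pts k j).2|) (J := J) (k := k) hs0.le ht0.le
    (by
      intro j hj hjJ
      rw [hnext j hj]
      refine abs_mul_one_add_ge hs0 hs2 (hFGb _ (hN j hj).1).2 ?_
      have h := hk j hjJ
      rw [← hiter j hj.le, hδ, lt_div_iff₀ hR] at h
      exact h.le)
    (by
      intro j hj
      have h := (hN j hj).2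
      rw [hsinv, lt_div_iff₀ hR] at h
      have h' := abs_mul_one_add_ge (y := (pts k j).2) hs0 hs2 (hFGb _ (hN j hj).1).2 h.le
      rw [mul_one] at h'
      rwa [hnext j hj])
    k le_rfl
  rw [min_eq_right hJk] at hgrow
  have hend : |(pts k k).2| ≤ C := by
    obtain ⟨n, rfl⟩ : ∃ n, k = n + 1 := ⟨k - 1, by have := hK1 k hkK; omega⟩
    have hn := (hN n n.lt_succ_self).1
    have hx : |(pts (n + 1) n).1| ≤ B := (norm_fst_le _).trans (hB _ hn)
    have hy : |(pts (n + 1) n).2| ≤ B := (norm_snd_le _).trans (hB _ hn)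
    have hGn := (hFGb _ hn).2
    rw [hnext n n.lt_succ_self, abs_mul, abs_mul, hC]
    gcongr
    refine (abs_add_le _ _).trans ?_
    rw [abs_one, abs_mul, abs_mul]
    gcongr
  rw [hspow, ← div_eq_mul_inv, le_div_iff₀ (by positivity)]
  have htJ : 0 < t ^ J := by positivity
  refine le_of_mul_le_mul_right ?_ htJ
  calc |(pts k 0).2| * s ^ k * t ^ J = s ^ k * t ^ J * |(pts k 0).2| := by ring
    _ ≤ C := hgrow.trans hend
    _ ≤ _ := hCJ
end
end

section
/- Suppose |λσ| ≤ 1 and suppose there is an infinite set K of positive integers such that for every k ∈ K the map f has an SR_k-solution with parameter η = η_R, with points (x_j^{(k)}, y_j^{(k)}) for j = 0,…,k, and (x₀^{(k)}, y₀^{(k)}) → (x*, 0) as k → ∞ in K. Then there exists ω > 0 such that |x_j^{(k)}| ≤ ω|λ|^j and |y_j^{(k)}| ≤ ω|σ|^{j−k} for all j ∈ {0,…,k} and all sufficiently large k ∈ K. -/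
open Filter Metric

noncomputable section

/-- If `s |y j| ≤ |y (j + 1)|` for `j < k`, then `|y j|` decays like `s⁻¹ ^ (k - j)`. -/
lemma abs_le_of_expanding {y : ℕ → ℝ} {k : ℕ} {s D : ℝ} (hs : 1 < s)
    (hy : ∀ j < k, s * |y j| ≤ |y (j + 1)|) (hD : |y k| ≤ D) :
    ∀ n j, j + n = k → |y j| ≤ D * s⁻¹ ^ n := by
  have hs0 : 0 < s := by linarith
  intro n
  induction n with
  | zero => intro j hj; obtain rfl : j = k := by omega
            simpa using hD
  | succ n ih =>
    intro j hj
    have h1 := ih (j + 1) (by omega)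
    have h2 := hy j (by omega)
    have h3 : |y j| ≤ s⁻¹ * (D * s⁻¹ ^ n) := by
      rw [inv_mul_eq_div, le_div_iff₀ hs0]
      linarith
    calc |y j| ≤ s⁻¹ * (D * s⁻¹ ^ n) := h3
      _ = D * s⁻¹ ^ (n + 1) := by ring

/-- Telescoping of the geometric potential `B * s⁻¹ ^ n`. -/
lemma geom_potential_step {s : ℝ} (hs : 1 < s) (A : ℝ) (n : ℕ) :
    A * s⁻¹ ^ (n + 1) = A / (s - 1) * s⁻¹ ^ n - A / (s - 1) * s⁻¹ ^ (n + 1) := by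
  have h1 : s - 1 ≠ 0 := by linarith
  have h2 : s ≠ 0 := by linarith
  rw [pow_succ]
  field_simp

lemma abs_contracting_le {x u : ℕ → ℝ} {k : ℕ} {s l A C : ℝ} (hs : 1 < s) (hl : 0 ≤ l)
    (hA : 0 ≤ A) (hC : 0 ≤ C) (hx0 : |x 0| ≤ C)
    (hu : ∀ n j, j + n = k → u j ≤ A * s⁻¹ ^ n)
    (hx : ∀ j < k, |x (j + 1)| ≤ l * |x j| * (1 + u j)) :
    ∀ j n, j + n = k → |x j| ≤ C * l ^ j * Real.exp (A / (s - 1) * s⁻¹ ^ n) := by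
  intro j
  induction j with
  | zero =>
    intro n _
    have hB : 0 ≤ A / (s - 1) * s⁻¹ ^ n :=
      mul_nonneg (div_nonneg hA (by linarith)) (by positivity)
    calc |x 0| ≤ C := hx0
      _ ≤ C * Real.exp (A / (s - 1) * s⁻¹ ^ n) := le_mul_of_one_le_right hC (Real.one_le_exp hB)
      _ = _ := by simp
  | succ j ih =>
    intro n hn
    have h1 := ih (n + 1) (by omega)
    have h2 := hu (n + 1) j (by omega)
    have h3 : 1 + u j ≤ Real.exp (A / (s - 1) * s⁻¹ ^ n - A / (s - 1) * s⁻¹ ^ (n + 1)) := by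
      rw [← geom_potential_step hs]
      linarith [Real.add_one_le_exp (A * s⁻¹ ^ (n + 1))]
    calc |x (j + 1)| ≤ l * |x j| * (1 + u j) := hx j (by omega)
      _ ≤ l * |x j| * Real.exp (A / (s - 1) * s⁻¹ ^ n - A / (s - 1) * s⁻¹ ^ (n + 1)) := by
          gcongr
      _ ≤ l * (C * l ^ j * Real.exp (A / (s - 1) * s⁻¹ ^ (n + 1))) *
            Real.exp (A / (s - 1) * s⁻¹ ^ n - A / (s - 1) * s⁻¹ ^ (n + 1)) := by gcongr
      _ = C * l ^ (j + 1) * (Real.exp (A / (s - 1) * s⁻¹ ^ (n + 1)) *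
            Real.exp (A / (s - 1) * s⁻¹ ^ n - A / (s - 1) * s⁻¹ ^ (n + 1))) := by ring
      _ = _ := by rw [← Real.exp_add]; ring_nf

lemma exp_neg_mul_le_one_sub {s t : ℝ} (hs : 1 < s) (ht0 : 0 ≤ t) (ht : t ≤ 1 - s⁻¹) :
    Real.exp (-(s * t)) ≤ 1 - t := by
  have hs0 : 0 < s := by linarith
  have h1 : 0 < s⁻¹ := by positivity
  have h2 : 1 ≤ (1 - t) * (1 + s * t) := by
    have h3 : s * t ≤ s - 1 := by
      have := mul_le_mul_of_nonneg_left ht hs0.le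
      rwa [mul_sub, mul_inv_cancel₀ hs0.ne', mul_one] at this
    nlinarith
  rw [Real.exp_neg, inv_le_iff_one_le_mul₀ (Real.exp_pos _)]
  refine h2.trans ?_
  have := Real.add_one_le_exp (s * t)
  exact mul_le_mul_of_nonneg_left (by linarith) (by linarith)

lemma abs_expanding_le {y u : ℕ → ℝ} {k : ℕ} {s g A D : ℝ} (hs : 1 < s) (hg : 0 < g)
    (hD : |y k| ≤ D)
    (hu0 : ∀ j, 0 ≤ u j) (hu1 : ∀ j < k, u j ≤ 1 - s⁻¹)
    (hu : ∀ n j, j + n = k → u j ≤ A * s⁻¹ ^ n)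
    (hy : ∀ j < k, g * |y j| * (1 - u j) ≤ |y (j + 1)|) :
    ∀ n j, j + n = k →
      |y j| ≤ D * (g ^ n)⁻¹ * Real.exp (s * (A / (s - 1) - A / (s - 1) * s⁻¹ ^ n)) := by
  have hs0 : 0 < s := by linarith
  intro n
  induction n with
  | zero => intro j hj; obtain rfl : j = k := by omega
            simpa using hD
  | succ n ih =>
    intro j hj
    have h1 := ih (j + 1) (by omega)
    have h2 := hu (n + 1) j hj
    have h3 := exp_neg_mul_le_one_sub hs (hu0 j) (hu1 j (by omega))
    have h4 := geom_potential_step hs A n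
    have h5 : Real.exp (-(s * (A * s⁻¹ ^ (n + 1)))) ≤ 1 - u j := by
      refine le_trans (Real.exp_le_exp.2 ?_) h3
      have := mul_le_mul_of_nonneg_left h2 hs0.le
      linarith
    have h6 : g * |y j| * Real.exp (-(s * (A * s⁻¹ ^ (n + 1)))) ≤
        D * (g ^ n)⁻¹ * Real.exp (s * (A / (s - 1) - A / (s - 1) * s⁻¹ ^ n)) := by
      refine le_trans ?_ ((hy j (by omega)).trans h1)
      gcongr
    rw [Real.exp_neg, ← div_eq_mul_inv, div_le_iff₀ (Real.exp_pos _), mul_assoc,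
      ← Real.exp_add] at h6
    have h7 : |y j| ≤ g⁻¹ * (D * (g ^ n)⁻¹ *
        Real.exp (s * (A / (s - 1) - A / (s - 1) * s⁻¹ ^ n) + s * (A * s⁻¹ ^ (n + 1)))) := by
      rw [inv_mul_eq_div, le_div_iff₀ hg]
      linarith
    refine h7.trans (le_of_eq ?_)
    rw [h4, pow_succ g, mul_inv,
      show s * (A / (s - 1) - A / (s - 1) * s⁻¹ ^ n) +
        s * (A / (s - 1) * s⁻¹ ^ n - A / (s - 1) * s⁻¹ ^ (n + 1)) =
        s * (A / (s - 1) - A / (s - 1) * s⁻¹ ^ (n + 1)) by ring]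
    ring

theorem xj_yj_bounds
    (f : ℝ × ℝ → ℝ × ℝ) (F G : ℝ × ℝ → ℝ)
    (lam sig R xs ys : ℝ)
    (N : Set (ℝ × ℝ)) (m : ℕ)
    (hf : ContDiff ℝ (⊤ : ℕ∞) f) (hF : ContDiff ℝ (⊤ : ℕ∞) F) (hG : ContDiff ℝ (⊤ : ℕ∞) G)
    (hlam0 : 0 < |lam|) (hlam1 : |lam| < 1) (hsig : 1 < |sig|)
    (hNopen : IsOpen N) (hNconv : Convex ℝ N) (hNbdd : Bornology.IsBounded N)
    (hN0 : ((0 : ℝ), (0 : ℝ)) ∈ N)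
    (hfN : ∀ p ∈ N, f p =
      (lam * p.1 * (1 + p.1 * p.2 * F p), sig * p.2 * (1 + p.1 * p.2 * G p)))
    (hR : 0 < R) (hFGb : ∀ p ∈ N, |F p| ≤ R ∧ |G p| ≤ R)
    (hxs : 0 < xs) (hys : 0 < ys)
    (hp1 : ((xs : ℝ), (0 : ℝ)) ∈ N) (hp2 : ((lam * xs : ℝ), (0 : ℝ)) ∈ N)
    (hp3 : ((0 : ℝ), ys / sig) ∈ N) (hp4 : ((0 : ℝ), ys / sig ^ 2) ∈ N)
    (hm : 1 ≤ m) (hhom : f^[m] (0, ys) = (xs, 0))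
    (hls : |lam * sig| ≤ 1)
    (K : Set ℕ) (pts : ℕ → ℕ → ℝ × ℝ)
    (hK : K.Infinite) (hK1 : ∀ k ∈ K, 1 ≤ k)
    (hSR : ∀ k ∈ K, IsSRSol f (f^[m]) N ((1 - |sig| ^ (-(1 : ℝ) / 2)) / R) m k (pts k))
    (hconv : Tendsto (fun k => pts k 0) (atTop ⊓ 𝓟 K) (nhds ((xs : ℝ), (0 : ℝ)))) :
    ∃ ω > 0, ∀ᶠ k in atTop ⊓ 𝓟 K, ∀ j ≤ k,
      |(pts k j).1| ≤ ω * |lam| ^ j ∧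
      |(pts k j).2| ≤ ω * |sig| ^ ((j : ℤ) - (k : ℤ)) := by
  obtain ⟨C₀, hC₀⟩ := hNbdd.exists_norm_le
  obtain ⟨C, hC, hCN⟩ : ∃ C > 0, ∀ p ∈ N, |p.1| ≤ C ∧ |p.2| ≤ C := by
    refine ⟨max C₀ 1, by positivity, fun p hp => ?_⟩
    have h := (hC₀ p hp).trans (le_max_left C₀ 1)
    exact ⟨(norm_fst_le p).trans h, (norm_snd_le p).trans h⟩
  set s : ℝ := √|sig| with hs_def
  have hs : 1 < s := by rw [hs_def, Real.lt_sqrt zero_le_one]; simpa using hsig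
  have hs0 : 0 < s := by linarith
  have hss : s * s = |sig| := Real.mul_self_sqrt (abs_nonneg _)
  have hpow : |sig| ^ (-(1 : ℝ) / 2) = s⁻¹ := by
    rw [neg_div, Real.rpow_neg (abs_nonneg _), hs_def, Real.sqrt_eq_rpow]
  rw [hpow] at hSR
  have hsi : 0 < s⁻¹ := by positivity
  have hD : 0 < 2 * |sig| * C := by positivity
  obtain ⟨D, hD_def⟩ : ∃ D, D = 2 * |sig| * C := ⟨_, rfl⟩
  rw [← hD_def] at hD
  have hA : 0 < R * C * D := by positivity
  obtain ⟨A, hA_def⟩ : ∃ A, A = R * C * D := ⟨_, rfl⟩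
  rw [← hA_def] at hA
  have hB : 0 < A / (s - 1) := div_pos hA (by linarith)
  refine ⟨C * Real.exp (A / (s - 1)) + D * Real.exp (s * (A / (s - 1))), by positivity, ?_⟩
  refine eventually_inf_principal.2 (Eventually.of_forall fun k hk => ?_)
  obtain ⟨-, -, hstep, hmem, -⟩ := hSR k hk
  have hk1 := hK1 k hk
  generalize pts k = z at hstep hmem
  have hu1 : ∀ j < k, R * |(z j).1 * (z j).2| ≤ 1 - s⁻¹ := fun j hj => by
    have := (lt_div_iff₀ hR).1 (hmem j hj).2
    linarith
  have hbd : ∀ j < k, ∀ H : ℝ, |H| ≤ R →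
      1 - R * |(z j).1 * (z j).2| ≤ |1 + (z j).1 * (z j).2 * H| ∧
      |1 + (z j).1 * (z j).2 * H| ≤ 1 + R * |(z j).1 * (z j).2| := fun j _ H hH => by
    have h1 : |(z j).1 * (z j).2 * H| ≤ R * |(z j).1 * (z j).2| := by
      rw [abs_mul _ H, mul_comm R]
      gcongr
    have h2 := abs_le.1 h1
    exact ⟨le_trans (by linarith) (le_abs_self _), abs_le.2 ⟨by linarith, by linarith⟩⟩
  have hx : ∀ j < k, |(z (j + 1)).1| ≤ |lam| * |(z j).1| * (1 + R * |(z j).1 * (z j).2|) := by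
    intro j hj
    rw [hstep j hj, hfN _ (hmem j hj).1, abs_mul, abs_mul lam]
    have := (hbd j hj _ (hFGb _ (hmem j hj).1).1).2
    gcongr
  have hyEq : ∀ j < k, |(z (j + 1)).2| =
      |sig| * |(z j).2| * |1 + (z j).1 * (z j).2 * G (z j)| := fun j hj => by
    rw [hstep j hj, hfN _ (hmem j hj).1, abs_mul, abs_mul sig]
  have hy : ∀ j < k, |sig| * |(z j).2| * (1 - R * |(z j).1 * (z j).2|) ≤ |(z (j + 1)).2| := by
    intro j hj
    rw [hyEq j hj]
    have := (hbd j hj _ (hFGb _ (hmem j hj).1).2).1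
    gcongr
  have hyk : |(z k).2| ≤ D := by
    obtain ⟨i, rfl⟩ : ∃ i, k = i + 1 := ⟨k - 1, by omega⟩
    have hi : i < i + 1 := Nat.lt_succ_self i
    have h1 := (hbd i hi _ (hFGb _ (hmem i hi).1).2).2
    have h2 := hu1 i hi
    calc |(z (i + 1)).2| = |sig| * |(z i).2| * |1 + (z i).1 * (z i).2 * G (z i)| := hyEq i hi
      _ ≤ |sig| * C * 2 := by
          gcongr
          · exact (hCN _ (hmem i hi).1).2
          · linarith
      _ = D := by rw [hD_def]; ring
  have hyexp : ∀ j < k, s * |(z j).2| ≤ |(z (j + 1)).2| := fun j hj => by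
    refine le_trans ?_ (hy j hj)
    calc s * |(z j).2| = |sig| * |(z j).2| * s⁻¹ := by rw [← hss]; field_simp
      _ ≤ _ := by
        have := hu1 j hj
        gcongr
        linarith
  have hydec := abs_le_of_expanding (y := fun j => (z j).2) hs hyexp hyk
  -- the last point may lie outside `N`, so the products are cut off there
  let u : ℕ → ℝ := fun j => if j < k then R * |(z j).1 * (z j).2| else 0
  have hu_of : ∀ j < k, u j = R * |(z j).1 * (z j).2| := fun j hj => if_pos hj
  have hu0 : ∀ j, 0 ≤ u j := fun j => by
    dsimp only [u]
    split_ifs <;> positivity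
  have hu : ∀ n j, j + n = k → u j ≤ A * s⁻¹ ^ n := fun n j hj => by
    by_cases hjk : j < k
    · rw [hu_of j hjk, abs_mul, hA_def]
      calc R * (|(z j).1| * |(z j).2|) ≤ R * (C * (D * s⁻¹ ^ n)) := by
            have h1 := (hCN _ (hmem j hjk).1).1
            have h2 : |(z j).2| ≤ D * s⁻¹ ^ n := hydec n j hj
            gcongr
        _ = R * C * D * s⁻¹ ^ n := by ring
    · dsimp only [u]
      rw [if_neg hjk]
      positivity
  have hX := abs_contracting_le (x := fun j => (z j).1) hs hlam0.le hA.le hC.le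
    (hCN _ (hmem 0 hk1).1).1 hu (fun j hj => by rw [hu_of j hj]; exact hx j hj)
  have hY := abs_expanding_le (y := fun j => (z j).2) hs (by linarith : 0 < |sig|) hyk hu0
    (fun j hj => by rw [hu_of j hj]; exact hu1 j hj) hu
    (fun j hj => by rw [hu_of j hj]; exact hy j hj)
  intro j hj
  obtain ⟨n, rfl⟩ := Nat.exists_eq_add_of_le hj
  have hpn : s⁻¹ ^ n ≤ 1 := pow_le_one₀ hsi.le (inv_le_one_of_one_le₀ hs.le)
  constructor
  · calc |(z j).1| ≤ C * |lam| ^ j * Real.exp (A / (s - 1) * s⁻¹ ^ n) := hX j n rfl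
      _ ≤ C * |lam| ^ j * Real.exp (A / (s - 1)) := by
          gcongr
          exact mul_le_of_le_one_right hB.le hpn
      _ = C * Real.exp (A / (s - 1)) * |lam| ^ j := by ring
      _ ≤ _ := by
          gcongr
          exact le_add_of_nonneg_right (by positivity)
  · have hz : |sig| ^ ((j : ℤ) - ((j + n : ℕ) : ℤ)) = (|sig| ^ n)⁻¹ := by
      rw [show (j : ℤ) - ((j + n : ℕ) : ℤ) = -(n : ℤ) by push_cast; ring, zpow_neg, zpow_natCast]
    rw [hz]
    calc |(z j).2| ≤ D * (|sig| ^ n)⁻¹ *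
          Real.exp (s * (A / (s - 1) - A / (s - 1) * s⁻¹ ^ n)) := hY n j rfl
      _ ≤ D * (|sig| ^ n)⁻¹ * Real.exp (s * (A / (s - 1))) := by
          gcongr
          exact sub_le_self _ (by positivity)
      _ = D * Real.exp (s * (A / (s - 1))) * (|sig| ^ n)⁻¹ := by ring
      _ ≤ _ := by
          gcongr
          exact le_add_of_nonneg_left (by positivity)
end
end

section
/- Suppose |λσ| ≤ 1 and suppose there is an infinite set K of positive integers such that for every k ∈ K the map f has an SR_k-solution with parameter η = η_R, with points (x_j^{(k)}, y_j^{(k)}) for j = 0,…,k, and (x₀^{(k)}, y₀^{(k)}) → (x*, 0) as k → ∞ in K. For j = 0,…,k−1 let M_j = DT₀(x_j^{(k)}, y_j^{(k)}) with entries p_j, q_j (first row) and r_j, s_j (second row). Then there exists α > 0 such that |p_j − λ| ≤ α|σ|^{−k}, |q_j| ≤ α|σ|^{−2j}, |r_j| ≤ α|σ|^{2(j−k)}, and |s_j − σ| ≤ α|σ|^{−k}, for all j ∈ {0,…,k−1} and all sufficiently large k ∈ K. -/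
lemma le_pow_mul_add_of_le_mul {u : ℕ → ℝ} {c : ℝ} {k : ℕ} (hc : 0 ≤ c)
    (h : ∀ i, i + 1 < k → u i ≤ c * u (i + 1)) (d : ℕ) :
    ∀ i, i + d < k → u i ≤ c ^ d * u (i + d) := by
  induction d with
  | zero => intro i _; simp
  | succ d ih =>
    intro i hi
    calc u i ≤ c ^ d * u (i + d) := ih i (by omega)
      _ ≤ c ^ d * (c * u (i + d + 1)) := by gcongr; exact h _ (by omega)
      _ = c ^ (d + 1) * u (i + (d + 1)) := by rw [← add_assoc]; ring

lemma le_pow_mul_zero_of_le_mul {u : ℕ → ℝ} {c : ℝ} {k : ℕ} (hc : 0 ≤ c)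
    (h : ∀ i, i + 1 < k → u (i + 1) ≤ c * u i) (i : ℕ) (hi : i < k) :
    u i ≤ c ^ i * u 0 := by
  induction i with
  | zero => simp
  | succ i ih =>
    calc u (i + 1) ≤ c * u i := h i hi
      _ ≤ c * (c ^ i * u 0) := by gcongr; exact ih (by omega)
      _ = c ^ (i + 1) * u 0 := by ring

lemma exists_nat_mul_pow_le {s : ℝ} (h0 : 0 < s) (h1 : s < 1) :
    ∃ D : ℝ, ∀ k : ℕ, (k : ℝ) * s ^ k ≤ D := by
  obtain ⟨D, hD⟩ := (tendsto_self_mul_const_pow_of_lt_one h0.le h1).bddAbove_range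
  exact ⟨D, fun k => hD ⟨k, rfl⟩⟩

/-- A uniform bound on the coordinates of orbit segments near a saddle: the perturbation factors
`1 ± R |x y|` only contribute a bounded factor to the exact geometric rates. -/
lemma exists_saddle_orbit_bound {s R B : ℝ} (h0 : 0 < s) (h1 : s < 1) (hR : 0 < R) (hB : 0 ≤ B) :
    ∃ C : ℝ, 0 < C ∧ ∀ (k : ℕ) (x y : ℕ → ℝ),
      (∀ j < k, |x j| ≤ B) → (∀ j < k, |y j| ≤ B) →
      (∀ j < k, R * |x j * y j| ≤ 1 - s) →
      (∀ j, j + 1 < k → |x (j + 1)| ≤ s ^ 2 * (1 + R * |x j * y j|) * |x j|) →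
      (∀ j, j + 1 < k → (1 - R * |x j * y j|) * |y j| ≤ s ^ 2 * |y (j + 1)|) →
      ∀ j < k, |x j| ≤ C * (s ^ 2) ^ j ∧ |y j| ≤ C * (s ^ 2) ^ (k - j) := by
  obtain ⟨D, hD⟩ := exists_nat_mul_pow_le h0 h1
  have hD0 : 0 ≤ D := by simpa using hD 0
  set A := R * B ^ 2 / s ^ 2 with hA
  have hA0 : 0 ≤ A := by positivity
  refine ⟨Real.exp (A * D) * (B + 1) / s ^ 2, by positivity, ?_⟩
  intro k x y hx hy ht hxs hys j hj
  obtain ⟨n, rfl⟩ : ∃ n, k = n + 1 := ⟨k - 1, by omega⟩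
  have hcx : ∀ i < n + 1, |x i| ≤ s ^ i * B := by
    intro i hi
    refine (le_pow_mul_zero_of_le_mul (u := fun i => |x i|) h0.le ?_ i hi).trans
      (by gcongr; exact hx 0 (by omega))
    intro i hi
    refine (hxs i hi).trans ?_
    gcongr
    have := ht i (by omega)
    calc s ^ 2 * (1 + R * |x i * y i|) ≤ s ^ 2 * (1 + (1 - s)) := by gcongr
      _ ≤ s := by nlinarith [mul_nonneg h0.le (sq_nonneg (1 - s))]
  have hcy : ∀ i < n + 1, |y i| ≤ s ^ (n - i) * B := by
    intro i hi
    have key := le_pow_mul_add_of_le_mul (u := fun i => |y i|) (k := n + 1) h0.le ?_ (n - i) i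
      (by omega)
    · exact key.trans (by gcongr; exact hy _ (by omega))
    intro i hi
    have h2 := hys i hi
    have h3 : s * |y i| ≤ (1 - R * |x i * y i|) * |y i| := by
      gcongr
      linarith [ht i (by omega)]
    have h4 : s * |y i| ≤ s * (s * |y (i + 1)|) := by linarith
    exact le_of_mul_le_mul_left h4 h0
  have hxy : ∀ i < n + 1, |x i * y i| ≤ B ^ 2 * s ^ n := by
    intro i hi
    rw [abs_mul]
    calc |x i| * |y i| ≤ (s ^ i * B) * (s ^ (n - i) * B) := by
          gcongr
          · exact hcx i hi
          · exact hcy i hi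
      _ = B ^ 2 * (s ^ i * s ^ (n - i)) := by ring
      _ = B ^ 2 * s ^ n := by rw [← pow_add]; congr 2; omega
  set c := s ^ 2 * (1 + A * s ^ (n + 1)) with hc
  have hc0 : 0 ≤ c := by positivity
  have hAt : ∀ i < n + 1, R * |x i * y i| / s ≤ A * s ^ (n + 1) := by
    intro i hi
    calc R * |x i * y i| / s ≤ R * (B ^ 2 * s ^ n) / s := by gcongr; exact hxy i hi
      _ = A * s ^ (n + 1) := by rw [hA]; field_simp; ring
  have hcpow : ∀ i ≤ n + 1, c ^ i ≤ Real.exp (A * D) * (s ^ 2) ^ i := by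
    intro i hi
    have hle : 1 + A * s ^ (n + 1) ≤ Real.exp (A * s ^ (n + 1)) := by
      linarith [Real.add_one_le_exp (A * s ^ (n + 1))]
    calc c ^ i = (1 + A * s ^ (n + 1)) ^ i * (s ^ 2) ^ i := by rw [hc, mul_pow]; ring
      _ ≤ Real.exp (A * s ^ (n + 1)) ^ i * (s ^ 2) ^ i := by gcongr
      _ ≤ Real.exp (A * D) * (s ^ 2) ^ i := by
        rw [← Real.exp_nat_mul]
        refine mul_le_mul_of_nonneg_right (Real.exp_le_exp.2 ?_) (by positivity)
        calc (i : ℝ) * (A * s ^ (n + 1)) ≤ ((n + 1 : ℕ) : ℝ) * (A * s ^ (n + 1)) := by gcongr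
          _ = A * (((n + 1 : ℕ) : ℝ) * s ^ (n + 1)) := by ring
          _ ≤ A * D := by gcongr; exact hD _
  have hs2 : s ^ 2 ≤ 1 := by nlinarith
  have hfx : |x j| ≤ c ^ j * |x 0| := by
    refine le_pow_mul_zero_of_le_mul (u := fun i => |x i|) hc0 ?_ j hj
    intro i hi
    refine (hxs i hi).trans ?_
    have h2 : R * |x i * y i| ≤ R * |x i * y i| / s := by
      rw [le_div_iff₀ h0]
      exact mul_le_of_le_one_right (by positivity) h1.le
    rw [hc]
    gcongr ?_ * (1 + ?_) * _
    exact h2.trans (hAt i (by omega))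
  have hfy : |y j| ≤ c ^ (n - j) * |y (j + (n - j))| := by
    refine le_pow_mul_add_of_le_mul (u := fun i => |y i|) (k := n + 1) hc0 ?_ (n - j) j (by omega)
    intro i hi
    have h2 := hys i hi
    have h3 := ht i (by omega)
    have h4 := hAt i (by omega)
    set t := R * |x i * y i| with htdef
    have ht0 : 0 ≤ t := by positivity
    have h5 : 1 ≤ (1 + t / s) * (1 - t) := by
      have : (1 + t / s) * (1 - t) = 1 + t / s * (1 - s - t) := by field_simp; ring
      rw [this]
      have : 0 ≤ t / s * (1 - s - t) := mul_nonneg (by positivity) (by linarith)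
      linarith
    calc |y i| ≤ ((1 + t / s) * (1 - t)) * |y i| := le_mul_of_one_le_left (abs_nonneg _) h5
      _ = (1 + t / s) * ((1 - t) * |y i|) := by ring
      _ ≤ (1 + A * s ^ (n + 1)) * (s ^ 2 * |y (i + 1)|) :=
          mul_le_mul (by linarith) h2 (mul_nonneg (by linarith) (abs_nonneg _)) (by positivity)
      _ = c * |y (i + 1)| := by rw [hc]; ring
  have hB1 : ∀ i < n + 1, |x i| ≤ B + 1 ∧ |y i| ≤ B + 1 := fun i hi =>
    ⟨by linarith [hx i hi], by linarith [hy i hi]⟩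
  constructor
  · calc |x j| ≤ c ^ j * |x 0| := hfx
      _ ≤ (Real.exp (A * D) * (s ^ 2) ^ j) * (B + 1) := by
        gcongr
        · exact hcpow j hj.le
        · exact (hB1 0 (by omega)).1
      _ = Real.exp (A * D) * (B + 1) * (s ^ 2) ^ j := by ring
      _ ≤ Real.exp (A * D) * (B + 1) / s ^ 2 * (s ^ 2) ^ j := by
        gcongr
        rw [le_div_iff₀ (by positivity)]
        exact mul_le_of_le_one_right (by positivity) hs2
  · calc |y j| ≤ c ^ (n - j) * |y (j + (n - j))| := hfy
      _ ≤ (Real.exp (A * D) * (s ^ 2) ^ (n - j)) * (B + 1) := by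
        gcongr
        · exact hcpow _ (by omega)
        · exact (hB1 _ (by omega)).2
      _ = Real.exp (A * D) * (B + 1) / s ^ 2 * (s ^ 2) ^ (n + 1 - j) := by
        rw [show n + 1 - j = (n - j) + 1 by omega, pow_succ (s ^ 2)]
        field_simp

lemma fderiv_mul_fst_one_add {F : ℝ × ℝ → ℝ} (hF : Differentiable ℝ F) (c : ℝ) (z v : ℝ × ℝ) :
    fderiv ℝ (fun p : ℝ × ℝ => c * p.1 * (1 + p.1 * p.2 * F p)) z v =
      c * v.1 * (1 + z.1 * z.2 * F z) +
        c * z.1 * (v.1 * z.2 * F z + z.1 * v.2 * F z + z.1 * z.2 * fderiv ℝ F z v) := by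
  have h1 : HasFDerivAt (fun p : ℝ × ℝ => p.1) (ContinuousLinearMap.fst ℝ ℝ ℝ) z :=
    hasFDerivAt_fst
  have h2 : HasFDerivAt (fun p : ℝ × ℝ => p.2) (ContinuousLinearMap.snd ℝ ℝ ℝ) z :=
    hasFDerivAt_snd
  have h := (h1.const_mul c).mul (((h1.mul h2).mul (hF z).hasFDerivAt).const_add 1)
  rw [HasFDerivAt.fderiv (f := fun p : ℝ × ℝ => c * p.1 * (1 + p.1 * p.2 * F p)) h]
  simp
  ring

lemma fderiv_mul_snd_one_add {G : ℝ × ℝ → ℝ} (hG : Differentiable ℝ G) (c : ℝ) (z v : ℝ × ℝ) :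
    fderiv ℝ (fun p : ℝ × ℝ => c * p.2 * (1 + p.1 * p.2 * G p)) z v =
      c * v.2 * (1 + z.1 * z.2 * G z) +
        c * z.2 * (v.1 * z.2 * G z + z.1 * v.2 * G z + z.1 * z.2 * fderiv ℝ G z v) := by
  have h1 : HasFDerivAt (fun p : ℝ × ℝ => p.1) (ContinuousLinearMap.fst ℝ ℝ ℝ) z :=
    hasFDerivAt_fst
  have h2 : HasFDerivAt (fun p : ℝ × ℝ => p.2) (ContinuousLinearMap.snd ℝ ℝ ℝ) z :=
    hasFDerivAt_snd
  have h := (h2.const_mul c).mul (((h1.mul h2).mul (hG z).hasFDerivAt).const_add 1)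
  rw [HasFDerivAt.fderiv (f := fun p : ℝ × ℝ => c * p.2 * (1 + p.1 * p.2 * G p)) h]
  simp
  ring

lemma exists_norm_fderiv_le_of_isBounded {F : ℝ × ℝ → ℝ} (hF : ContDiff ℝ (⊤ : ℕ∞) F)
    {N : Set (ℝ × ℝ)} (hN : Bornology.IsBounded N) :
    ∃ M, ∀ z ∈ N, ‖fderiv ℝ F z‖ ≤ M := by
  obtain ⟨M, hM⟩ := hN.isCompact_closure.exists_bound_of_continuousOn
    (hF.continuous_fderiv (by simp)).continuousOn
  exact ⟨M, fun z hz => hM z (subset_closure hz)⟩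

/-- Bounds for the partial derivatives of `c u (1 + u w F)` in terms of `u`, `w`, where `a` is the
value of `F` and `d` that of one of its partial derivatives. -/
lemma abs_diag_off_diag_le {c u w a d L R B M : ℝ} (hc : |c| ≤ L) (ha : |a| ≤ R)
    (hd : |d| ≤ M) (hu : |u| ≤ B) (hw : |w| ≤ B) :
    |c * (2 * (u * w) * a + u * (u * w) * d)| ≤ L * (2 * R + B * M) * (|u| * |w|) ∧
      |c * (u ^ 2 * (a + w * d))| ≤ L * (2 * R + B * M) * |u| ^ 2 := by
  have hL : 0 ≤ L := (abs_nonneg _).trans hc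
  have hR : 0 ≤ R := (abs_nonneg _).trans ha
  have hM : 0 ≤ M := (abs_nonneg _).trans hd
  have hB : 0 ≤ B := (abs_nonneg _).trans hu
  constructor
  · calc |c * (2 * (u * w) * a + u * (u * w) * d)|
        = |c| * |2 * a + u * d| * (|u| * |w|) := by
          rw [← abs_mul, ← abs_mul, ← abs_mul]; congr 1; ring
      _ ≤ L * (2 * R + B * M) * (|u| * |w|) := by
          gcongr
          refine (abs_add_le _ _).trans ?_
          rw [abs_mul, abs_mul, abs_two]
          gcongr
  · calc |c * (u ^ 2 * (a + w * d))| = |c| * |a + w * d| * |u| ^ 2 := by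
          rw [← abs_pow, ← abs_mul, ← abs_mul]; congr 1; ring
      _ ≤ L * (2 * R + B * M) * |u| ^ 2 := by
          gcongr
          refine (abs_add_le _ _).trans ?_
          rw [abs_mul]
          have : |w| * |d| ≤ B * M := by gcongr
          linarith


open Filter Metric

noncomputable section

theorem jacobian_entry_bounds
    (f T₀ : ℝ × ℝ → ℝ × ℝ) (F G : ℝ × ℝ → ℝ)
    (lam sig R xs ys : ℝ)
    (N : Set (ℝ × ℝ)) (m : ℕ)
    (hf : ContDiff ℝ (⊤ : ℕ∞) f) (hF : ContDiff ℝ (⊤ : ℕ∞) F) (hG : ContDiff ℝ (⊤ : ℕ∞) G)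
    (hlam0 : 0 < |lam|) (hlam1 : |lam| < 1) (hsig : 1 < |sig|)
    (hNopen : IsOpen N) (hNconv : Convex ℝ N) (hNbdd : Bornology.IsBounded N)
    (hN0 : ((0 : ℝ), (0 : ℝ)) ∈ N)
    (hT₀ : ∀ p : ℝ × ℝ, T₀ p =
      (lam * p.1 * (1 + p.1 * p.2 * F p), sig * p.2 * (1 + p.1 * p.2 * G p)))
    (hfN : ∀ p ∈ N, f p = T₀ p)
    (hR : 0 < R) (hFGb : ∀ p ∈ N, |F p| ≤ R ∧ |G p| ≤ R)
    (hxs : 0 < xs) (hys : 0 < ys)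
    (hp1 : ((xs : ℝ), (0 : ℝ)) ∈ N) (hp2 : ((lam * xs : ℝ), (0 : ℝ)) ∈ N)
    (hp3 : ((0 : ℝ), ys / sig) ∈ N) (hp4 : ((0 : ℝ), ys / sig ^ 2) ∈ N)
    (hm : 1 ≤ m) (hhom : f^[m] (0, ys) = (xs, 0))
    (hls : |lam * sig| ≤ 1)
    (K : Set ℕ) (pts : ℕ → ℕ → ℝ × ℝ)
    (hK : K.Infinite) (hK1 : ∀ k ∈ K, 1 ≤ k)
    (hSR : ∀ k ∈ K, IsSRSol f (f^[m]) N ((1 - |sig| ^ (-(1 : ℝ) / 2)) / R) m k (pts k))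
    (hconv : Tendsto (fun k => pts k 0) (atTop ⊓ 𝓟 K) (nhds ((xs : ℝ), (0 : ℝ)))) :
    ∃ α > 0, ∀ᶠ k in atTop ⊓ 𝓟 K, ∀ j < k,
      |jac T₀ (pts k j) 0 0 - lam| ≤ α * |sig| ^ (-(k : ℤ)) ∧
      |jac T₀ (pts k j) 0 1| ≤ α * |sig| ^ (-(2 * j : ℤ)) ∧
      |jac T₀ (pts k j) 1 0| ≤ α * |sig| ^ (2 * ((j : ℤ) - (k : ℤ))) ∧
      |jac T₀ (pts k j) 1 1 - sig| ≤ α * |sig| ^ (-(k : ℤ)) := by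
  set L := |sig| with hL
  have hL0 : 0 < L := by linarith
  set s := L ^ (-(1 : ℝ) / 2) with hs
  have hs0 : 0 < s := Real.rpow_pos_of_pos hL0 _
  have hs1 : s < 1 := Real.rpow_lt_one_of_one_lt_of_neg hsig (by norm_num)
  have hsL : s ^ 2 = L⁻¹ := by
    rw [hs, ← Real.rpow_natCast, ← Real.rpow_mul hL0.le, ← Real.rpow_neg_one]
    norm_num
  have hlamL : |lam| ≤ s ^ 2 := by
    rw [hsL, ← one_div, le_div_iff₀ hL0, hL, ← abs_mul]
    exact hls
  obtain ⟨B, hB⟩ := hNbdd.exists_norm_le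
  have hB0 : 0 ≤ B := (norm_nonneg _).trans (hB _ hN0)
  have hB1 : ∀ p ∈ N, |p.1| ≤ B := fun p hp => (norm_fst_le p).trans (hB p hp)
  have hB2 : ∀ p ∈ N, |p.2| ≤ B := fun p hp => (norm_snd_le p).trans (hB p hp)
  obtain ⟨MF, hMF⟩ := exists_norm_fderiv_le_of_isBounded hF hNbdd
  obtain ⟨MG, hMG⟩ := exists_norm_fderiv_le_of_isBounded hG hNbdd
  set M := max MF MG with hM
  have hM0 : 0 ≤ M := (norm_nonneg _).trans ((hMF _ hN0).trans (le_max_left _ _))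
  have hdF : ∀ p ∈ N, ∀ v : ℝ × ℝ, ‖v‖ = 1 → |fderiv ℝ F p v| ≤ M := fun p hp v hv => by
    have := (fderiv ℝ F p).le_opNorm v
    rw [hv, mul_one] at this
    exact this.trans ((hMF p hp).trans (le_max_left _ _))
  have hdG : ∀ p ∈ N, ∀ v : ℝ × ℝ, ‖v‖ = 1 → |fderiv ℝ G p v| ≤ M := fun p hp v hv => by
    have := (fderiv ℝ G p).le_opNorm v
    rw [hv, mul_one] at this
    exact this.trans ((hMG p hp).trans (le_max_right _ _))
  have he1 : ‖((1 : ℝ), (0 : ℝ))‖ = 1 := by simp [Prod.norm_def]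
  have he2 : ‖((0 : ℝ), (1 : ℝ))‖ = 1 := by simp [Prod.norm_def]
  have hFd : Differentiable ℝ F := hF.differentiable (by simp)
  have hGd : Differentiable ℝ G := hG.differentiable (by simp)
  obtain ⟨C, hC0, hC⟩ := exists_saddle_orbit_bound hs0 hs1 hR hB0
  refine ⟨L * (2 * R + B * M) * C ^ 2, by positivity, ?_⟩
  rw [eventually_inf_principal]
  refine Eventually.of_forall fun k hk j hj => ?_
  obtain ⟨-, -, hstep, hmem, -⟩ := hSR k hk
  have hN : ∀ i < k, pts k i ∈ N := fun i hi => (hmem i hi).1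
  have hsmall : ∀ i < k, R * |(pts k i).1 * (pts k i).2| ≤ 1 - s := fun i hi => by
    have := (hmem i hi).2
    rw [lt_div_iff₀ hR] at this
    linarith
  have hstep' : ∀ i, i + 1 < k → pts k (i + 1) = T₀ (pts k i) := fun i hi => by
    rw [hstep i (by omega), hfN _ (hN i (by omega))]
  obtain ⟨hx, hy⟩ := hC k (fun i => (pts k i).1) (fun i => (pts k i).2)
    (fun i hi => hB1 _ (hN i hi)) (fun i hi => hB2 _ (hN i hi)) hsmall
    (fun i hi => by
      simp only [hstep' i hi, hT₀]
      have hFi := (hFGb _ (hN i (by omega))).1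
      rw [abs_mul, abs_mul, mul_right_comm]
      gcongr
      refine (abs_add_le _ _).trans ?_
      rw [abs_one, abs_mul, mul_comm R]
      gcongr)
    (fun i hi => by
      simp only [hstep' i hi, hT₀]
      have hGi := (hFGb _ (hN i (by omega))).2
      rw [abs_mul (sig * _), abs_mul sig, hsL, ← hL]
      have h1 : 1 - R * |(pts k i).1 * (pts k i).2| ≤
          |1 + (pts k i).1 * (pts k i).2 * G (pts k i)| := by
        have h2 : |(pts k i).1 * (pts k i).2 * G (pts k i)| ≤
            R * |(pts k i).1 * (pts k i).2| := by
          rw [abs_mul, mul_comm R]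
          gcongr
        have h3 := neg_abs_le ((pts k i).1 * (pts k i).2 * G (pts k i))
        refine le_trans ?_ (le_abs_self _)
        linarith
      calc _ ≤ |1 + (pts k i).1 * (pts k i).2 * G (pts k i)| * |(pts k i).2| := by gcongr
        _ = _ := by field_simp) j hj
  have hzN := hN j hj
  obtain ⟨hFz, hGz⟩ := hFGb _ hzN
  have hxB := hB1 _ hzN
  have hyB := hB2 _ hzN
  generalize pts k j = z at *
  have hlL : |lam| ≤ L := by linarith
  have hT1 : (fun p => (T₀ p).1) = fun p : ℝ × ℝ => lam * p.1 * (1 + p.1 * p.2 * F p) := by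
    funext p; rw [hT₀]
  have hT2 : (fun p => (T₀ p).2) = fun p : ℝ × ℝ => sig * p.2 * (1 + p.1 * p.2 * G p) := by
    funext p; rw [hT₀]
  have hp : jac T₀ z 0 0 - lam = lam * (2 * (z.1 * z.2) * F z +
      z.1 * (z.1 * z.2) * fderiv ℝ F z (1, 0)) := by
    simp only [jac, Matrix.of_apply, Matrix.cons_val', Matrix.cons_val_zero, hT1,
      fderiv_mul_fst_one_add hFd]
    ring
  have hq : jac T₀ z 0 1 = lam * (z.1 ^ 2 * (F z + z.2 * fderiv ℝ F z (0, 1))) := by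
    simp [jac, hT1, fderiv_mul_fst_one_add hFd]
    ring
  have hr : jac T₀ z 1 0 = sig * (z.2 ^ 2 * (G z + z.1 * fderiv ℝ G z (1, 0))) := by
    simp [jac, hT2, fderiv_mul_snd_one_add hGd]
    ring
  have ht : jac T₀ z 1 1 - sig = sig * (2 * (z.2 * z.1) * G z +
      z.2 * (z.2 * z.1) * fderiv ℝ G z (0, 1)) := by
    simp [jac, hT2, fderiv_mul_snd_one_add hGd]
    ring
  have hxy : |z.1| * |z.2| ≤ C ^ 2 * L ^ (-(k : ℤ)) := by
    calc |z.1| * |z.2| ≤ (C * (s ^ 2) ^ j) * (C * (s ^ 2) ^ (k - j)) := by gcongr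
      _ = C ^ 2 * ((s ^ 2) ^ j * (s ^ 2) ^ (k - j)) := by ring
      _ = C ^ 2 * L ^ (-(k : ℤ)) := by
        rw [← pow_add, Nat.add_sub_cancel' hj.le, hsL, zpow_neg, zpow_natCast, inv_pow]
  have hxx : |z.1| ^ 2 ≤ C ^ 2 * L ^ (-(2 * j : ℤ)) := by
    calc |z.1| ^ 2 ≤ (C * (s ^ 2) ^ j) ^ 2 := by gcongr
      _ = C ^ 2 * L ^ (-(2 * j : ℤ)) := by
        rw [mul_pow, hsL, ← pow_mul, zpow_neg, inv_pow, mul_comm j]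
        norm_cast
  have hyy : |z.2| ^ 2 ≤ C ^ 2 * L ^ (2 * ((j : ℤ) - (k : ℤ))) := by
    calc |z.2| ^ 2 ≤ (C * (s ^ 2) ^ (k - j)) ^ 2 := by gcongr
      _ = C ^ 2 * L ^ (2 * ((j : ℤ) - (k : ℤ))) := by
        rw [mul_pow, hsL, ← pow_mul, inv_pow, mul_comm (k - j),
          show 2 * ((j : ℤ) - (k : ℤ)) = -((2 * (k - j) : ℕ) : ℤ) by omega, zpow_neg,
          zpow_natCast]
  have hK0 : 0 ≤ L * (2 * R + B * M) := by positivity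
  rw [hp, hq, hr, ht]
  simp only [mul_assoc (L * (2 * R + B * M))]
  exact ⟨(abs_diag_off_diag_le hlL hFz (hdF _ hzN _ he1) hxB hyB).1.trans (by gcongr),
    (abs_diag_off_diag_le hlL hFz (hdF _ hzN _ he2) hxB hyB).2.trans (by gcongr),
    (abs_diag_off_diag_le hL.ge hGz (hdG _ hzN _ he1) hyB hxB).2.trans (by gcongr),
    (abs_diag_off_diag_le hL.ge hGz (hdG _ hzN _ he2) hyB hxB).1.trans
      (by rw [mul_comm |z.2|]; gcongr)⟩
end
end

section
/- Suppose |λσ| ≤ 1 and suppose there is an infinite set K of positive integers such that for every k ∈ K the map f has an SR_k-solution with parameter η = η_R, with points (x_j^{(k)}, y_j^{(k)}) for j = 0,…,k, and (x₀^{(k)}, y₀^{(k)}) → (x*, 0) as k → ∞ in K. For j = 0,…,k−1 let M_j = DT₀(x_j^{(k)}, y_j^{(k)}), and for j = 1,…,k let P_j = M_{j−1}···M₁M₀ with entries t_j, u_j (first row) and v_j, w_j (second row). Then there exists β > 0 such that |t_j − λ^j| ≤ βj|σ|^{−(j+k)}, |u_j| ≤ βj|σ|^{−j}, |v_j| ≤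 βj|σ|^{j−2k}, and |w_j − σ^j| ≤ βj|σ|^{j−k}, for all j ∈ {1,…,k} and all sufficiently large k ∈ K. -/
open Filter Metric

noncomputable section

/-- `matProd M j = M (j-1) * ⋯ * M 1 * M 0`. -/
def matProd (M : ℕ → Matrix (Fin 2) (Fin 2) ℝ) : ℕ → Matrix (Fin 2) (Fin 2) ℝ
  | 0 => 1
  | j + 1 => M j * matProd M j

/-- A perturbed diagonal linear recursion with contracting diagonal stays close to the unperturbed
one over a time span that is short compared to the inverse size of the perturbation. -/
lemma abs_perturbed_recursion_le {μ ν D ε : ℝ} {k : ℕ} {X Y a b c d : ℕ → ℝ}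
    (hμ : |μ| ≤ 1) (hν : |ν| ≤ 1) (hD : 0 ≤ D) (hε : 0 ≤ ε) (hk : 4 * D * k * ε ≤ 1)
    (hX0 : X 0 = 1) (hY0 : Y 0 = 0)
    (hX : ∀ j < k, X (j + 1) = (μ + a j) * X j + b j * Y j)
    (hY : ∀ j < k, Y (j + 1) = c j * X j + (ν + d j) * Y j)
    (ha : ∀ j < k, |a j| ≤ D * ε) (hb : ∀ j < k, |b j| ≤ D * ε ^ 2)
    (hc : ∀ j < k, |c j| ≤ D) (hd : ∀ j < k, |d j| ≤ D * ε) :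
    ∀ j ≤ k, |X j - μ ^ j| ≤ 3 * D * ε * j ∧ |Y j| ≤ 4 * D * j := by
  intro j
  induction j with
  | zero => simp [hX0, hY0]
  | succ j ih =>
    intro hj
    have hjk : j < k := hj
    obtain ⟨h1, h2⟩ := ih hjk.le
    have hDε : 0 ≤ D * ε := mul_nonneg hD hε
    have hjk' : (j : ℝ) ≤ k := by exact_mod_cast hjk.le
    have h4 : 4 * D * j * ε ≤ 1 := by nlinarith
    have hμj : |μ ^ j| ≤ 1 := by rw [abs_pow]; exact pow_le_one₀ (abs_nonneg _) hμ
    have hX2 : |X j| ≤ 2 := by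
      have h5 : |X j| ≤ |X j - μ ^ j| + |μ ^ j| := by
        simpa using abs_add_le (X j - μ ^ j) (μ ^ j)
      have h6 : 0 ≤ D * ε * j := by positivity
      nlinarith
    have hμX : |μ * (X j - μ ^ j)| ≤ 3 * D * ε * j := by
      rw [abs_mul]
      exact (mul_le_of_le_one_left (abs_nonneg _) hμ).trans h1
    have haX : |a j * X j| ≤ D * ε * 2 := by
      rw [abs_mul]
      exact mul_le_mul (ha j hjk) hX2 (abs_nonneg _) hDε
    have hbY : |b j * Y j| ≤ D * ε := by
      rw [abs_mul]
      calc |b j| * |Y j| ≤ (D * ε ^ 2) * (4 * D * j) :=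
            mul_le_mul (hb j hjk) h2 (abs_nonneg _) (by positivity)
        _ = D * ε * (4 * D * j * ε) := by ring
        _ ≤ D * ε := mul_le_of_le_one_right hDε h4
    have hcX : |c j * X j| ≤ D * 2 := by
      rw [abs_mul]
      exact mul_le_mul (hc j hjk) hX2 (abs_nonneg _) hD
    have hνY : |ν * Y j| ≤ 4 * D * j := by
      rw [abs_mul]
      exact (mul_le_of_le_one_left (abs_nonneg _) hν).trans h2
    have hdY : |d j * Y j| ≤ D := by
      rw [abs_mul]
      calc |d j| * |Y j| ≤ (D * ε) * (4 * D * j) :=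
            mul_le_mul (hd j hjk) h2 (abs_nonneg _) hDε
        _ = D * (4 * D * j * ε) := by ring
        _ ≤ D := mul_le_of_le_one_right hD h4
    push_cast
    constructor
    · have e : X (j + 1) - μ ^ (j + 1) = μ * (X j - μ ^ j) + a j * X j + b j * Y j := by
        rw [hX j hjk]; ring
      rw [e]
      have := abs_add_three (μ * (X j - μ ^ j)) (a j * X j) (b j * Y j)
      linarith
    · have e : Y (j + 1) = c j * X j + ν * Y j + d j * Y j := by
        rw [hY j hjk]; ring
      rw [e]
      have := abs_add_three (c j * X j) (ν * Y j) (d j * Y j)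
      linarith

/-- Bounds on the entries of a product of perturbations of `diag(lam, sig)`. -/
lemma matProd_bounds {M : ℕ → Matrix (Fin 2) (Fin 2) ℝ} {lam sig D : ℝ} {k : ℕ}
    (hsig : 1 < |sig|) (hls : |lam * sig| ≤ 1) (hD : 0 ≤ D)
    (hk : 4 * (D * |sig|) * k * (|sig|⁻¹) ^ k ≤ 1)
    (h00 : ∀ i < k, |M i 0 0 - lam| ≤ D * (|sig|⁻¹) ^ k)
    (h01 : ∀ i < k, |M i 0 1| ≤ D * ((|sig|⁻¹) ^ i) ^ 2)
    (h10 : ∀ i < k, |M i 1 0| ≤ D * ((|sig|⁻¹) ^ k) ^ 2 * (|sig| ^ i) ^ 2)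
    (h11 : ∀ i < k, |M i 1 1 - sig| ≤ D * (|sig|⁻¹) ^ k) {j : ℕ} (hj : j ≤ k) :
    |matProd M j 0 0 - lam ^ j| ≤ 4 * (D * |sig|) * j * |sig| ^ (-((j : ℤ) + (k : ℤ))) ∧
    |matProd M j 0 1| ≤ 4 * (D * |sig|) * j * |sig| ^ (-(j : ℤ)) ∧
    |matProd M j 1 0| ≤ 4 * (D * |sig|) * j * |sig| ^ ((j : ℤ) - 2 * (k : ℤ)) ∧
    |matProd M j 1 1 - sig ^ j| ≤ 4 * (D * |sig|) * j * |sig| ^ ((j : ℤ) - (k : ℤ)) := by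
  obtain ⟨s, hs⟩ : ∃ s, |sig| = s := ⟨_, rfl⟩
  simp only [hs] at hsig hk h00 h01 h10 h11 ⊢
  have hs0 : 0 < s := by linarith
  have hsne : s ≠ 0 := hs0.ne'
  have hq0 : 0 < s⁻¹ := inv_pos.2 hs0
  have hq1 : s⁻¹ ≤ 1 := inv_le_one_of_one_le₀ hsig.le
  have hqs : s⁻¹ ≤ s := hq1.trans hsig.le
  have hDs : 0 ≤ D * s := mul_nonneg hD hs0.le
  have hμ : |s * lam| ≤ 1 := by
    rw [abs_mul, abs_of_pos hs0, ← hs, ← abs_mul, mul_comm]; exact hls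
  have hν : |s⁻¹ * sig| ≤ 1 := by
    rw [abs_mul, abs_of_pos hq0, hs, inv_mul_cancel₀ hsne]
  have ha : ∀ i < k, |s * (M i 0 0 - lam)| ≤ D * s * s⁻¹ ^ k := fun i hi => by
    rw [abs_mul, abs_of_pos hs0]
    nlinarith [mul_le_mul_of_nonneg_left (h00 i hi) hs0.le]
  have hd : ∀ i < k, |s⁻¹ * (M i 1 1 - sig)| ≤ D * s * s⁻¹ ^ k := fun i hi => by
    rw [abs_mul, abs_of_pos hq0]
    calc s⁻¹ * |M i 1 1 - sig| ≤ s * (D * s⁻¹ ^ k) :=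
          mul_le_mul hqs (h11 i hi) (abs_nonneg _) hs0.le
      _ = _ := by ring
  have hb : ∀ i < k, |s * (s ^ i) ^ 2 * M i 0 1| ≤ D * s := fun i hi => by
    rw [abs_mul, abs_of_pos (by positivity)]
    calc s * (s ^ i) ^ 2 * |M i 0 1| ≤ s * (s ^ i) ^ 2 * (D * (s⁻¹ ^ i) ^ 2) := by
          gcongr; exact h01 i hi
      _ = D * s := by rw [inv_pow]; field_simp
  have hc : ∀ i < k, |s⁻¹ * (s⁻¹ ^ i) ^ 2 * M i 1 0| ≤ D * s * (s⁻¹ ^ k) ^ 2 := fun i hi => by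
    rw [abs_mul, abs_of_pos (by positivity)]
    calc s⁻¹ * (s⁻¹ ^ i) ^ 2 * |M i 1 0|
        ≤ s * (s⁻¹ ^ i) ^ 2 * (D * (s⁻¹ ^ k) ^ 2 * (s ^ i) ^ 2) := by
          gcongr; exact h10 i hi
      _ = D * s * (s⁻¹ ^ k) ^ 2 := by rw [inv_pow, inv_pow]; field_simp
  have hrec : ∀ (i : ℕ) (l m : Fin 2),
      matProd M (i + 1) l m = M i l 0 * matProd M i 0 m + M i l 1 * matProd M i 1 m := by
    intro i l m
    simp [matProd, Matrix.mul_apply, Fin.sum_univ_two]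
  have hcol0 := abs_perturbed_recursion_le (k := k) (ε := s⁻¹ ^ k)
    (X := fun i => s ^ i * matProd M i 0 0)
    (Y := fun i => s⁻¹ ^ i * (s ^ k) ^ 2 * matProd M i 1 0)
    (a := fun i => s * (M i 0 0 - lam)) (b := fun i => s * (s ^ i) ^ 2 * M i 0 1 * (s⁻¹ ^ k) ^ 2)
    (c := fun i => s⁻¹ * (s⁻¹ ^ i) ^ 2 * M i 1 0 * (s ^ k) ^ 2)
    (d := fun i => s⁻¹ * (M i 1 1 - sig))
    hμ hν hDs (by positivity) hk (by simp [matProd]) (by simp [matProd])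
    (fun i _ => by simp only [hrec, inv_pow]; field_simp; ring)
    (fun i _ => by simp only [hrec, inv_pow]; field_simp; ring) ha
    (fun i hi => by
      rw [abs_mul, abs_of_pos (a := (s⁻¹ ^ k) ^ 2) (by positivity)]
      exact mul_le_mul_of_nonneg_right (hb i hi) (by positivity))
    (fun i hi => by
      rw [abs_mul, abs_of_pos (a := (s ^ k) ^ 2) (by positivity)]
      calc _ ≤ D * s * (s⁻¹ ^ k) ^ 2 * (s ^ k) ^ 2 :=
            mul_le_mul_of_nonneg_right (hc i hi) (by positivity)
        _ = D * s := by rw [inv_pow]; field_simp) hd j hj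
  have hcol1 := abs_perturbed_recursion_le (k := k) (ε := s⁻¹ ^ k)
    (X := fun i => s⁻¹ ^ i * matProd M i 1 1)
    (Y := fun i => s ^ i * matProd M i 0 1)
    (a := fun i => s⁻¹ * (M i 1 1 - sig)) (b := fun i => s⁻¹ * (s⁻¹ ^ i) ^ 2 * M i 1 0)
    (c := fun i => s * (s ^ i) ^ 2 * M i 0 1)
    (d := fun i => s * (M i 0 0 - lam))
    hν hμ hDs (by positivity) hk (by simp [matProd]) (by simp [matProd])
    (fun i _ => by simp only [hrec, inv_pow]; field_simp; ring)
    (fun i _ => by simp only [hrec, inv_pow]; field_simp; ring) hd hc hb ha j hj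
  obtain ⟨ht, hv⟩ := hcol0
  obtain ⟨hw, hu⟩ := hcol1
  have hsj : 0 < s ^ j := by positivity
  have hsk : 0 < s ^ k := by positivity
  have hnn : 0 ≤ D * s * j := by positivity
  have ez : s ^ (-((j : ℤ) + (k : ℤ))) = (s ^ j)⁻¹ * (s ^ k)⁻¹ := by
    rw [neg_add, zpow_add₀ hsne]; simp
  have ez1 : s ^ (-(j : ℤ)) = (s ^ j)⁻¹ := by simp
  have ez2 : s ^ ((j : ℤ) - 2 * (k : ℤ)) = s ^ j * ((s ^ k) ^ 2)⁻¹ := by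
    rw [sub_eq_add_neg, zpow_add₀ hsne, zpow_neg, mul_comm (2 : ℤ), zpow_mul]; norm_cast
  have ez3 : s ^ ((j : ℤ) - (k : ℤ)) = s ^ j * (s ^ k)⁻¹ := by
    rw [sub_eq_add_neg, zpow_add₀ hsne]; simp
  rw [ez, ez1, ez2, ez3]
  refine ⟨?_, ?_, ?_, ?_⟩
  · rw [mul_pow, ← mul_sub, abs_mul, abs_of_pos hsj, inv_pow] at ht
    rw [← mul_le_mul_iff_right₀ hsj]
    refine ht.trans ?_
    have e : s ^ j * (4 * (D * s) * j * ((s ^ j)⁻¹ * (s ^ k)⁻¹)) = 4 * (D * s * j) * (s ^ k)⁻¹ := by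
      field_simp
    rw [e]
    nlinarith [mul_nonneg hnn (inv_pos.2 hsk).le]
  · rw [abs_mul, abs_of_pos hsj] at hu
    rw [← mul_le_mul_iff_right₀ hsj]
    refine hu.trans (le_of_eq ?_)
    field_simp
  · rw [abs_mul, abs_of_pos (by positivity), inv_pow] at hv
    have hp : 0 < (s ^ j)⁻¹ * (s ^ k) ^ 2 := by positivity
    rw [← mul_le_mul_iff_right₀ hp]
    refine hv.trans (le_of_eq ?_)
    field_simp
  · rw [mul_pow, ← mul_sub, abs_mul, inv_pow, abs_of_pos (inv_pos.2 hsj), inv_pow] at hw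
    rw [← mul_le_mul_iff_right₀ (inv_pos.2 hsj)]
    refine hw.trans ?_
    have e : (s ^ j)⁻¹ * (4 * (D * s) * j * (s ^ j * (s ^ k)⁻¹)) = 4 * (D * s * j) * (s ^ k)⁻¹ := by
      field_simp
    rw [e]
    nlinarith [mul_nonneg hnn (inv_pos.2 hsk).le]

lemma abs_le_mul_pow_of_forward {x : ℕ → ℝ} {B c : ℝ} {k : ℕ} (hc : 0 ≤ c)
    (hB : ∀ j < k, |x j| ≤ B) (h : ∀ j, j + 1 < k → |x (j + 1)| ≤ c * |x j|) :
    ∀ j < k, |x j| ≤ B * c ^ j := by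
  intro j
  induction j with
  | zero => intro hj; simpa using hB 0 hj
  | succ j ih =>
    intro hj
    calc |x (j + 1)| ≤ c * (B * c ^ j) :=
          (h j hj).trans (mul_le_mul_of_nonneg_left (ih (by omega)) hc)
      _ = B * c ^ (j + 1) := by ring

lemma abs_le_mul_pow_of_backward {y : ℕ → ℝ} {B c : ℝ} {k : ℕ} (hc : 0 ≤ c)
    (hB : ∀ j < k, |y j| ≤ B) (h : ∀ j, j + 1 < k → |y j| ≤ c * |y (j + 1)|) :
    ∀ i j, j + i + 1 = k → |y j| ≤ B * c ^ i := by
  intro i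
  induction i with
  | zero => intro j hj; simpa using hB j (by omega)
  | succ i ih =>
    intro j hj
    calc |y j| ≤ c * (B * c ^ i) :=
          (h j (by omega)).trans (mul_le_mul_of_nonneg_left (ih (j + 1) (by omega)) hc)
      _ = B * c ^ (i + 1) := by ring

lemma one_add_pow_le_two {δ : ℝ} {n : ℕ} (hδ : 0 ≤ δ) (h : 2 * (n * δ) ≤ 1) :
    (1 + δ) ^ n ≤ 2 := by
  rcases Nat.eq_zero_or_pos n with rfl | hn
  · norm_num
  have hn1 : (1 : ℝ) ≤ n := by exact_mod_cast hn
  have hδ1 : δ ≤ 1 / 2 := by nlinarith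
  have h1 : 1 + n * (-δ) ≤ (1 + -δ) ^ n := one_add_mul_le_pow (by linarith) n
  have h2 : (1 + δ) ^ n * (1 + -δ) ^ n ≤ 1 := by
    rw [← mul_pow]
    exact pow_le_one₀ (by nlinarith) (by nlinarith)
  have h3 : 0 < (1 + δ) ^ n := by positivity
  nlinarith

/-- Orbits near a resonant saddle: the a priori contraction rate `r` improves to `r ^ 2`. -/
lemma orbit_bounds {x y F G : ℕ → ℝ} {lam sig R B r : ℝ} {k : ℕ}
    (hr0 : 0 < r) (hr1 : r < 1) (hsr : |sig| * r ^ 2 = 1) (hls : |lam * sig| ≤ 1)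
    (hR : 0 < R) (hB : 0 ≤ B)
    (hx : ∀ j < k, |x j| ≤ B) (hy : ∀ j < k, |y j| ≤ B)
    (hF : ∀ j < k, |F j| ≤ R) (hG : ∀ j < k, |G j| ≤ R)
    (hxy : ∀ j < k, |x j * y j| < (1 - r) / R)
    (hxs : ∀ j, j + 1 < k → x (j + 1) = lam * x j * (1 + x j * y j * F j))
    (hys : ∀ j, j + 1 < k → y (j + 1) = sig * y j * (1 + x j * y j * G j))
    (hk : 4 * (k * (R * B ^ 2 * r⁻¹ * r ^ k)) ≤ 1) :
    ∀ j < k, |x j| ≤ 2 * B * (|sig|⁻¹) ^ j ∧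
      |y j| ≤ 2 * B * |sig| * (|sig|⁻¹) ^ k * |sig| ^ j := by
  have hs0 : 0 < |sig| := by
    by_contra h
    have : |sig| = 0 := le_antisymm (not_lt.1 h) (abs_nonneg _)
    rw [this] at hsr; norm_num at hsr
  have hqr : |sig|⁻¹ = r ^ 2 := inv_eq_of_mul_eq_one_right hsr
  have hlam : |lam| ≤ r ^ 2 := by
    rw [abs_mul] at hls
    calc |lam| = |lam| * |sig| * r ^ 2 := by rw [mul_assoc, hsr, mul_one]
      _ ≤ 1 * r ^ 2 := mul_le_mul_of_nonneg_right hls (by positivity)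
      _ = r ^ 2 := one_mul _
  have hpert : ∀ {H : ℕ → ℝ} (_ : ∀ j < k, |H j| ≤ R) {δ : ℝ} {j : ℕ} (_ : j < k)
      (_ : |x j * y j| ≤ δ), |x j * y j * H j| ≤ R * δ := by
    intro H hH δ j hj hδ
    rw [abs_mul, mul_comm R]
    exact mul_le_mul hδ (hH j hj) (abs_nonneg _) ((abs_nonneg _).trans hδ)
  have hfwd : ∀ {e : ℝ} {j : ℕ}, j + 1 < k → |x j * y j * F j| ≤ e →
      |x (j + 1)| ≤ r ^ 2 * (1 + e) * |x j| := by
    intro e j hj he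
    rw [hxs j hj, abs_mul, abs_mul]
    have h1 : |1 + x j * y j * F j| ≤ 1 + e := by
      have := abs_add_le 1 (x j * y j * F j)
      rw [abs_one] at this; linarith
    calc |lam| * |x j| * |1 + x j * y j * F j| ≤ r ^ 2 * |x j| * (1 + e) := by gcongr
      _ = _ := by ring
  have hbwd : ∀ {e : ℝ} {j : ℕ}, j + 1 < k → |x j * y j * G j| ≤ e →
      |y j| * (1 - e) ≤ r ^ 2 * |y (j + 1)| := by
    intro e j hj he
    rw [hys j hj, abs_mul, abs_mul]
    have h1 : 1 - e ≤ |1 + x j * y j * G j| := by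
      have := neg_abs_le (x j * y j * G j)
      exact le_trans (by linarith) (le_abs_self _)
    calc |y j| * (1 - e) ≤ |y j| * |1 + x j * y j * G j| := by gcongr
      _ = (|sig| * r ^ 2) * (|y j| * |1 + x j * y j * G j|) := by rw [hsr, one_mul]
      _ = _ := by ring
  have hRη : R * ((1 - r) / R) = 1 - r := by field_simp
  have hx1 : ∀ j < k, |x j| ≤ B * r ^ j := by
    refine abs_le_mul_pow_of_forward hr0.le hx fun j hj => ?_
    refine (hfwd hj (hpert hF (by omega) (hxy j (by omega)).le)).trans ?_
    rw [hRη]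
    refine mul_le_mul_of_nonneg_right ?_ (abs_nonneg _)
    nlinarith [mul_nonneg hr0.le (sq_nonneg (1 - r))]
  have hy1 : ∀ i j, j + i + 1 = k → |y j| ≤ B * r ^ i := by
    refine abs_le_mul_pow_of_backward hr0.le hy fun j hj => ?_
    have h := hbwd hj (hpert hG (by omega) (hxy j (by omega)).le)
    rw [hRη] at h
    have h' : r * |y j| ≤ r * (r * |y (j + 1)|) := by linarith
    exact le_of_mul_le_mul_left h' hr0
  obtain ⟨δ, hδ⟩ : ∃ δ, δ = R * B ^ 2 * r⁻¹ * r ^ k := ⟨_, rfl⟩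
  have hδ0 : 0 ≤ δ := by rw [hδ]; positivity
  rw [← hδ] at hk
  have hxy2 : ∀ j < k, |x j * y j| ≤ B ^ 2 * r⁻¹ * r ^ k := by
    intro j hj
    obtain ⟨i, rfl⟩ : ∃ i, k = j + i + 1 := ⟨k - j - 1, by omega⟩
    rw [abs_mul]
    calc |x j| * |y j| ≤ (B * r ^ j) * (B * r ^ i) :=
          mul_le_mul (hx1 j hj) (hy1 i j rfl) (abs_nonneg _) (by positivity)
      _ = _ := by rw [pow_succ, pow_add]; field_simp; ring
  have hpert2 : ∀ {H : ℕ → ℝ} (_ : ∀ j < k, |H j| ≤ R) {j : ℕ} (_ : j < k),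
      |x j * y j * H j| ≤ δ := fun hH j hj =>
    (hpert hH hj (hxy2 j hj)).trans (le_of_eq (by rw [hδ]; ring))
  have hpow : ∀ {i : ℕ}, i ≤ k → B * (r ^ 2 * (1 + 2 * δ)) ^ i ≤ 2 * B * (r ^ 2) ^ i := by
    intro i hi
    have hi' : (i : ℝ) ≤ k := by exact_mod_cast hi
    have h2 : (1 + 2 * δ) ^ i ≤ 2 := one_add_pow_le_two (by positivity) (by nlinarith)
    rw [mul_pow]
    calc B * ((r ^ 2) ^ i * (1 + 2 * δ) ^ i) ≤ B * ((r ^ 2) ^ i * 2) := by gcongr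
      _ = _ := by ring
  have hx2 : ∀ j < k, |x j| ≤ B * (r ^ 2 * (1 + 2 * δ)) ^ j := by
    refine abs_le_mul_pow_of_forward (by positivity) hx fun j hj => ?_
    refine (hfwd hj (hpert2 hF (by omega))).trans ?_
    gcongr
    linarith
  have hy2 : ∀ i j, j + i + 1 = k → |y j| ≤ B * (r ^ 2 * (1 + 2 * δ)) ^ i := by
    refine abs_le_mul_pow_of_backward (by positivity) hy fun j hj => ?_
    have h := hbwd hj (hpert2 hG (by omega))
    have hk1 : (1 : ℝ) ≤ k := by exact_mod_cast (by omega : 1 ≤ k)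
    have hδ1 : 4 * δ ≤ 1 := by nlinarith
    have h1 : 1 ≤ (1 - δ) * (1 + 2 * δ) := by nlinarith
    calc |y j| ≤ |y j| * ((1 - δ) * (1 + 2 * δ)) := le_mul_of_one_le_right (abs_nonneg _) h1
      _ = |y j| * (1 - δ) * (1 + 2 * δ) := by ring
      _ ≤ r ^ 2 * |y (j + 1)| * (1 + 2 * δ) := by gcongr
      _ = _ := by ring
  intro j hj
  rw [hqr]
  refine ⟨(hx2 j hj).trans (hpow hj.le), ?_⟩
  obtain ⟨i, rfl⟩ : ∃ i, k = j + i + 1 := ⟨k - j - 1, by omega⟩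
  refine ((hy2 i j rfl).trans (hpow (by omega))).trans (le_of_eq ?_)
  rw [← hqr, pow_succ, pow_add, inv_pow, inv_pow]
  field_simp

/-- Deviation of the Jacobian of a resonant normal form from its linear part. -/
lemma jac_bounds {T₀ : ℝ × ℝ → ℝ × ℝ} {F G : ℝ × ℝ → ℝ} {lam sig R B L : ℝ} {p : ℝ × ℝ}
    (hT₀ : ∀ p : ℝ × ℝ, T₀ p =
      (lam * p.1 * (1 + p.1 * p.2 * F p), sig * p.2 * (1 + p.1 * p.2 * G p)))
    (hF : DifferentiableAt ℝ F p) (hG : DifferentiableAt ℝ G p)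
    (hlam : |lam| ≤ |sig|) (hFR : |F p| ≤ R) (hGR : |G p| ≤ R)
    (hFL : ‖fderiv ℝ F p‖ ≤ L) (hGL : ‖fderiv ℝ G p‖ ≤ L)
    (hx : |p.1| ≤ B) (hy : |p.2| ≤ B) :
    |jac T₀ p 0 0 - lam| ≤ |sig| * (2 * R + B * L) * |p.1 * p.2| ∧
    |jac T₀ p 0 1| ≤ |sig| * (2 * R + B * L) * |p.1| ^ 2 ∧
    |jac T₀ p 1 0| ≤ |sig| * (2 * R + B * L) * |p.2| ^ 2 ∧
    |jac T₀ p 1 1 - sig| ≤ |sig| * (2 * R + B * L) * |p.1 * p.2| := by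
  have h1 : HasFDerivAt (fun p : ℝ × ℝ => p.1) (ContinuousLinearMap.fst ℝ ℝ ℝ) p := hasFDerivAt_fst
  have h2 : HasFDerivAt (fun p : ℝ × ℝ => p.2) (ContinuousLinearMap.snd ℝ ℝ ℝ) p := hasFDerivAt_snd
  have e1 : (fun p => (T₀ p).1) = fun p : ℝ × ℝ => lam * p.1 * (1 + p.1 * p.2 * F p) := by
    funext p; rw [hT₀]
  have e2 : (fun p => (T₀ p).2) = fun p : ℝ × ℝ => sig * p.2 * (1 + p.1 * p.2 * G p) := by
    funext p; rw [hT₀]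
  have d1 := ((h1.const_mul lam).mul (((h1.mul h2).mul hF.hasFDerivAt).const_add 1)).fderiv
  have d2 := ((h2.const_mul sig).mul (((h1.mul h2).mul hG.hasFDerivAt).const_add 1)).fderiv
  have n10 : ‖((1 : ℝ), (0 : ℝ))‖ = 1 := by simp [Prod.norm_def]
  have n01 : ‖((0 : ℝ), (1 : ℝ))‖ = 1 := by simp [Prod.norm_def]
  have hbd : ∀ {A : ℝ × ℝ →L[ℝ] ℝ} (_ : ‖A‖ ≤ L) {v : ℝ × ℝ} (_ : ‖v‖ = 1), |A v| ≤ L := by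
    intro A hA v hv
    have := A.le_opNorm v
    rw [hv, mul_one] at this
    exact this.trans hA
  have hFx := hbd hFL n10
  have hFy := hbd hFL n01
  have hGx := hbd hGL n10
  have hGy := hbd hGL n01
  have hL : 0 ≤ L := (norm_nonneg _).trans hFL
  have hR : 0 ≤ R := (abs_nonneg _).trans hFR
  have hB : 0 ≤ B := (abs_nonneg _).trans hx
  have hmul : ∀ {a b w : ℝ}, |a| ≤ B → |b| ≤ L → |w| ≤ 2 * R →
      |w + a * b| ≤ 2 * R + B * L := by
    intro a b w ha hb hw
    have h3 : |a * b| ≤ B * L := by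
      rw [abs_mul]; exact mul_le_mul ha hb (abs_nonneg _) hB
    exact (abs_add_le _ _).trans (add_le_add hw h3)
  have h2F : |2 * F p| ≤ 2 * R := by rw [abs_mul, abs_two]; linarith
  have h2G : |2 * G p| ≤ 2 * R := by rw [abs_mul, abs_two]; linarith
  have h1F : |F p| ≤ 2 * R := by linarith
  have h1G : |G p| ≤ 2 * R := by linarith
  have hfin : ∀ {e l m w : ℝ}, e = l * w * m → |l| ≤ |sig| → |w| ≤ 2 * R + B * L →
      |e| ≤ |sig| * (2 * R + B * L) * |m| := by
    intro e l m w he hl hw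
    rw [he, abs_mul, abs_mul]
    gcongr
  simp only [jac, Matrix.cons_val', Matrix.cons_val_zero, Matrix.cons_val_one, Matrix.of_apply,
    Matrix.cons_val_fin_one, e1, e2, ← abs_pow]
  refine ⟨hfin (l := lam) (w := 2 * F p + p.1 * fderiv ℝ F p (1, 0)) ?_ hlam (hmul hx hFx h2F),
    hfin (l := lam) (w := F p + p.2 * fderiv ℝ F p (0, 1)) ?_ hlam
      (hmul hy hFy h1F),
    hfin (l := sig) (w := G p + p.1 * fderiv ℝ G p (1, 0)) ?_ le_rfl
      (hmul hx hGx h1G),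
    hfin (l := sig) (w := 2 * G p + p.2 * fderiv ℝ G p (0, 1)) ?_ le_rfl (hmul hy hGy h2G)⟩
  · erw [d1]; simp; ring
  · erw [d1]; simp; ring
  · erw [d2]; simp; ring
  · erw [d2]; simp; ring

/-- A smooth function has bounded derivative on bounded sets. -/
lemma exists_fderiv_bound {N : Set (ℝ × ℝ)} (hN : Bornology.IsBounded N) {F : ℝ × ℝ → ℝ}
    (hF : ContDiff ℝ (⊤ : ℕ∞) F) : ∃ L, ∀ p ∈ N, ‖fderiv ℝ F p‖ ≤ L := by
  obtain ⟨L, hL⟩ := hN.isCompact_closure.exists_bound_of_continuousOn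
    (hF.continuous_fderiv (by simp)).continuousOn
  exact ⟨L, fun p hp => hL p (subset_closure hp)⟩


theorem jacobian_product_bounds
    (f T₀ : ℝ × ℝ → ℝ × ℝ) (F G : ℝ × ℝ → ℝ)
    (lam sig R xs ys : ℝ)
    (N : Set (ℝ × ℝ)) (m : ℕ)
    (hf : ContDiff ℝ (⊤ : ℕ∞) f) (hF : ContDiff ℝ (⊤ : ℕ∞) F) (hG : ContDiff ℝ (⊤ : ℕ∞) G)
    (hlam0 : 0 < |lam|) (hlam1 : |lam| < 1) (hsig : 1 < |sig|)
    (hNopen : IsOpen N) (hNconv : Convex ℝ N) (hNbdd : Bornology.IsBounded N)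
    (hN0 : ((0 : ℝ), (0 : ℝ)) ∈ N)
    (hT₀ : ∀ p : ℝ × ℝ, T₀ p =
      (lam * p.1 * (1 + p.1 * p.2 * F p), sig * p.2 * (1 + p.1 * p.2 * G p)))
    (hfN : ∀ p ∈ N, f p = T₀ p)
    (hR : 0 < R) (hFGb : ∀ p ∈ N, |F p| ≤ R ∧ |G p| ≤ R)
    (hxs : 0 < xs) (hys : 0 < ys)
    (hp1 : ((xs : ℝ), (0 : ℝ)) ∈ N) (hp2 : ((lam * xs : ℝ), (0 : ℝ)) ∈ N)
    (hp3 : ((0 : ℝ), ys / sig) ∈ N) (hp4 : ((0 : ℝ), ys / sig ^ 2) ∈ N)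
    (hm : 1 ≤ m) (hhom : f^[m] (0, ys) = (xs, 0))
    (hls : |lam * sig| ≤ 1)
    (K : Set ℕ) (pts : ℕ → ℕ → ℝ × ℝ)
    (hK : K.Infinite) (hK1 : ∀ k ∈ K, 1 ≤ k)
    (hSR : ∀ k ∈ K, IsSRSol f (f^[m]) N ((1 - |sig| ^ (-(1 : ℝ) / 2)) / R) m k (pts k))
    (hconv : Tendsto (fun k => pts k 0) (atTop ⊓ 𝓟 K) (nhds ((xs : ℝ), (0 : ℝ)))) :
    ∃ β > 0, ∀ᶠ k in atTop ⊓ 𝓟 K, ∀ j : ℕ, 1 ≤ j → j ≤ k →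
      |matProd (fun i => jac T₀ (pts k i)) j 0 0 - lam ^ j|
        ≤ β * j * |sig| ^ (-((j : ℤ) + (k : ℤ))) ∧
      |matProd (fun i => jac T₀ (pts k i)) j 0 1| ≤ β * j * |sig| ^ (-(j : ℤ)) ∧
      |matProd (fun i => jac T₀ (pts k i)) j 1 0|
        ≤ β * j * |sig| ^ ((j : ℤ) - 2 * (k : ℤ)) ∧
      |matProd (fun i => jac T₀ (pts k i)) j 1 1 - sig ^ j|
        ≤ β * j * |sig| ^ ((j : ℤ) - (k : ℤ)) := by
  obtain ⟨B, hB0, hB⟩ := hNbdd.exists_pos_norm_le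
  obtain ⟨L₁, hL₁⟩ := exists_fderiv_bound hNbdd hF
  obtain ⟨L₂, hL₂⟩ := exists_fderiv_bound hNbdd hG
  have hL0 : 0 ≤ max L₁ L₂ := (norm_nonneg _).trans ((hL₁ _ hN0).trans (le_max_left _ _))
  obtain ⟨L, hL⟩ : ∃ L, L = max L₁ L₂ := ⟨_, rfl⟩
  rw [← hL] at hL0
  have hs0 : 0 < |sig| := by linarith
  obtain ⟨r, hr⟩ : ∃ r, r = |sig| ^ (-(1 : ℝ) / 2) := ⟨_, rfl⟩
  rw [← hr] at hSR
  have hr0 : 0 < r := hr ▸ Real.rpow_pos_of_pos hs0 _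
  have hr1 : r < 1 := hr ▸ Real.rpow_lt_one_of_one_lt_of_neg hsig (by norm_num)
  have hsr : |sig| * r ^ 2 = 1 := by
    rw [hr, ← Real.rpow_natCast, ← Real.rpow_mul hs0.le]
    norm_num [Real.rpow_neg_one]
    exact mul_inv_cancel₀ hs0.ne'
  have hq0 : 0 < |sig|⁻¹ := inv_pos.2 hs0
  have hq1 : |sig|⁻¹ < 1 := inv_lt_one_of_one_lt₀ hsig
  obtain ⟨C, hC⟩ : ∃ C, C = |sig| * (2 * R + B * L) := ⟨_, rfl⟩
  have hC0 : 0 < C := by rw [hC]; positivity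
  obtain ⟨D, hD⟩ : ∃ D, D = C * (4 * B ^ 2 * |sig| ^ 2) := ⟨_, rfl⟩
  have hD0 : 0 < D := by rw [hD]; positivity
  have hlim : ∀ (c q : ℝ), 0 ≤ q → q < 1 → ∀ᶠ k : ℕ in atTop, c * (k * q ^ k) ≤ 1 := by
    intro c q h0 h1
    have h := (tendsto_self_mul_const_pow_of_lt_one h0 h1).const_mul c
    rw [mul_zero] at h
    exact h.eventually (ge_mem_nhds one_pos)
  refine ⟨4 * (D * |sig|), by positivity, ?_⟩
  filter_upwards [mem_inf_of_left (hlim (4 * (D * |sig|)) _ hq0.le hq1),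
    mem_inf_of_left (hlim (4 * (R * B ^ 2 * r⁻¹)) r hr0.le hr1),
    mem_inf_of_right (mem_principal_self K)] with k hk1 hk2 hkK j _ hj
  obtain ⟨-, -, hstep, hmem, -⟩ := hSR k hkK
  have hN : ∀ i < k, pts k i ∈ N := fun i hi => (hmem i hi).1
  have hxB : ∀ i < k, |(pts k i).1| ≤ B := fun i hi =>
    (norm_fst_le (pts k i)).trans (hB _ (hN i hi))
  have hyB : ∀ i < k, |(pts k i).2| ≤ B := fun i hi =>
    (norm_snd_le (pts k i)).trans (hB _ (hN i hi))
  have hstep' : ∀ i, i + 1 < k → pts k (i + 1) = T₀ (pts k i) := fun i hi => by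
    rw [hstep i (by omega), hfN _ (hN i (by omega))]
  have horb := orbit_bounds (k := k) (x := fun i => (pts k i).1) (y := fun i => (pts k i).2)
    (F := fun i => F (pts k i)) (G := fun i => G (pts k i)) hr0 hr1 hsr hls hR hB0.le hxB hyB
    (fun i hi => (hFGb _ (hN i hi)).1) (fun i hi => (hFGb _ (hN i hi)).2)
    (fun i hi => (hmem i hi).2) (fun i hi => by rw [hstep' i hi, hT₀])
    (fun i hi => by rw [hstep' i hi, hT₀]) (le_of_eq_of_le (by ring) hk2)
  have hjac : ∀ i < k, _ := fun i hi => jac_bounds (p := pts k i) (L := L) hT₀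
    (hF.differentiable (by simp) _) (hG.differentiable (by simp) _) (hlam1.trans hsig).le
    (hFGb _ (hN i hi)).1 (hFGb _ (hN i hi)).2
    ((hL₁ _ (hN i hi)).trans (hL ▸ le_max_left _ _))
    ((hL₂ _ (hN i hi)).trans (hL ▸ le_max_right _ _)) (hxB i hi) (hyB i hi)
  rw [← hC] at hjac
  have hsq : |sig| ≤ |sig| ^ 2 := by nlinarith
  have hsq1 : 1 ≤ |sig| ^ 2 := by nlinarith
  have hprod : ∀ i < k, C * |(pts k i).1 * (pts k i).2| ≤ D * |sig|⁻¹ ^ k := fun i hi => by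
    rw [abs_mul, hD, mul_assoc]
    refine mul_le_mul_of_nonneg_left ?_ hC0.le
    calc |(pts k i).1| * |(pts k i).2|
        ≤ (2 * B * |sig|⁻¹ ^ i) * (2 * B * |sig| * |sig|⁻¹ ^ k * |sig| ^ i) :=
          mul_le_mul (horb i hi).1 (horb i hi).2 (abs_nonneg _) (by positivity)
      _ = 4 * B ^ 2 * |sig| * |sig|⁻¹ ^ k := by
          rw [inv_pow _ i]; field_simp; ring
      _ ≤ _ := by gcongr
  refine matProd_bounds hsig hls hD0.le (le_of_eq_of_le (by ring) hk1)
    (fun i hi => (hjac i hi).1.trans (hprod i hi)) (fun i hi => (hjac i hi).2.1.trans ?_)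
    (fun i hi => (hjac i hi).2.2.1.trans ?_)
    (fun i hi => (hjac i hi).2.2.2.trans (hprod i hi)) hj
  · rw [hD, mul_assoc]
    refine mul_le_mul_of_nonneg_left ?_ hC0.le
    calc |(pts k i).1| ^ 2 ≤ (2 * B * |sig|⁻¹ ^ i) ^ 2 := by gcongr; exact (horb i hi).1
      _ = 4 * B ^ 2 * 1 * (|sig|⁻¹ ^ i) ^ 2 := by ring
      _ ≤ _ := by gcongr
  · rw [hD, mul_assoc, mul_assoc]
    refine mul_le_mul_of_nonneg_left ?_ hC0.le
    calc |(pts k i).2| ^ 2 ≤ (2 * B * |sig| * |sig|⁻¹ ^ k * |sig| ^ i) ^ 2 := by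
          gcongr; exact (horb i hi).2
      _ = _ := by ring
end
end

section
/- Suppose |λσ| ≤ 1 and set δ = (2^{1/3} − 1)/(2R). For k ≥ 1 and (x,y) with xy ≠ 0, define F_k(x,y) and G_k(x,y) by writing the k-th iterate T₀^k(x,y) = (λ^k x (1 + x y F_k(x,y)), σ^k y (1 + x y G_k(x,y))). Then for every k ≥ 1 and every (x,y) with xy ≠ 0 such that k|xy| ≤ δ and T₀^j(x,y) ∈ N for all j = 0,…,k−1, one has |F_k(x,y)| ≤ 2kR and |G_k(x,y)| ≤ 2kR. -/
noncomputable section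

/-- Three factors of absolute value at most the cube root of `2` have a product of absolute value
at most `2`. -/
theorem abs_mul_mul_le_two {u v w a : ℝ} (ha : a ^ 3 = 2) (hu : |u| ≤ a) (hv : |v| ≤ a)
    (hw : |w| ≤ a) : |u * v * w| ≤ 2 := by
  have ha0 : 0 ≤ a := (abs_nonneg u).trans hu
  calc |u * v * w| = |u| * |v| * |w| := by rw [abs_mul, abs_mul]
    _ ≤ a * a * a := by gcongr
    _ = 2 := by rw [← ha]; ring

/-- A resonance coefficient grows by at most `2 * R` in one iteration step. -/
theorem abs_add_resonance_le {A u v w a ρ H R B : ℝ} (ha : a ^ 3 = 2) (hu : |u| ≤ a)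
    (hv : |v| ≤ a) (hw : |w| ≤ a) (hρ : |ρ| ≤ 1) (hH : |H| ≤ R) (hA : |A| ≤ B) :
    |A + ρ * (u * v * w) * H| ≤ B + 2 * R := by
  have h2 := abs_mul_mul_le_two ha hu hv hw
  have hinc : |ρ * (u * v * w) * H| ≤ 2 * R :=
    calc |ρ * (u * v * w) * H| = |ρ| * |u * v * w| * |H| := by rw [abs_mul, abs_mul ρ]
      _ ≤ 1 * 2 * R := by gcongr
      _ = 2 * R := by ring
  exact (abs_add_le _ _).trans (add_le_add hA hinc)

/-- A coefficient `A` of size at most `2 * j * R` with `j ≤ k` keeps `|1 + m * A|` below `a` as soon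
as `k * |m| ≤ (a - 1) / (2 * R)`. -/
theorem abs_one_add_mul_le {m A R a j k : ℝ} (hR : 0 < R) (hjk : j ≤ k)
    (hm : k * |m| ≤ (a - 1) / (2 * R)) (hA : |A| ≤ 2 * j * R) : |1 + m * A| ≤ a := by
  rw [le_div_iff₀ (by positivity)] at hm
  have hmA : |m * A| ≤ a - 1 :=
    calc |m * A| = |m| * |A| := abs_mul _ _
      _ ≤ |m| * (2 * k * R) := by
        gcongr
        exact hA.trans (by gcongr)
      _ = k * |m| * (2 * R) := by ring
      _ ≤ a - 1 := hm
  have h := abs_add_le 1 (m * A)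
  rw [abs_one] at h
  linarith

theorem iterate_resonance_bounds
    (T₀ : ℝ × ℝ → ℝ × ℝ) (F G : ℝ × ℝ → ℝ)
    (lam sig R : ℝ) (N : Set (ℝ × ℝ))
    (hF : ContDiff ℝ (⊤ : ℕ∞) F) (hG : ContDiff ℝ (⊤ : ℕ∞) G)
    (hlam0 : 0 < |lam|) (hlam1 : |lam| < 1) (hsig : 1 < |sig|)
    (hT₀ : ∀ p : ℝ × ℝ, T₀ p =
      (lam * p.1 * (1 + p.1 * p.2 * F p), sig * p.2 * (1 + p.1 * p.2 * G p)))
    (hNopen : IsOpen N) (hNconv : Convex ℝ N) (hNbdd : Bornology.IsBounded N)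
    (hN0 : ((0 : ℝ), (0 : ℝ)) ∈ N)
    (hR : 0 < R) (hFGb : ∀ p ∈ N, |F p| ≤ R ∧ |G p| ≤ R)
    (hls : |lam * sig| ≤ 1) :
    ∀ k : ℕ, 1 ≤ k → ∀ x y : ℝ, x * y ≠ 0 →
      (k : ℝ) * |x * y| ≤ ((2 : ℝ) ^ ((1 : ℝ) / 3) - 1) / (2 * R) →
      (∀ j < k, T₀^[j] (x, y) ∈ N) →
      ∃ Fk Gk : ℝ,
        T₀^[k] (x, y) =
          (lam ^ k * x * (1 + x * y * Fk), sig ^ k * y * (1 + x * y * Gk)) ∧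
        |Fk| ≤ 2 * k * R ∧ |Gk| ≤ 2 * k * R := by
  intro k _ x y _ hk hN
  set a : ℝ := (2 : ℝ) ^ ((1 : ℝ) / 3) with ha_def
  have ha : a ^ 3 = 2 := by
    rw [ha_def, ← Real.rpow_natCast, ← Real.rpow_mul (by norm_num)]
    norm_num
  suffices h : ∀ j ≤ k, ∃ A B : ℝ,
      T₀^[j] (x, y) = (lam ^ j * x * (1 + x * y * A), sig ^ j * y * (1 + x * y * B)) ∧
      |A| ≤ 2 * j * R ∧ |B| ≤ 2 * j * R from h k le_rfl
  intro j
  induction j with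
  | zero => exact fun _ => ⟨0, 0, by simp, by simp, by simp⟩
  | succ j ih =>
    intro hj
    obtain ⟨A, B, hT, hA, hB⟩ := ih (by omega)
    obtain ⟨hFp, hGp⟩ := hFGb _ (hN j (by omega))
    have hjk : (j : ℝ) ≤ k := by exact_mod_cast (by omega : j ≤ k)
    have hu := abs_one_add_mul_le hR hjk hk hA
    have hv := abs_one_add_mul_le hR hjk hk hB
    have hρ : |(lam * sig) ^ j| ≤ 1 := by
      rw [abs_pow]
      exact pow_le_one₀ (abs_nonneg _) hls
    set p := T₀^[j] (x, y)
    refine ⟨A + (lam * sig) ^ j *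
        ((1 + x * y * A) * (1 + x * y * A) * (1 + x * y * B)) * F p,
      B + (lam * sig) ^ j *
        ((1 + x * y * A) * (1 + x * y * B) * (1 + x * y * B)) * G p, ?_, ?_, ?_⟩
    · have h1 : p.1 = lam ^ j * x * (1 + x * y * A) := by rw [hT]
      have h2 : p.2 = sig ^ j * y * (1 + x * y * B) := by rw [hT]
      rw [Function.iterate_succ_apply', hT₀]
      change (lam * p.1 * (1 + p.1 * p.2 * F p), sig * p.2 * (1 + p.1 * p.2 * G p)) = _
      rw [h1, h2, mul_pow]
      ext <;> ring
    · exact (abs_add_resonance_le ha hu hu hv hρ hFp hA).trans_eq (by push_cast; ring)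
    · exact (abs_add_resonance_le ha hu hv hv hρ hGp hB).trans_eq (by push_cast; ring)
end
end
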